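/- arXiv:1907.09129 — 2 statements merged into one kernel-verified Lean document; each statement's English description precedes it below -/
import Mathlib

section
/- Let α > 0 be a real number. Then as x → ∞, Σ_{√x < p ≤ √x (log x)^{4/α}, p prime} 1/(p^{2α+1} log(x/p)) = (2/α)·1/(x^α (log x)^2) + O(1/(x^α (log x)^4)). -/
open Filter Finset

namespace StrongPNT

open Complex Topology

/-- The entire function `(s - 1) ζ(s)`. -/
noncomputable def zetaReg : ℂ → ℂ :=
  Function.update (fun s : ℂ => (s - 1) * riemannZeta s) 1 1

lemma zetaReg_one : zetaReg 1 = 1 := by simp [zetaReg]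

lemma zetaReg_of_ne {s : ℂ} (hs : s ≠ 1) : zetaReg s = (s - 1) * riemannZeta s := by
  simp [zetaReg, hs]

lemma zetaReg_eventuallyEq {s : ℂ} (hs : s ≠ 1) :
    zetaReg =ᶠ[𝓝 s] fun s => (s - 1) * riemannZeta s := by
  filter_upwards [isOpen_ne.mem_nhds hs] with z hz using zetaReg_of_ne hz

lemma differentiableAt_zetaReg_of_ne {s : ℂ} (hs : s ≠ 1) : DifferentiableAt ℂ zetaReg s := by
  refine DifferentiableAt.congr_of_eventuallyEq ?_ (zetaReg_eventuallyEq hs)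
  exact (differentiableAt_id.sub_const 1).mul (differentiableAt_riemannZeta hs)

lemma differentiable_zetaReg : Differentiable ℂ zetaReg := by
  intro s
  rcases eq_or_ne s 1 with rfl | hs
  · refine (analyticAt_of_differentiable_on_punctured_nhds_of_continuousAt ?_ ?_).differentiableAt
    · filter_upwards [self_mem_nhdsWithin] with z hz using differentiableAt_zetaReg_of_ne hz
    · exact continuousAt_update_same.mpr riemannZeta_residue_one
  · exact differentiableAt_zetaReg_of_ne hs

lemma zetaReg_ne_zero {s : ℂ} (hs : 1 ≤ s.re) : zetaReg s ≠ 0 := by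
  rcases eq_or_ne s 1 with rfl | h
  · simp [zetaReg_one]
  · rw [zetaReg_of_ne h]
    exact mul_ne_zero (sub_ne_zero.mpr h) (riemannZeta_ne_zero_of_one_le_re hs)

/-- Euler–Maclaurin terms of `(s - 1) ζ(s)`. -/
noncomputable def emTerm (n : ℕ) (s : ℂ) : ℂ :=
  (s - 1) * ((n + 1 : ℝ) : ℂ) ^ (-s) - ((n + 1 : ℝ) : ℂ) ^ (1 - s) + ((n + 2 : ℝ) : ℂ) ^ (1 - s)

lemma norm_cpow_sub_le {n : ℕ} {s : ℂ} (hs : 0 < s.re) {u : ℝ} (hu : u ∈ Set.Icc (n + 1 : ℝ) (n + 2)) :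
    ‖((n + 1 : ℝ) : ℂ) ^ (-s) - (u : ℂ) ^ (-s)‖ ≤ ‖s‖ * (n + 1 : ℝ) ^ (-s.re - 1) := by
  have hn : (0 : ℝ) < n + 1 := by positivity
  have key := (convex_Icc (n + 1 : ℝ) (n + 2)).norm_image_sub_le_of_norm_hasDerivWithin_le
    (f := fun u : ℝ => (u : ℂ) ^ (-s)) (f' := fun u : ℝ => (-s) * (u : ℂ) ^ (-s - 1))
    (C := ‖s‖ * (n + 1 : ℝ) ^ (-s.re - 1)) (x := u) (y := n + 1)
    (fun x hx => (hasDerivAt_ofReal_cpow_const (by linarith [hx.1])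
      (by intro h; simp [neg_eq_zero.mp h] at hs)).hasDerivWithinAt)
    (fun x hx => by
      rw [norm_mul, norm_neg, norm_cpow_eq_rpow_re_of_pos (by linarith [hx.1])]
      simp only [sub_re, neg_re, one_re]
      gcongr 1
      exact Real.rpow_le_rpow_of_nonpos hn hx.1 (by linarith)) hu ⟨le_rfl, by linarith⟩
  refine key.trans ?_
  have : ‖(n + 1 : ℝ) - u‖ ≤ 1 := by
    rw [Real.norm_eq_abs, abs_le]; constructor <;> linarith [hu.1, hu.2]
  exact mul_le_of_le_one_right (by positivity) this

lemma norm_emTerm_le (n : ℕ) {s : ℂ} (hs : 0 < s.re) :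
    ‖emTerm n s‖ ≤ ‖s - 1‖ * ‖s‖ * (n + 1 : ℝ) ^ (-s.re - 1) := by
  rcases eq_or_ne s 1 with rfl | h1
  · simp [emTerm]
  have hn : (0 : ℝ) < n + 1 := by positivity
  have key := (convex_Icc (n + 1 : ℝ) (n + 2)).norm_image_sub_le_of_norm_hasDerivWithin_le
    (f := fun u : ℝ => (s - 1) * (((n + 1 : ℝ) : ℂ) ^ (-s) * (u - (n + 1 : ℝ)))
      + (u : ℂ) ^ (1 - s))
    (f' := fun u : ℝ => (s - 1) * (((n + 1 : ℝ) : ℂ) ^ (-s) * 1) + (1 - s) * (u : ℂ) ^ (1 - s - 1))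
    (C := ‖s - 1‖ * ‖s‖ * (n + 1 : ℝ) ^ (-s.re - 1)) (x := n + 1) (y := n + 2)
    (fun x hx => by
      refine HasDerivAt.hasDerivWithinAt ?_
      refine HasDerivAt.add ?_ (hasDerivAt_ofReal_cpow_const (by linarith [hx.1]) ?_)
      · exact (((hasDerivAt_id x).ofReal_comp.sub_const _).const_mul _).const_mul _
      · rwa [sub_ne_zero, ne_comm])
    (fun x hx => by
      have : (s - 1) * (((n + 1 : ℝ) : ℂ) ^ (-s) * 1) + (1 - s) * (x : ℂ) ^ (1 - s - 1)
          = (s - 1) * (((n + 1 : ℝ) : ℂ) ^ (-s) - (x : ℂ) ^ (-s)) := by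
        rw [show (1 - s - 1 : ℂ) = -s by ring]; ring
      rw [this, norm_mul, mul_assoc]
      gcongr
      exact norm_cpow_sub_le hs hx) ⟨le_rfl, by linarith⟩ ⟨by linarith, le_rfl⟩
  have e : ‖(n + 2 : ℝ) - (n + 1)‖ = 1 := by norm_num
  rw [e, mul_one] at key
  refine le_of_eq_of_le ?_ key
  congr 1
  simp only [emTerm]
  push_cast
  ring

lemma sum_emTerm (N : ℕ) (s : ℂ) :
    ∑ n ∈ range N, emTerm n s =
      (s - 1) * ∑ n ∈ range N, ((n + 1 : ℝ) : ℂ) ^ (-s) - 1 + ((N + 1 : ℝ) : ℂ) ^ (1 - s) := by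
  induction N with
  | zero => simp
  | succ N ih =>
    rw [sum_range_succ, sum_range_succ, ih, emTerm]
    push_cast
    rw [show (N : ℂ) + 1 + 1 = N + 2 by ring]
    ring

lemma summable_rpow_shift {a : ℝ} (ha : 0 < a) : Summable fun n : ℕ => (n + 1 : ℝ) ^ (-a - 1) := by
  have := (summable_nat_add_iff 1).mpr (Real.summable_nat_rpow.mpr (by linarith : -a - 1 < -1))
  simpa using this

lemma summable_emTerm {s : ℂ} (hs : 0 < s.re) : Summable fun n => emTerm n s :=
  .of_norm_bounded ((summable_rpow_shift hs).mul_left _) fun n => norm_emTerm_le n hs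

lemma differentiable_emTerm (n : ℕ) : Differentiable ℂ (emTerm n) := by
  unfold emTerm
  have h1 : ((n + 1 : ℝ) : ℂ) ≠ 0 := by exact_mod_cast (by positivity : (n + 1 : ℝ) ≠ 0)
  have h2 : ((n + 2 : ℝ) : ℂ) ≠ 0 := by exact_mod_cast (by positivity : (n + 2 : ℝ) ≠ 0)
  refine ((Differentiable.mul (by fun_prop) ?_).sub ?_).add ?_
  · exact Differentiable.const_cpow (by fun_prop) (.inl h1)
  · exact Differentiable.const_cpow (by fun_prop) (.inl h1)
  · exact Differentiable.const_cpow (by fun_prop) (.inl h2)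

lemma zetaReg_eq_of_one_lt_re {s : ℂ} (hs : 1 < s.re) : zetaReg s = 1 + ∑' n, emTerm n s := by
  have h1 : s ≠ 1 := by rintro rfl; simp at hs
  have hz : HasSum (fun n : ℕ => ((n + 1 : ℝ) : ℂ) ^ (-s)) (riemannZeta s) := by
    have hsum : Summable fun n : ℕ => ((n + 1 : ℝ) : ℂ) ^ (-s) := by
      refine .of_norm ?_
      have := summable_rpow_shift (a := s.re - 1) (by linarith)
      refine this.congr fun n => ?_
      rw [norm_cpow_eq_rpow_re_of_pos (by positivity)]
      simp
    rw [zeta_eq_tsum_one_div_nat_add_one_cpow hs]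
    convert hsum.hasSum using 3 with n
    rw [cpow_neg, one_div]; push_cast; rfl
  have ht : Tendsto (fun N : ℕ => ((N + 1 : ℝ) : ℂ) ^ (1 - s)) atTop (𝓝 0) := by
    rw [tendsto_zero_iff_norm_tendsto_zero]
    have : Tendsto (fun N : ℕ => (N + 1 : ℝ) ^ (-(s.re - 1))) atTop (𝓝 0) :=
      (tendsto_rpow_neg_atTop (by linarith)).comp
        (tendsto_atTop_add_const_right _ _ tendsto_natCast_atTop_atTop)
    refine this.congr fun N => ?_
    rw [norm_cpow_eq_rpow_re_of_pos (by positivity)]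
    simp
  have h2 := (summable_emTerm (by linarith : 0 < s.re)).hasSum.tendsto_sum_nat
  simp_rw [sum_emTerm] at h2
  have h3 := ((hz.tendsto_sum_nat.const_mul (s - 1)).sub_const 1).add ht
  have := tendsto_nhds_unique h2 h3
  rw [this, zetaReg_of_ne h1]
  ring

lemma zetaReg_eq {s : ℂ} (hs : 0 < s.re) : zetaReg s = 1 + ∑' n, emTerm n s := by
  have hopen : IsOpen {z : ℂ | 0 < z.re} := isOpen_lt continuous_const continuous_re
  have hconv : Convex ℝ {z : ℂ | 0 < z.re} := convex_halfSpace_re_gt 0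
  have hdiff : DifferentiableOn ℂ (fun s => 1 + ∑' n, emTerm n s) {z : ℂ | 0 < z.re} := by
    intro s hs
    have hs' : 0 < s.re := hs
    set a := s.re / 2 with ha
    have ha0 : 0 < a := by positivity
    set U : Set ℂ := {z : ℂ | a < z.re} ∩ Metric.ball 0 (‖s‖ + 1) with hU
    have hUo : IsOpen U := (isOpen_lt continuous_const continuous_re).inter Metric.isOpen_ball
    have hsU : s ∈ U := ⟨by change a < s.re; linarith, by simp⟩
    have hd : DifferentiableOn ℂ (fun w => ∑' n, emTerm n w) U := by
      refine differentiableOn_tsum_of_summable_norm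
        (u := fun n : ℕ => (‖s‖ + 2) * (‖s‖ + 1) * (n + 1 : ℝ) ^ (-a - 1))
        ((summable_rpow_shift ha0).mul_left _)
        (fun n => (differentiable_emTerm n).differentiableOn) hUo ?_
      rintro n w ⟨hw1, hw2⟩
      have hw1 : a < w.re := hw1
      have hw2 : ‖w‖ < ‖s‖ + 1 := by simpa using hw2
      refine (norm_emTerm_le n (by linarith)).trans ?_
      have : ‖w - 1‖ ≤ ‖s‖ + 2 := by
        refine (norm_sub_le _ _).trans ?_
        rw [norm_one]; linarith
      gcongr
      · linarith
    exact ((hd.differentiableAt (hUo.mem_nhds hsU)).const_add 1).differentiableWithinAt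
  refine AnalyticOnNhd.eqOn_of_preconnected_of_eventuallyEq
    (differentiable_zetaReg.differentiableOn.analyticOnNhd hopen) (hdiff.analyticOnNhd hopen)
    hconv.isPreconnected (z₀ := 2) (by simp) ?_ hs
  have : {z : ℂ | 1 < z.re} ∈ 𝓝 (2 : ℂ) :=
    (isOpen_lt continuous_const continuous_re).mem_nhds (by simp)
  filter_upwards [this] with z hz using zetaReg_eq_of_one_lt_re hz

lemma sum_rpow_neg_le {b : ℝ} (hb0 : 0 < b) (hb1 : b < 1) (N : ℕ) :
    ∑ n ∈ range N, (n + 1 : ℝ) ^ (-b) ≤ 1 / (1 - b) * (N : ℝ) ^ (1 - b) := by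
  have hb : 0 < 1 - b := by linarith
  induction N with
  | zero => simp [Real.zero_rpow hb.ne']
  | succ N ih =>
    rw [sum_range_succ]
    have hN : (0 : ℝ) < N + 1 := by positivity
    have h1 := rpow_one_add_le_one_add_mul_self (s := -1 / (N + 1 : ℝ)) (p := 1 - b)
      (by rw [le_div_iff₀ hN]; nlinarith [(Nat.cast_nonneg N : (0 : ℝ) ≤ N)]) hb.le (by linarith)
    have h2 : (N : ℝ) ^ (1 - b) = (N + 1 : ℝ) ^ (1 - b) * (1 + -1 / (N + 1 : ℝ)) ^ (1 - b) := by
      rw [← Real.mul_rpow hN.le]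
      · congr 1; field_simp; ring
      · rw [show 1 + -1 / (N + 1 : ℝ) = N / (N + 1) by field_simp; ring]; positivity
    have h3 : (N + 1 : ℝ) ^ (1 - b) = (N + 1 : ℝ) ^ (-b) * (N + 1) := by
      rw [← Real.rpow_add_one hN.ne']; congr 1; ring
    have h4 : (N : ℝ) ^ (1 - b) ≤ (N + 1 : ℝ) ^ (1 - b) - (1 - b) * (N + 1 : ℝ) ^ (-b) := by
      rw [h2]
      calc _ ≤ (N + 1 : ℝ) ^ (1 - b) * (1 + (1 - b) * (-1 / (N + 1 : ℝ))) := by gcongr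
        _ = _ := by rw [h3]; field_simp; ring
    push_cast
    have h5 : 1 / (1 - b) * (N : ℝ) ^ (1 - b)
        ≤ 1 / (1 - b) * ((N + 1 : ℝ) ^ (1 - b) - (1 - b) * (N + 1 : ℝ) ^ (-b)) := by gcongr
    have h6 : 1 / (1 - b) * ((N + 1 : ℝ) ^ (1 - b) - (1 - b) * (N + 1 : ℝ) ^ (-b))
      = 1 / (1 - b) * (N + 1 : ℝ) ^ (1 - b) - (N + 1 : ℝ) ^ (-b) := by field_simp
    linarith

lemma rpow_neg_sub_one_le {a x : ℝ} (ha : 0 < a) (hx : 0 < x) :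
    (x + 1) ^ (-a - 1) ≤ 1 / a * (x ^ (-a) - (x + 1) ^ (-a)) := by
  have hx1 : 0 < x + 1 := by linarith
  have h1 : x / (x + 1) ≤ Real.exp (-(1 / (x + 1))) := by
    have := Real.add_one_le_exp (-(1 / (x + 1)))
    refine le_trans (le_of_eq ?_) this
    field_simp; ring
  have h2 : 1 + a / (x + 1) ≤ (x / (x + 1)) ^ (-a) := by
    calc 1 + a / (x + 1) ≤ Real.exp (a / (x + 1)) := by
          linarith [Real.add_one_le_exp (a / (x + 1))]
      _ = (Real.exp (-(1 / (x + 1)))) ^ (-a) := by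
          rw [← Real.exp_mul]; congr 1; field_simp
      _ ≤ _ := Real.rpow_le_rpow_of_nonpos (by positivity) h1 (by linarith)
  have h3 : x ^ (-a) = (x + 1) ^ (-a) * (x / (x + 1)) ^ (-a) := by
    rw [← Real.mul_rpow hx1.le (by positivity)]; congr 1; field_simp
  have h4 : (x + 1) ^ (-a - 1) = (x + 1) ^ (-a) / (x + 1) := by
    rw [Real.rpow_sub_one hx1.ne']
  rw [h3, h4]
  calc (x + 1) ^ (-a) / (x + 1) = 1 / a * ((x + 1) ^ (-a) * (1 + a / (x + 1)) - (x + 1) ^ (-a)) := by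
        field_simp; ring
    _ ≤ _ := by gcongr

lemma tsum_rpow_tail_le {a : ℝ} (ha : 0 < a) {N : ℕ} (hN : 0 < N) :
    ∑' n : ℕ, ((n + N : ℕ) + 1 : ℝ) ^ (-a - 1) ≤ 1 / a * (N : ℝ) ^ (-a) := by
  have hN' : (0 : ℝ) < N := by exact_mod_cast hN
  refine Real.tsum_le_of_sum_range_le (fun n => by positivity) fun M => ?_
  have : ∑ n ∈ range M, ((n + N : ℕ) + 1 : ℝ) ^ (-a - 1)
      ≤ 1 / a * ((N : ℝ) ^ (-a) - ((M + N : ℕ) : ℝ) ^ (-a)) := by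
    induction M with
    | zero => simp
    | succ M ih =>
      rw [sum_range_succ]
      have := rpow_neg_sub_one_le ha (by positivity : (0 : ℝ) < (M + N : ℕ))
      have e : ((M + 1 + N : ℕ) : ℝ) = ((M + N : ℕ) : ℝ) + 1 := by push_cast; ring
      rw [e]
      linarith
  refine this.trans ?_
  gcongr
  have : 0 ≤ ((M + N : ℕ) : ℝ) ^ (-a) := by positivity
  linarith

lemma norm_zetaReg_le_aux {s : ℂ} {b : ℝ} (hb0 : 0 < b) (hb1 : b < 1) (hs : b ≤ s.re) {N : ℕ}
    (hN : 0 < N) :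
    ‖zetaReg s‖ ≤ ‖s - 1‖ * (1 / (1 - b) * (N : ℝ) ^ (1 - b)) + (N + 1 : ℝ) ^ (1 - b) +
      ‖s - 1‖ * ‖s‖ * (1 / b * (N : ℝ) ^ (-b)) := by
  have hs0 : 0 < s.re := by linarith
  rw [zetaReg_eq hs0, ← (summable_emTerm hs0).sum_add_tsum_nat_add N, sum_emTerm]
  have e : ∀ a b c : ℂ, 1 + (a - 1 + b + c) = a + b + c := by intros; ring
  rw [e]
  refine norm_add₃_le.trans ?_
  gcongr
  · rw [norm_mul]
    gcongr
    refine (norm_sum_le _ _).trans (le_trans ?_ (sum_rpow_neg_le hb0 hb1 N))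
    refine sum_le_sum fun n _ => ?_
    rw [norm_cpow_eq_rpow_re_of_pos (by positivity)]
    refine Real.rpow_le_rpow_of_exponent_le ?_ (by simpa using hs)
    have : (0 : ℝ) ≤ n := by positivity
    linarith
  · rw [norm_cpow_eq_rpow_re_of_pos (by positivity)]
    refine Real.rpow_le_rpow_of_exponent_le ?_ (by simp; linarith)
    have : (0 : ℝ) ≤ N := by positivity
    linarith
  · have hb : ∀ n : ℕ, ‖emTerm (n + N) s‖ ≤ ‖s - 1‖ * ‖s‖ * ((n + N : ℕ) + 1 : ℝ) ^ (-b - 1) := by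
      intro n
      refine (norm_emTerm_le (n + N) hs0).trans ?_
      gcongr
      have : (0 : ℝ) ≤ (n + N : ℕ) := by positivity
      linarith
    have hsum : Summable fun n : ℕ => ((n + N : ℕ) + 1 : ℝ) ^ (-b - 1) :=
      (summable_nat_add_iff N).mpr (summable_rpow_shift hb0)
    refine (tsum_of_norm_bounded (hsum.mul_left _).hasSum hb).trans ?_
    rw [tsum_mul_left]
    gcongr
    exact tsum_rpow_tail_le hb0 hN

/-- The height `1 + |Im s|`. -/
noncomputable def ht (s : ℂ) : ℝ := 1 + |s.im|

lemma one_le_ht (s : ℂ) : 1 ≤ ht s := by simp [ht]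

lemma ht_pos (s : ℂ) : 0 < ht s := by linarith [one_le_ht s]

lemma norm_le_mul_ht {s : ℂ} {A : ℝ} (hA : 1 ≤ A) (h : |s.re| ≤ A) : ‖s‖ ≤ A * ht s := by
  refine (norm_le_abs_re_add_abs_im s).trans ?_
  unfold ht
  nlinarith [abs_nonneg s.im]

lemma ht_le_two_mul {s z : ℂ} {r : ℝ} (hr : r ≤ 1) (h : ‖z - s‖ ≤ r) : ht z ≤ 2 * ht s := by
  have h1 : |z.im - s.im| ≤ r := by simpa using (abs_im_le_norm (z - s)).trans h
  have h2 : |z.im| ≤ |s.im| + |z.im - s.im| := by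
    calc |z.im| = |s.im + (z.im - s.im)| := by ring_nf
      _ ≤ _ := abs_add_le _ _
  unfold ht
  linarith [abs_nonneg s.im]

lemma exists_norm_zetaReg_le :
    ∃ C : ℝ, 0 < C ∧ ∀ s : ℂ, 49 / 50 ≤ s.re → s.re ≤ 4 →
      ‖zetaReg s‖ ≤ C * (ht s * ht s ^ (1 / 50 : ℝ)) := by
  refine ⟨4 * (50 * 2) + 3 + 4 * 4 * 2, by norm_num, fun s h1 h2 => ?_⟩
  set T := ht s with hT
  have hT1 : 1 ≤ T := one_le_ht s
  have hT0 : 0 < T := by linarith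
  have hN : 0 < ⌈T⌉₊ := Nat.ceil_pos.mpr hT0
  have hN1 : T ≤ ⌈T⌉₊ := Nat.le_ceil T
  have hN2 : (⌈T⌉₊ : ℝ) ≤ 2 * T := by linarith [Nat.ceil_lt_add_one hT0.le]
  have key := norm_zetaReg_le_aux (b := 49 / 50) (by norm_num) (by norm_num) h1 hN
  set N := ⌈T⌉₊
  have hN0 : (0 : ℝ) < N := by exact_mod_cast hN
  have hs1 : ‖s - 1‖ ≤ 4 * T := by
    have := norm_le_mul_ht (s := s - 1) (A := 4) (by norm_num)
      (by rw [abs_le]; simp; constructor <;> linarith)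
    simpa [hT, ht] using this
  have hs : ‖s‖ ≤ 4 * T := norm_le_mul_ht (by norm_num) (by rw [abs_le]; constructor <;> linarith)
  have e1 : (1 : ℝ) - 49 / 50 = 1 / 50 := by norm_num
  rw [e1] at key
  have pw : ∀ k : ℝ, 1 ≤ k → k ^ (1 / 50 : ℝ) ≤ k := fun k hk => by
    simpa using Real.rpow_le_rpow_of_exponent_le hk (by norm_num : (1 / 50 : ℝ) ≤ 1)
  have hA : (N : ℝ) ^ (1 / 50 : ℝ) ≤ 2 * T ^ (1 / 50 : ℝ) := by
    calc (N : ℝ) ^ (1 / 50 : ℝ) ≤ (2 * T) ^ (1 / 50 : ℝ) := by gcongr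
      _ = 2 ^ (1 / 50 : ℝ) * T ^ (1 / 50 : ℝ) := Real.mul_rpow (by norm_num) hT0.le
      _ ≤ _ := by gcongr; exact pw 2 (by norm_num)
  have hB : (N + 1 : ℝ) ^ (1 / 50 : ℝ) ≤ 3 * T ^ (1 / 50 : ℝ) := by
    calc (N + 1 : ℝ) ^ (1 / 50 : ℝ) ≤ (3 * T) ^ (1 / 50 : ℝ) := by gcongr; linarith
      _ = 3 ^ (1 / 50 : ℝ) * T ^ (1 / 50 : ℝ) := Real.mul_rpow (by norm_num) hT0.le
      _ ≤ _ := by gcongr; exact pw 3 (by norm_num)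
  have hC : (N : ℝ) ^ (-(49 / 50) : ℝ) ≤ T ^ (1 / 50 : ℝ) / T := by
    rw [← Real.rpow_sub_one hT0.ne']
    norm_num
    exact Real.rpow_le_rpow_of_nonpos hT0 hN1 (by norm_num)
  have hTT : T ^ (1 / 50 : ℝ) ≤ T * T ^ (1 / 50 : ℝ) := le_mul_of_one_le_left (by positivity) hT1
  calc ‖zetaReg s‖ ≤ _ := key
    _ ≤ 4 * T * (1 / (1 / 50) * (2 * T ^ (1 / 50 : ℝ))) + 3 * T ^ (1 / 50 : ℝ)
        + 4 * T * (4 * T) * (1 / (49 / 50) * (T ^ (1 / 50 : ℝ) / T)) := by gcongr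
    _ = 400 * (T * T ^ (1 / 50 : ℝ)) + 3 * T ^ (1 / 50 : ℝ)
        + 16 * (50 / 49) * (T * T ^ (1 / 50 : ℝ)) := by field_simp; ring
    _ ≤ _ := by nlinarith [mul_pos hT0 (Real.rpow_pos_of_pos hT0 (1 / 50))]

lemma exists_norm_deriv_zetaReg_le :
    ∃ C : ℝ, 0 < C ∧ ∀ s : ℂ, 99 / 100 ≤ s.re → s.re ≤ 3 →
      ‖deriv zetaReg s‖ ≤ C * (ht s * ht s ^ (1 / 50 : ℝ)) := by
  obtain ⟨C, hC, h⟩ := exists_norm_zetaReg_le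
  refine ⟨C * 4 / (1 / 100), by positivity, fun s h1 h2 => ?_⟩
  have key := norm_deriv_le_of_forall_mem_sphere_norm_le (c := s) (R := 1 / 100)
    (C := C * 4 * (ht s * ht s ^ (1 / 50 : ℝ))) (f := zetaReg) (by norm_num)
    differentiable_zetaReg.diffContOnCl (fun z hz => ?_)
  · refine key.trans (le_of_eq (by ring))
  · have hz : ‖z - s‖ = 1 / 100 := by simpa [dist_eq_norm] using hz
    have hre : |z.re - s.re| ≤ 1 / 100 := by simpa [hz] using abs_re_le_norm (z - s)
    rw [abs_le] at hre
    have hht := ht_le_two_mul (by norm_num) hz.le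
    have := ht_pos s
    have := ht_pos z
    calc ‖zetaReg z‖ ≤ _ := h z (by linarith) (by linarith)
      _ ≤ C * ((2 * ht s) * (2 * ht s) ^ (1 / 50 : ℝ)) := by gcongr
      _ = C * (2 * ht s * (2 ^ (1 / 50 : ℝ) * ht s ^ (1 / 50 : ℝ))) := by
        rw [Real.mul_rpow (by norm_num) (by positivity)]
      _ ≤ C * (2 * ht s * (2 * ht s ^ (1 / 50 : ℝ))) := by
        gcongr
        simpa using Real.rpow_le_rpow_of_exponent_le (by norm_num : (1 : ℝ) ≤ 2)
          (by norm_num : (1 / 50 : ℝ) ≤ 1)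
      _ = _ := by ring

lemma zetaReg_product_ge {x : ℝ} (hx : 0 < x) {y : ℝ} (hy : y ≠ 0) :
    x ^ 3 * |y| ^ 5 ≤ ‖zetaReg (1 + x)‖ ^ 3 * ‖zetaReg (1 + x + I * y)‖ ^ 4 *
      ‖zetaReg (1 + x + 2 * I * y)‖ := by
  have key := DirichletCharacter.norm_LFunction_product_ge_one (1 : DirichletCharacter ℂ 1) hx y
  rw [DirichletCharacter.LFunctionTrivChar, DirichletCharacter.LFunction_modOne_eq,
    DirichletCharacter.LFunction_modOne_eq] at key
  have n1 : (1 + x : ℂ) ≠ 1 := fun h => by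
    have := congrArg re h; simp at this; linarith
  have n2 : (1 + x + I * y : ℂ) ≠ 1 := fun h => by
    have := congrArg im h; simp at this; exact hy this
  have n3 : (1 + x + 2 * I * y : ℂ) ≠ 1 := fun h => by
    have := congrArg im h; simp at this; exact hy this
  rw [zetaReg_of_ne n1, zetaReg_of_ne n2, zetaReg_of_ne n3]
  simp only [norm_mul, norm_pow, mul_pow] at key ⊢
  have a1 : ‖(1 + x : ℂ) - 1‖ = x := by simp [abs_of_pos hx]
  have a2 : |y| ≤ ‖(1 + x + I * y : ℂ) - 1‖ := by
    simpa using abs_im_le_norm ((1 + x + I * y : ℂ) - 1)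
  have a3 : |y| ≤ ‖(1 + x + 2 * I * y : ℂ) - 1‖ := by
    refine le_trans ?_ (abs_im_le_norm ((1 + x + 2 * I * y : ℂ) - 1))
    simp [abs_mul]
    linarith [abs_nonneg y]
  rw [a1]
  calc x ^ 3 * |y| ^ 5 = x ^ 3 * |y| ^ 4 * |y| * 1 := by ring
    _ ≤ x ^ 3 * ‖(1 + x + I * y : ℂ) - 1‖ ^ 4 * ‖(1 + x + 2 * I * y : ℂ) - 1‖ *
        (‖riemannZeta (1 + x)‖ ^ 3 * ‖riemannZeta (1 + x + I * y)‖ ^ 4 *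
          ‖riemannZeta (1 + x + 2 * I * y)‖) := by
        gcongr
    _ = _ := by ring

lemma ht_rpow_le {s z : ℂ} (h : ht z ≤ 2 * ht s) :
    ht z ^ (1 / 50 : ℝ) ≤ 2 * ht s ^ (1 / 50 : ℝ) := by
  have := ht_pos s
  have := ht_pos z
  calc ht z ^ (1 / 50 : ℝ) ≤ (2 * ht s) ^ (1 / 50 : ℝ) := by gcongr
    _ = 2 ^ (1 / 50 : ℝ) * ht s ^ (1 / 50 : ℝ) := Real.mul_rpow (by norm_num) (by positivity)
    _ ≤ _ := by
      gcongr
      simpa using Real.rpow_le_rpow_of_exponent_le (by norm_num : (1 : ℝ) ≤ 2)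
        (by norm_num : (1 / 50 : ℝ) ≤ 1)

lemma exists_zetaReg_pow_four_ge :
    ∃ c : ℝ, 0 < c ∧ ∀ s : ℂ, 1 < s.re → s.re ≤ 3 → 1 ≤ |s.im| →
      c ^ 4 * (s.re - 1) ^ 3 * ht s ^ 4 ≤ ht s ^ (1 / 50 : ℝ) * ‖zetaReg s‖ ^ 4 := by
  obtain ⟨C, hC, h⟩ := exists_norm_zetaReg_le
  refine ⟨1 / (4 * C), by positivity, fun s h1 h2 h3 => ?_⟩
  obtain ⟨x, hx⟩ : ∃ x : ℝ, x = s.re - 1 := ⟨_, rfl⟩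
  have hx0 : 0 < x := by linarith
  have key := zetaReg_product_ge hx0 (y := s.im) (fun h => by simp [h] at h3; linarith)
  have es : (1 + x + I * s.im : ℂ) = s := by
    apply Complex.ext <;> simp [hx]
  rw [es] at key
  have hT := ht_pos s
  have b1 : ‖zetaReg (1 + x)‖ ≤ C := by
    have := h (1 + x) (by simp; linarith) (by simp; linarith)
    simpa [ht] using this
  have b2 : ‖zetaReg (1 + x + 2 * I * s.im)‖ ≤ C * (2 * ht s * (2 * ht s ^ (1 / 50 : ℝ))) := by
    refine (h _ (by simp; linarith) (by simp; linarith)).trans ?_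
    have : ht (1 + x + 2 * I * s.im) ≤ 2 * ht s := by
      simp [ht, abs_mul]; linarith
    have h0 := ht_pos (1 + x + 2 * I * s.im)
    have := ht_rpow_le this
    gcongr
  have b3 : ht s / 2 ≤ |s.im| := by unfold ht; linarith
  have k2 : x ^ 3 * (ht s / 2) ^ 5 ≤ C ^ 3 * ‖zetaReg s‖ ^ 4 *
      (C * (2 * ht s * (2 * ht s ^ (1 / 50 : ℝ)))) := by
    calc _ ≤ x ^ 3 * |s.im| ^ 5 := by gcongr
      _ ≤ _ := key
      _ ≤ _ := by gcongr
  rw [← hx]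
  have k3 : 2 * (x ^ 3 * ht s ^ 4) ≤ 256 * C ^ 4 * (ht s ^ (1 / 50 : ℝ) * ‖zetaReg s‖ ^ 4) := by
    have := mul_le_mul_of_nonneg_left k2 (by positivity : 0 ≤ 64 / ht s)
    have e1 : 64 / ht s * (x ^ 3 * (ht s / 2) ^ 5) = 2 * (x ^ 3 * ht s ^ 4) := by
      field_simp; ring
    have e2 : 64 / ht s * (C ^ 3 * ‖zetaReg s‖ ^ 4 *
      (C * (2 * ht s * (2 * ht s ^ (1 / 50 : ℝ))))) =
        256 * C ^ 4 * (ht s ^ (1 / 50 : ℝ) * ‖zetaReg s‖ ^ 4) := by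
      field_simp; ring
    rwa [e1, e2] at this
  have k4 : 0 ≤ x ^ 3 * ht s ^ 4 := by positivity
  have : (1 / (4 * C)) ^ 4 * x ^ 3 * ht s ^ 4 = x ^ 3 * ht s ^ 4 / (256 * C ^ 4) := by
    field_simp; norm_num
  rw [this, div_le_iff₀ (by positivity)]
  linarith

lemma exists_norm_zetaReg_sub_le :
    ∃ C : ℝ, 0 < C ∧ ∀ s z : ℂ, s.im = z.im → 99 / 100 ≤ s.re → s.re ≤ 3 →
      99 / 100 ≤ z.re → z.re ≤ 3 →
      ‖zetaReg z - zetaReg s‖ ≤ C * (ht s * ht s ^ (1 / 50 : ℝ)) * |z.re - s.re| := by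
  obtain ⟨C, hC, h⟩ := exists_norm_deriv_zetaReg_le
  refine ⟨C, hC, fun s z him h1 h2 h3 h4 => ?_⟩
  set S : Set ℂ := {w | 99 / 100 ≤ w.re} ∩ {w | w.re ≤ 3} ∩ {w | w.im = s.im} with hS
  have hconv : Convex ℝ S := ((convex_halfSpace_re_ge _).inter (convex_halfSpace_re_le _)).inter
    (convex_hyperplane (f := Complex.im) ⟨fun _ _ => rfl, fun _ _ => by simp⟩ _)
  have key := hconv.norm_image_sub_le_of_norm_deriv_le (f := zetaReg)
    (C := C * (ht s * ht s ^ (1 / 50 : ℝ))) (x := s) (y := z)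
    (fun w _ => differentiable_zetaReg w) (fun w hw => by
      have := h w hw.1.1 hw.1.2
      have e : ht w = ht s := by simp only [ht]; rw [hw.2]
      rwa [e] at this) ⟨⟨h1, h2⟩, rfl⟩ ⟨⟨h3, h4⟩, him.symm⟩
  have e : z - s = ((z.re - s.re : ℝ) : ℂ) := by
    apply Complex.ext <;> simp [him]
  have e2 : ‖z - s‖ = |z.re - s.re| := by rw [e, norm_real, Real.norm_eq_abs]
  rwa [e2] at key

lemma exists_norm_zetaReg_ge_of_one_le_abs_im :
    ∃ c : ℝ, 0 < c ∧ ∀ s : ℂ, 1 ≤ s.re → s.re ≤ 3 → 1 ≤ |s.im| →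
      c * (ht s / (ht s ^ (1 / 50 : ℝ)) ^ 4) ≤ ‖zetaReg s‖ := by
  obtain ⟨c, hc, h⟩ := exists_zetaReg_pow_four_ge
  obtain ⟨C, hC, hmv⟩ := exists_norm_zetaReg_sub_le
  obtain ⟨ε, hε0, hε1, hε2⟩ : ∃ ε : ℝ, 0 < ε ∧ ε ≤ 1 ∧ C * ε ≤ c / 2 := by
    refine ⟨min 1 (c / (2 * C)), by positivity, min_le_left _ _, ?_⟩
    calc C * min 1 (c / (2 * C)) ≤ C * (c / (2 * C)) := by gcongr; exact min_le_right _ _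
      _ = c / 2 := by field_simp
  refine ⟨c / 2 * ε ^ 3, by positivity, fun s h1 h2 h3 => ?_⟩
  have hT := ht_pos s
  have hτ1 : 1 ≤ ht s ^ (1 / 50 : ℝ) := Real.one_le_rpow (one_le_ht s) (by norm_num)
  have hτ0 : 0 < ht s ^ (1 / 50 : ℝ) := by linarith
  have main : ∀ z : ℂ, z.im = s.im → 1 + ε ^ 4 / (ht s ^ (1 / 50 : ℝ)) ^ 5 ≤ z.re → z.re ≤ 3 →
      c * ε ^ 3 * (ht s / (ht s ^ (1 / 50 : ℝ)) ^ 4) ≤ ‖zetaReg z‖ := by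
    intro z hz hz1 hz2
    have e : ht z = ht s := by simp only [ht, hz]
    have hp : 0 < ε ^ 4 / (ht s ^ (1 / 50 : ℝ)) ^ 5 := by positivity
    have := h z (by linarith) hz2 (by rwa [hz])
    rw [e] at this
    set τ := ht s ^ (1 / 50 : ℝ)
    refine le_of_pow_le_pow_left₀ (n := 4) (by norm_num) (norm_nonneg _) ?_
    have h5 : c ^ 4 * (ε ^ 4 / τ ^ 5) ^ 3 * ht s ^ 4 ≤ τ * ‖zetaReg z‖ ^ 4 := by
      refine le_trans ?_ this
      gcongr
      linarith
    have h6 : (c * ε ^ 3 * (ht s / τ ^ 4)) ^ 4 = (c ^ 4 * (ε ^ 4 / τ ^ 5) ^ 3 * ht s ^ 4) / τ := by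
      field_simp
    rw [h6, div_le_iff₀ hτ0]
    linarith
  set τ := ht s ^ (1 / 50 : ℝ)
  set x0 := ε ^ 4 / τ ^ 5 with hx0
  have hx00 : 0 < x0 := by positivity
  have hx01 : x0 ≤ 1 := by
    rw [hx0, div_le_one (by positivity)]
    exact (pow_le_one₀ hε0.le hε1).trans (one_le_pow₀ hτ1)
  by_cases hcase : 1 + x0 ≤ s.re
  · refine le_trans ?_ (main s rfl hcase h2)
    gcongr
    linarith
  · push Not at hcase
    set z : ℂ := ⟨1 + x0, s.im⟩ with hz
    have hz' := main z rfl le_rfl (by simp [hz]; linarith)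
    have hd := hmv s z rfl (by linarith) h2 (by simp [hz]; linarith) (by simp [hz]; linarith)
    have habs : |z.re - s.re| ≤ x0 := by
      simp only [hz]; rw [abs_le]; constructor <;> linarith
    have hd2 : ‖zetaReg z - zetaReg s‖ ≤ c / 2 * ε ^ 3 * (ht s / τ ^ 4) := by
      calc _ ≤ C * (ht s * τ) * |z.re - s.re| := hd
        _ ≤ C * (ht s * τ) * x0 := by gcongr
        _ = (C * ε) * ε ^ 3 * (ht s / τ ^ 4) := by rw [hx0]; field_simp
        _ ≤ _ := by gcongr
    have := norm_sub_norm_le (zetaReg z) (zetaReg s)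
    linarith

lemma exists_norm_zetaReg_ge :
    ∃ c : ℝ, 0 < c ∧ ∀ s : ℂ, 1 ≤ s.re → s.re ≤ 3 →
      c * (ht s / (ht s ^ (1 / 50 : ℝ)) ^ 4) ≤ ‖zetaReg s‖ := by
  obtain ⟨c, hc, h⟩ := exists_norm_zetaReg_ge_of_one_le_abs_im
  have hK : IsCompact (Set.Icc (1 : ℝ) 3 ×ℂ Set.Icc (-1 : ℝ) 1) :=
    isCompact_Icc.reProdIm isCompact_Icc
  obtain ⟨z, hz, hmin⟩ := hK.exists_isMinOn ⟨1, by simp [mem_reProdIm]⟩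
    (f := fun s => ‖zetaReg s‖) differentiable_zetaReg.continuous.norm.continuousOn
  have hz0 : 0 < ‖zetaReg z‖ := norm_pos_iff.mpr (zetaReg_ne_zero (mem_reProdIm.mp hz).1.1)
  refine ⟨min c (‖zetaReg z‖ / 2), by positivity, fun s h1 h2 => ?_⟩
  have hT := ht_pos s
  have hτ1 : 1 ≤ ht s ^ (1 / 50 : ℝ) := Real.one_le_rpow (one_le_ht s) (by norm_num)
  rcases le_total 1 |s.im| with h3 | h3
  · refine le_trans ?_ (h s h1 h2 h3)
    gcongr
    exact min_le_left _ _
  · have hs : ‖zetaReg z‖ ≤ ‖zetaReg s‖ := hmin (mem_reProdIm.mpr ⟨⟨h1, h2⟩, abs_le.mp h3⟩)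
    have hT2 : ht s ≤ 2 := by unfold ht; linarith
    calc _ ≤ ‖zetaReg z‖ / 2 * (2 / 1 ^ 4) := by
          gcongr
          exact min_le_right _ _
      _ = ‖zetaReg z‖ := by ring
      _ ≤ _ := hs

/-- Lower bound for `(s - 1) ζ(s)` slightly to the left of the line `Re s = 1`. -/
lemma exists_norm_zetaReg_ge_left :
    ∃ δ c : ℝ, 0 < δ ∧ δ ≤ 1 / 100 ∧ 0 < c ∧ ∀ s : ℂ,
      1 - δ / (ht s ^ (1 / 50 : ℝ)) ^ 5 ≤ s.re → s.re ≤ 3 →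
      c * (ht s / (ht s ^ (1 / 50 : ℝ)) ^ 4) ≤ ‖zetaReg s‖ := by
  obtain ⟨c, hc, h⟩ := exists_norm_zetaReg_ge
  obtain ⟨C, hC, hmv⟩ := exists_norm_zetaReg_sub_le
  have hδ : C * min (1 / 100) (c / (2 * C)) ≤ c / 2 := by
    calc C * min (1 / 100) (c / (2 * C)) ≤ C * (c / (2 * C)) := by gcongr; exact min_le_right _ _
      _ = c / 2 := by field_simp
  refine ⟨min (1 / 100) (c / (2 * C)), c / 2, by positivity, min_le_left _ _, by positivity,
    fun s h1 h2 => ?_⟩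
  set δ := min (1 / 100) (c / (2 * C)) with hδd
  have hδ0 : 0 < δ := by positivity
  have hT := ht_pos s
  have hτ1 : 1 ≤ ht s ^ (1 / 50 : ℝ) := Real.one_le_rpow (one_le_ht s) (by norm_num)
  set τ := ht s ^ (1 / 50 : ℝ)
  rcases le_total 1 s.re with h3 | h3
  · refine le_trans ?_ (h s h3 h2)
    gcongr
    linarith
  · set z : ℂ := ⟨1, s.im⟩ with hz
    have hz' := h z le_rfl (by simp [hz])
    have e : ht z = ht s := rfl
    rw [e] at hz'
    have hle : δ / τ ^ 5 ≤ 1 / 100 := by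
      calc δ / τ ^ 5 ≤ δ / 1 := by gcongr; exact one_le_pow₀ hτ1
        _ ≤ 1 / 100 := by rw [div_one]; exact min_le_left _ _
    have hd := hmv s z rfl (by linarith) h2 (by simp [hz]; norm_num) (by simp [hz])
    have habs : |z.re - s.re| ≤ δ / τ ^ 5 := by
      simp only [hz]; rw [abs_le]; constructor <;> linarith [show 0 < δ / τ ^ 5 by positivity]
    have hd2 : ‖zetaReg z - zetaReg s‖ ≤ c / 2 * (ht s / τ ^ 4) := by
      calc _ ≤ C * (ht s * τ) * |z.re - s.re| := hd
        _ ≤ C * (ht s * τ) * (δ / τ ^ 5) := by gcongr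
        _ = (C * δ) * (ht s / τ ^ 4) := by field_simp
        _ ≤ _ := by gcongr
    have := norm_sub_norm_le (zetaReg z) (zetaReg s)
    linarith

/-- The negative logarithmic derivative of `(s - 1) ζ(s)`, divided by `s (s + 1)`. -/
noncomputable def smoothedLogDeriv (s : ℂ) : ℂ := -(deriv zetaReg s / zetaReg s) / (s * (s + 1))

lemma differentiableAt_smoothedLogDeriv {s : ℂ} (h0 : zetaReg s ≠ 0) (hs : 0 < s.re) :
    DifferentiableAt ℂ smoothedLogDeriv s := by
  have h1 : s * (s + 1) ≠ 0 := by
    refine mul_ne_zero (fun h => by simp [h] at hs) (fun h => ?_)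
    have := congrArg re h
    simp at this
    linarith
  have h2 : DifferentiableAt ℂ (deriv zetaReg) s :=
    (differentiable_zetaReg.analyticAt s).deriv.differentiableAt
  unfold smoothedLogDeriv
  have := differentiable_zetaReg s
  exact ((h2.div this h0).neg).div (by fun_prop) h1

lemma ht_le_three_mul_norm {s : ℂ} (hs : 1 / 2 ≤ s.re) : ht s ≤ 3 * ‖s‖ := by
  have h1 := abs_im_le_norm s
  have h2 := (le_abs_self _).trans (abs_re_le_norm s)
  unfold ht
  linarith

lemma exists_norm_smoothedLogDeriv_le :
    ∃ δ C : ℝ, 0 < δ ∧ δ ≤ 1 / 100 ∧ 0 < C ∧ ∀ s : ℂ,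
      1 - δ / (ht s ^ (1 / 50 : ℝ)) ^ 5 ≤ s.re → s.re ≤ 3 →
      DifferentiableAt ℂ smoothedLogDeriv s ∧
      ‖smoothedLogDeriv s‖ ≤ C * ((ht s ^ (1 / 50 : ℝ)) ^ 5 / ht s ^ 2) := by
  obtain ⟨δ, c, hδ0, hδ1, hc, h⟩ := exists_norm_zetaReg_ge_left
  obtain ⟨C, hC, hd⟩ := exists_norm_deriv_zetaReg_le
  refine ⟨δ, 9 * (C / c), hδ0, hδ1, by positivity, fun s h1 h2 => ?_⟩
  have hT := ht_pos s
  have hτ1 : 1 ≤ ht s ^ (1 / 50 : ℝ) := Real.one_le_rpow (one_le_ht s) (by norm_num)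
  have hs := h s h1 h2
  have hle : δ / (ht s ^ (1 / 50 : ℝ)) ^ 5 ≤ 1 / 100 := by
    calc _ ≤ δ / 1 := by gcongr; exact one_le_pow₀ hτ1
      _ ≤ 1 / 100 := by rwa [div_one]
  have hds := hd s (by linarith) h2
  set τ := ht s ^ (1 / 50 : ℝ)
  have hpos : 0 < c * (ht s / τ ^ 4) := by positivity
  have hz : zetaReg s ≠ 0 := norm_pos_iff.mp (by linarith)
  refine ⟨differentiableAt_smoothedLogDeriv hz (by linarith), ?_⟩
  have n1 := ht_le_three_mul_norm (s := s) (by linarith)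
  have n2 : ht s ≤ 3 * ‖s + 1‖ := by
    have := ht_le_three_mul_norm (s := s + 1) (by simp; linarith)
    simpa [ht] using this
  unfold smoothedLogDeriv
  rw [norm_div, norm_neg, norm_div, norm_mul]
  calc _ ≤ (C * (ht s * τ) / (c * (ht s / τ ^ 4))) / (ht s / 3 * (ht s / 3)) := by
        gcongr <;> linarith
    _ = _ := by field_simp; norm_num

lemma exists_norm_iteratedDeriv_smoothedLogDeriv_le :
    ∃ C : ℝ, 0 < C ∧ ∀ s : ℂ, 1 ≤ s.re → s.re ≤ 2 →
      ‖iteratedDeriv 4 smoothedLogDeriv s‖ ≤ C * (1 + |s.im|) ^ (-(3 / 2) : ℝ) := by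
  obtain ⟨δ, C, hδ0, hδ1, hC, h⟩ := exists_norm_smoothedLogDeriv_le
  refine ⟨24 * (C * (32 * 4)) * (32 / δ) ^ 4, by positivity, fun s h1 h2 => ?_⟩
  have hT := ht_pos s
  have hτ1 : 1 ≤ ht s ^ (1 / 50 : ℝ) := Real.one_le_rpow (one_le_ht s) (by norm_num)
  have hτ0 : 0 < ht s ^ (1 / 50 : ℝ) := by linarith
  set τ := ht s ^ (1 / 50 : ℝ) with hτ
  set r := δ / (32 * τ ^ 5) with hr
  have hr0 : 0 < r := by positivity
  have hr1 : r ≤ 1 / 100 := by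
    calc r ≤ δ / 1 := by
          rw [hr]; gcongr
          have := one_le_pow₀ (n := 5) hτ1
          linarith
      _ ≤ 1 / 100 := by rwa [div_one]
  have ball : ∀ z ∈ Metric.closedBall s r, DifferentiableAt ℂ smoothedLogDeriv z ∧
      ‖smoothedLogDeriv z‖ ≤ C * (32 * 4) * (τ ^ 5 / ht s ^ 2) := by
    intro z hz
    have hz : ‖z - s‖ ≤ r := by simpa [dist_eq_norm] using hz
    have hre : |z.re - s.re| ≤ r := by simpa using (abs_re_le_norm (z - s)).trans hz
    rw [abs_le] at hre
    have t1 : ht z ≤ 2 * ht s := ht_le_two_mul (by linarith) hz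
    have t2 : ht s ≤ 2 * ht z := ht_le_two_mul (r := r) (by linarith) (by rwa [norm_sub_rev])
    have t3 : (ht z ^ (1 / 50 : ℝ)) ^ 5 ≤ 32 * τ ^ 5 := by
      have := ht_pos z
      calc (ht z ^ (1 / 50 : ℝ)) ^ 5 ≤ (2 * τ) ^ 5 := by gcongr; exact ht_rpow_le t1
        _ = 32 * τ ^ 5 := by ring
    have t4 : r ≤ δ / (ht z ^ (1 / 50 : ℝ)) ^ 5 := by
      have := ht_pos z
      rw [hr]
      gcongr
    obtain ⟨d1, d2⟩ := h z (by linarith) (by linarith)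
    refine ⟨d1, d2.trans ?_⟩
    have := ht_pos z
    calc C * ((ht z ^ (1 / 50 : ℝ)) ^ 5 / ht z ^ 2) ≤ C * (32 * τ ^ 5 / (ht s / 2) ^ 2) := by
          gcongr
          linarith
      _ = _ := by field_simp; ring
  have key := norm_iteratedDeriv_le_of_forall_mem_sphere_norm_le 4 hr0
    (f := smoothedLogDeriv) (c := s) (C := C * (32 * 4) * (τ ^ 5 / ht s ^ 2))
    (DifferentiableOn.diffContOnCl (fun z hz =>
      (ball z (Metric.closure_ball_subset_closedBall hz)).1.differentiableWithinAt))
    (fun z hz => (ball z (Metric.sphere_subset_closedBall hz)).2)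
  refine key.trans (le_of_eq ?_)
  have e : (1 + |s.im|) ^ (-(3 / 2) : ℝ) = τ ^ 25 / ht s ^ 2 := by
    change ht s ^ (-(3 / 2) : ℝ) = _
    rw [hτ, ← Real.rpow_natCast, ← Real.rpow_mul hT.le, ← Real.rpow_natCast (ht s) 2,
      ← Real.rpow_sub hT]
    norm_num
  rw [e, hr]
  simp only [Nat.factorial]
  push_cast
  field_simp

open MeasureTheory

lemma laplace_ramp {c : ℝ} (hc : 0 < c) {z : ℂ} (hz : -1 < z.re) :
    Integrable (fun u : ℝ => ((max (Real.exp u - c) 0 : ℝ) : ℂ) * exp (-(2 + z) * u)) ∧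
    ∫ u : ℝ, ((max (Real.exp u - c) 0 : ℝ) : ℂ) * exp (-(2 + z) * u) =
      (c : ℂ) ^ (-(1 + z)) / ((1 + z) * (2 + z)) := by
  have e : (fun u : ℝ => ((max (Real.exp u - c) 0 : ℝ) : ℂ) * exp (-(2 + z) * u)) =
      (Set.Ioi (Real.log c)).indicator fun u : ℝ =>
        exp (-(1 + z) * u) - c * exp (-(2 + z) * u) := by
    funext u
    by_cases hu : Real.log c < u
    · have : c < Real.exp u := (Real.log_lt_iff_lt_exp hc).mp hu
      rw [Set.indicator_of_mem (by exact hu), max_eq_left (by linarith)]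
      push_cast
      rw [sub_mul, ← exp_add]
      ring_nf
    · have : Real.exp u ≤ c := by
        rw [← Real.exp_log hc]; exact Real.exp_le_exp.mpr (not_lt.mp hu)
      rw [Set.indicator_of_notMem (by exact hu), max_eq_right (by linarith)]
      simp
  have r1 : (-(1 + z)).re < 0 := by simp; linarith
  have r2 : (-(2 + z)).re < 0 := by simp; linarith
  have n1 : 1 + z ≠ 0 := fun h => by simp [h] at r1
  have n2 : 2 + z ≠ 0 := fun h => by simp [h] at r2
  have i1 := integrableOn_exp_mul_complex_Ioi r1 (Real.log c)
  have i2 := (integrableOn_exp_mul_complex_Ioi r2 (Real.log c)).const_mul (c : ℂ)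
  rw [e]
  refine ⟨(integrable_indicator_iff measurableSet_Ioi).mpr (i1.sub i2), ?_⟩
  rw [integral_indicator measurableSet_Ioi, integral_sub i1 i2, integral_const_mul,
    integral_exp_mul_complex_Ioi r1, integral_exp_mul_complex_Ioi r2]
  have hc' : (c : ℂ) ≠ 0 := by exact_mod_cast hc.ne'
  have e1 : exp (-(2 + z) * Real.log c) = (c : ℂ)⁻¹ * exp (-(1 + z) * Real.log c) := by
    have : -(2 + z) * (Real.log c : ℂ) = -Real.log c + -(1 + z) * Real.log c := by ring
    rw [this, exp_add, exp_neg, ← ofReal_exp, Real.exp_log hc]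
  rw [e1, cpow_def_of_ne_zero hc', ← ofReal_log hc.le, mul_comm (Real.log c : ℂ)]
  field_simp
  ring

lemma laplace_ramp_sq {z : ℂ} (hz : 0 < z.re) :
    Integrable (fun u : ℝ => ((max (Real.exp u - 1) 0 ^ 2 / 2 : ℝ) : ℂ) * exp (-(2 + z) * u)) ∧
    ∫ u : ℝ, ((max (Real.exp u - 1) 0 ^ 2 / 2 : ℝ) : ℂ) * exp (-(2 + z) * u) =
      1 / (z * (1 + z) * (2 + z)) := by
  have e : (fun u : ℝ => ((max (Real.exp u - 1) 0 ^ 2 / 2 : ℝ) : ℂ) * exp (-(2 + z) * u)) =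
      (Set.Ioi 0).indicator fun u : ℝ =>
        1 / 2 * exp (-z * u) - exp (-(1 + z) * u) + 1 / 2 * exp (-(2 + z) * u) := by
    funext u
    by_cases hu : 0 < u
    · have : 1 < Real.exp u := Real.one_lt_exp_iff.mpr hu
      rw [Set.indicator_of_mem (by exact hu), max_eq_left (by linarith)]
      have a1 : exp (-z * u) = exp u ^ 2 * exp (-(2 + z) * u) := by
        rw [← exp_nat_mul, ← exp_add]; congr 1; push_cast; ring
      have a2 : exp (-(1 + z) * u) = exp u * exp (-(2 + z) * u) := by
        rw [← exp_add]; congr 1; ring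
      rw [a1, a2]
      push_cast
      ring
    · have : Real.exp u ≤ 1 := Real.exp_le_one_iff.mpr (not_lt.mp hu)
      rw [Set.indicator_of_notMem (by exact hu), max_eq_right (by linarith)]
      simp
  have r0 : (-z).re < 0 := by simpa using hz
  have r1 : (-(1 + z)).re < 0 := by simp; linarith
  have r2 : (-(2 + z)).re < 0 := by simp; linarith
  have n0 : z ≠ 0 := fun h => by simp [h] at r0
  have n1 : 1 + z ≠ 0 := fun h => by simp [h] at r1
  have n2 : 2 + z ≠ 0 := fun h => by simp [h] at r2
  have i0 := (integrableOn_exp_mul_complex_Ioi r0 0).const_mul (1 / 2)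
  have i1 := integrableOn_exp_mul_complex_Ioi r1 0
  have i2 := (integrableOn_exp_mul_complex_Ioi r2 0).const_mul (1 / 2)
  rw [e]
  refine ⟨(integrable_indicator_iff measurableSet_Ioi).mpr ((i0.sub i1).add i2), ?_⟩
  have i01 : IntegrableOn (fun u : ℝ => 1 / 2 * exp (-z * u) - exp (-(1 + z) * u)) (Set.Ioi 0) :=
    i0.sub i1
  rw [integral_indicator measurableSet_Ioi, integral_add i01 i2, integral_sub i0 i1, integral_const_mul, integral_const_mul,
    integral_exp_mul_complex_Ioi r0, integral_exp_mul_complex_Ioi r1,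
    integral_exp_mul_complex_Ioi r2]
  simp only [ofReal_zero, mul_zero, exp_zero, neg_div_neg_eq]
  field_simp
  ring

/-- `∫₀ˣ ψ(t) dt`, written as a sum over prime powers. -/
noncomputable def psiOne (x : ℝ) : ℝ := ∑' n : ℕ, ArithmeticFunction.vonMangoldt n * max (x - n) 0

lemma psiOne_eq_sum {x : ℝ} {N : ℕ} (h : x ≤ N) :
    psiOne x = ∑ n ∈ range N, ArithmeticFunction.vonMangoldt n * max (x - n) 0 := by
  refine tsum_eq_sum fun n hn => ?_
  have : (N : ℝ) ≤ n := by simpa using hn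
  rw [max_eq_right (by linarith), mul_zero]

lemma psi_eq_sum {x : ℝ} (hx : 0 ≤ x) {N : ℕ} (h : x < N) :
    Chebyshev.psi x =
      ∑ n ∈ range N, ArithmeticFunction.vonMangoldt n * if (n : ℝ) ≤ x then 1 else 0 := by
  rw [Chebyshev.psi]
  simp only [mul_ite, mul_one, mul_zero]
  rw [← Finset.sum_filter]
  refine Finset.sum_subset_zero_on_sdiff (fun n hn => ?_) (fun n hn => ?_) fun _ _ => rfl
  · rw [Finset.mem_Ioc] at hn
    have := (Nat.le_floor_iff hx).mp hn.2
    rw [Finset.mem_filter, Finset.mem_range]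
    exact ⟨by exact_mod_cast this.trans_lt h, this⟩
  · rw [Finset.mem_sdiff, Finset.mem_filter, Finset.mem_Ioc, not_and] at hn
    have : n = 0 := by
      by_contra h0
      exact hn.2 (Nat.pos_of_ne_zero h0) ((Nat.le_floor_iff hx).mpr hn.1.2)
    simp [this]

lemma continuous_psiOne : Continuous psiOne := by
  rw [continuous_iff_continuousAt]
  intro x
  obtain ⟨N, hN⟩ := exists_nat_gt x
  have : psiOne =ᶠ[𝓝 x] fun x => ∑ n ∈ range N, ArithmeticFunction.vonMangoldt n * max (x - n) 0 := by
    filter_upwards [Iio_mem_nhds hN] with y hy using psiOne_eq_sum (le_of_lt hy)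
  refine ContinuousAt.congr ?_ this.symm
  fun_prop

lemma psiOne_sub_le {x h : ℝ} (hx : 0 ≤ x) (hh : 0 ≤ h) :
    psiOne (x + h) - psiOne x ≤ h * Chebyshev.psi (x + h) := by
  obtain ⟨N, hN⟩ := exists_nat_gt (x + h)
  rw [psiOne_eq_sum hN.le, psiOne_eq_sum (by linarith : x ≤ N), psi_eq_sum (by linarith) hN,
    ← Finset.sum_sub_distrib, Finset.mul_sum]
  refine Finset.sum_le_sum fun n _ => ?_
  rw [← mul_sub, mul_left_comm]
  refine mul_le_mul_of_nonneg_left ?_ ArithmeticFunction.vonMangoldt_nonneg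
  split_ifs with h1
  · rw [max_eq_left (by linarith)]
    linarith [le_max_left (x - n) 0]
  · rw [max_eq_right (by linarith), max_eq_right (by linarith)]
    simp

lemma le_psiOne_sub {x h : ℝ} (hx : 0 ≤ x) (hh : 0 ≤ h) :
    h * Chebyshev.psi x ≤ psiOne (x + h) - psiOne x := by
  obtain ⟨N, hN⟩ := exists_nat_gt (x + h)
  rw [psiOne_eq_sum hN.le, psiOne_eq_sum (by linarith : x ≤ N), psi_eq_sum hx (by linarith : x < N),
    ← Finset.sum_sub_distrib, Finset.mul_sum]
  refine Finset.sum_le_sum fun n _ => ?_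
  rw [← mul_sub, mul_left_comm]
  refine mul_le_mul_of_nonneg_left ?_ ArithmeticFunction.vonMangoldt_nonneg
  split_ifs with h1
  · rw [max_eq_left (by linarith), max_eq_left (by linarith)]
    linarith
  · rw [max_eq_right (by linarith : x - n ≤ 0)]
    simp

lemma psiOne_nonneg (x : ℝ) : 0 ≤ psiOne x :=
  tsum_nonneg fun _ => mul_nonneg ArithmeticFunction.vonMangoldt_nonneg (le_max_right _ _)

lemma psiOne_of_le_one {x : ℝ} (hx : x ≤ 1) : psiOne x = 0 := by
  rw [psiOne_eq_sum (N := 1) (by simpa using hx)]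
  simp

lemma psiOne_le {x : ℝ} (hx : 0 ≤ x) : psiOne x ≤ (Real.log 4 + 4) * x ^ 2 := by
  have h1 := psiOne_sub_le le_rfl hx
  rw [psiOne_of_le_one zero_le_one, sub_zero, zero_add] at h1
  nlinarith [Chebyshev.psi_le_const_mul_self hx]

/-- The normalised error `e^{-2u} (ψ₁(e^u) - (e^u - 1)² / 2)`, extended by zero to `u ≤ 0`. -/
noncomputable def psiOneErr (u : ℝ) : ℝ :=
  Real.exp (-2 * u) * (psiOne (Real.exp u) - max (Real.exp u - 1) 0 ^ 2 / 2)

lemma continuous_psiOneErr : Continuous psiOneErr := by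
  unfold psiOneErr
  have := continuous_psiOne
  fun_prop

lemma psiOneErr_of_nonpos {u : ℝ} (hu : u ≤ 0) : psiOneErr u = 0 := by
  have := Real.exp_le_one_iff.mpr hu
  rw [psiOneErr, psiOne_of_le_one this, max_eq_right (by linarith)]
  simp

lemma abs_psiOneErr_le (u : ℝ) : |psiOneErr u| ≤ Real.log 4 + 5 := by
  have h4 : 0 ≤ Real.log 4 := Real.log_nonneg (by norm_num)
  have hE : Real.exp (-2 * u) * Real.exp u ^ 2 = 1 := by
    rw [← Real.exp_nat_mul, ← Real.exp_add]; simp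
  have h1 := psiOne_le (Real.exp_pos u).le
  have h2 := psiOne_nonneg (Real.exp u)
  have h3 : max (Real.exp u - 1) 0 ≤ Real.exp u := max_le (by linarith) (Real.exp_pos u).le
  have h5 : max (Real.exp u - 1) 0 ^ 2 ≤ Real.exp u ^ 2 := by gcongr
  have h6 : 0 ≤ max (Real.exp u - 1) 0 ^ 2 := by positivity
  have hp := Real.exp_pos (-2 * u)
  rw [psiOneErr, abs_mul, abs_of_pos hp]
  calc _ ≤ Real.exp (-2 * u) * ((Real.log 4 + 5) * Real.exp u ^ 2) := by
        gcongr
        rw [abs_le]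
        constructor <;> nlinarith
    _ = (Real.log 4 + 5) * (Real.exp (-2 * u) * Real.exp u ^ 2) := by ring
    _ = _ := by rw [hE, mul_one]

lemma laplace_psiOne {z : ℂ} (hz : 0 < z.re) :
    ∫ u : ℝ, (psiOne (Real.exp u) : ℂ) * exp (-(2 + z) * u) =
      -(deriv riemannZeta (1 + z) / riemannZeta (1 + z)) / ((1 + z) * (2 + z)) := by
  set F : ℕ → ℝ → ℂ := fun n u =>
    (ArithmeticFunction.vonMangoldt n : ℂ) *
      (((max (Real.exp u - n) 0 : ℝ) : ℂ) * exp (-(2 + z) * u)) with hF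
  have hzero : ∀ u, F 0 u = 0 := fun u => by simp [hF]
  have hint (n : ℕ) : Integrable (F n) := by
    rcases Nat.eq_zero_or_pos n with rfl | hn
    · simp [hF]
    · have := (laplace_ramp (c := n) (by exact_mod_cast hn) (z := z) (by linarith)).1
      exact this.const_mul _
  have hval (n : ℕ) : ∫ u, F n u = LSeries.term (fun n => (ArithmeticFunction.vonMangoldt n : ℂ))
      (1 + z) n / ((1 + z) * (2 + z)) := by
    rcases Nat.eq_zero_or_pos n with rfl | hn
    · simp [hF]
    · have := (laplace_ramp (c := n) (by exact_mod_cast hn) (z := z) (by linarith)).2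
      simp only [hF]
      rw [integral_const_mul, this, LSeries.term_of_ne_zero hn.ne', cpow_neg]
      push_cast
      ring
  have hnorm (n : ℕ) (u : ℝ) : (‖F n u‖ : ℂ) = (ArithmeticFunction.vonMangoldt n : ℂ) *
      (((max (Real.exp u - n) 0 : ℝ) : ℂ) * exp (-(2 + (z.re : ℂ)) * u)) := by
    have : ‖exp (-(2 + z) * u)‖ = Real.exp (-(2 + z.re) * u) := by
      rw [norm_exp]; congr 1; simp
    simp only [hF, norm_mul, this, norm_real, Real.norm_of_nonneg
      (ArithmeticFunction.vonMangoldt_nonneg (n := n)), Real.norm_of_nonneg (le_max_right _ _)]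
    push_cast
    rfl
  have hvaln (n : ℕ) : ((∫ u, ‖F n u‖ : ℝ) : ℂ) =
      LSeries.term (fun n => (ArithmeticFunction.vonMangoldt n : ℂ)) (1 + (z.re : ℂ)) n /
        ((1 + (z.re : ℂ)) * (2 + z.re)) := by
    rw [← integral_complex_ofReal]
    simp only [hnorm]
    rcases Nat.eq_zero_or_pos n with rfl | hn
    · simp
    · have := (laplace_ramp (c := n) (by exact_mod_cast hn) (z := (z.re : ℂ))
        (by simp; linarith)).2
      rw [integral_const_mul, this, LSeries.term_of_ne_zero hn.ne', cpow_neg]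
      push_cast
      ring
  have hs : Summable fun n => ∫ u, ‖F n u‖ := by
    rw [← Complex.summable_ofReal]
    simp only [hvaln]
    exact Summable.div_const (ArithmeticFunction.LSeriesSummable_vonMangoldt (by simpa using hz)) _
  have key := (hasSum_integral_of_summable_integral_norm hint hs).tsum_eq
  simp only [hval] at key
  rw [tsum_div_const] at key
  have hL := ArithmeticFunction.LSeries_vonMangoldt_eq_deriv_riemannZeta_div (s := 1 + z)
    (by simpa using hz)
  rw [LSeries] at hL
  rw [hL, neg_div] at key
  rw [key]
  refine integral_congr_ae (ae_of_all _ fun u => ?_)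
  simp only [hF, psiOne]
  rw [ofReal_tsum, ← tsum_mul_right]
  refine tsum_congr fun n => ?_
  push_cast
  ring

lemma smoothedLogDeriv_one_add {z : ℂ} (hz : 0 < z.re) :
    smoothedLogDeriv (1 + z) =
      -(deriv riemannZeta (1 + z) / riemannZeta (1 + z)) / ((1 + z) * (2 + z)) -
        1 / (z * (1 + z) * (2 + z)) := by
  have n0 : z ≠ 0 := fun h => by simp [h] at hz
  have n1 : 1 + z ≠ 0 := fun h => by
    have := congrArg re h; simp at this; linarith
  have n2 : 2 + z ≠ 0 := fun h => by
    have := congrArg re h; simp at this; linarith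
  have h1 : 1 + z ≠ 1 := by simpa using n0
  have hζ : riemannZeta (1 + z) ≠ 0 := riemannZeta_ne_zero_of_one_le_re (by simp; linarith)
  have hd : deriv zetaReg (1 + z) = riemannZeta (1 + z) + z * deriv riemannZeta (1 + z) := by
    rw [(zetaReg_eventuallyEq h1).deriv_eq]
    have := (((hasDerivAt_id (1 + z)).sub_const 1).mul
      (differentiableAt_riemannZeta h1).hasDerivAt).deriv
    simpa [Pi.mul_def] using this
  rw [smoothedLogDeriv, hd, zetaReg_of_ne h1, show (1 + z : ℂ) + 1 = 2 + z by ring,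
    show (1 + z : ℂ) - 1 = z by ring]
  field_simp
  ring

open FourierTransform

lemma iteratedDeriv_comp_affine {f : ℂ → ℂ} {a b : ℂ} (ha : 0 < a.re) (hb : b.re = 0)
    (hf : ∀ s : ℂ, 0 < s.re → AnalyticAt ℂ f s) (n : ℕ) (w : ℝ) :
    iteratedDeriv n (fun w : ℝ => f (a + b * w)) w = b ^ n * iteratedDeriv n f (a + b * w) := by
  induction n generalizing w with
  | zero => simp
  | succ n ih =>
    rw [iteratedDeriv_succ, iteratedDeriv_succ, funext ih]
    have hre : 0 < (a + b * w : ℂ).re := by simp [hb, ha]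
    have hd : HasDerivAt (iteratedDeriv n f) (deriv (iteratedDeriv n f) (a + b * w))
        (a + b * w) := by
      rw [iteratedDeriv_eq_iterate]
      exact ((hf _ hre).iterated_deriv n).differentiableAt.hasDerivAt
    have hl : HasDerivAt (fun z : ℂ => a + b * z) b w := by
      simpa using ((hasDerivAt_id (w : ℂ)).const_mul b).const_add a
    have := ((hd.comp (w : ℂ) hl).const_mul (b ^ n)).comp_ofReal
    refine this.deriv.trans ?_
    ring

lemma analyticAt_smoothedLogDeriv {z : ℂ} (hz : 0 < z.re) :
    AnalyticAt ℂ (fun z => smoothedLogDeriv (1 + z)) z := by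
  refine DifferentiableOn.analyticAt (s := {z : ℂ | 0 < z.re}) (fun w hw => ?_)
    ((isOpen_lt continuous_const continuous_re).mem_nhds hz)
  have hw : 0 < w.re := hw
  have h1 : DifferentiableAt ℂ smoothedLogDeriv (1 + w) :=
    differentiableAt_smoothedLogDeriv (zetaReg_ne_zero (by simp; linarith)) (by simp; linarith)
  exact (h1.comp w (differentiableAt_id.const_add 1)).differentiableWithinAt

lemma integrable_pow_mul_psiOneErr {σ : ℝ} (hσ : 0 < σ) (n : ℕ) :
    Integrable fun u : ℝ => u ^ n * (psiOneErr u * Real.exp (-σ * u)) := by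
  have hc := continuous_psiOneErr
  have h : IntegrableOn (fun u : ℝ => u ^ (n : ℝ) * Real.exp (-σ * u ^ (1 : ℝ))) (Set.Ioi 0) :=
    integrableOn_rpow_mul_exp_neg_mul_rpow (by linarith [n.cast_nonneg (α := ℝ)]) one_pos hσ
  have h' := ((integrable_indicator_iff measurableSet_Ioi).mpr h).const_mul (Real.log 4 + 5)
  refine h'.mono' (by fun_prop) (ae_of_all _ fun u => ?_)
  by_cases hu : 0 < u
  · rw [Set.indicator_of_mem (by exact hu), Real.rpow_natCast, Real.rpow_one, norm_mul, norm_mul,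
      Real.norm_of_nonneg (Real.exp_pos _).le, Real.norm_of_nonneg (by positivity : 0 ≤ u ^ n),
      mul_left_comm]
    gcongr
    exact abs_psiOneErr_le u
  · simp [psiOneErr_of_nonpos (not_lt.mp hu), Set.indicator_of_notMem (show u ∉ Set.Ioi 0 from hu)]

lemma fourier_psiOneErr {σ : ℝ} (hσ : 0 < σ) (w : ℝ) :
    𝓕 (fun u : ℝ => ((psiOneErr u * Real.exp (-σ * u) : ℝ) : ℂ)) w =
      smoothedLogDeriv (1 + (σ + 2 * Real.pi * I * w)) := by
  set z : ℂ := σ + 2 * Real.pi * I * w with hzdef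
  have hz : 0 < z.re := by simp [hzdef, hσ]
  rw [smoothedLogDeriv_one_add hz, ← laplace_psiOne hz, ← (laplace_ramp_sq hz).2,
    Real.fourier_real_eq_integral_exp_smul]
  have i2 := (laplace_ramp_sq hz).1
  have e (u : ℝ) : exp ((-2 * Real.pi * u * w : ℝ) * I) *
      ((psiOneErr u * Real.exp (-σ * u) : ℝ) : ℂ) = (psiOneErr u : ℂ) * exp (-z * u) := by
    have : exp (-z * u) = exp ((-2 * Real.pi * u * w : ℝ) * I) * exp (-σ * u) := by
      rw [← exp_add, hzdef]; congr 1; push_cast; ring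
    rw [this]
    push_cast
    ring
  have e' (u : ℝ) : (psiOneErr u : ℂ) * exp (-z * u) =
      (psiOne (Real.exp u) : ℂ) * exp (-(2 + z) * u) -
      ((max (Real.exp u - 1) 0 ^ 2 / 2 : ℝ) : ℂ) * exp (-(2 + z) * u) := by
    have : exp (-(2 + z) * u) = exp (-2 * u) * exp (-z * u) := by
      rw [← exp_add]; congr 1; ring
    rw [this, psiOneErr]
    push_cast
    ring
  have i0 : Integrable fun u : ℝ => (psiOneErr u : ℂ) * exp (-z * u) := by
    have hc := continuous_psiOneErr
    have h := integrable_pow_mul_psiOneErr hσ 0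
    refine h.norm.mono' (by fun_prop) (ae_of_all _ fun u => ?_)
    have hn : ‖exp (-z * u)‖ = Real.exp (-σ * u) := by
      rw [norm_exp]; simp [hzdef]
    rw [norm_mul, hn]
    simp
  have i1 : Integrable fun u : ℝ => (psiOne (Real.exp u) : ℂ) * exp (-(2 + z) * u) := by
    refine (i0.add i2).congr (ae_of_all _ fun u => ?_)
    simp only [Pi.add_apply, e']
    ring
  rw [← integral_sub i1 i2]
  refine integral_congr_ae (ae_of_all _ fun u => ?_)
  simp only [smul_eq_mul, e, e']

lemma exists_pow_four_mul_psiOneErr_le :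
    ∃ C : ℝ, 0 < C ∧ ∀ u : ℝ, u ^ 4 * |psiOneErr u| ≤ C := by
  obtain ⟨C, hC, hG⟩ := exists_norm_iteratedDeriv_smoothedLogDeriv_le
  have hint : Integrable fun w : ℝ => (1 + ‖w‖) ^ (-(3 / 2) : ℝ) :=
    integrable_one_add_norm (by simp; norm_num)
  have main {σ : ℝ} (h0 : 0 < σ) (h1 : σ ≤ 1) (u : ℝ) :
      u ^ 4 * |psiOneErr u| * Real.exp (-σ * u) ≤ C * ∫ w : ℝ, (1 + ‖w‖) ^ (-(3 / 2) : ℝ) := by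
    set g : ℝ → ℂ := fun u => ((psiOneErr u * Real.exp (-σ * u) : ℝ) : ℂ) with hg
    set k : ℝ → ℂ := fun u => (-2 * Real.pi * I * u) ^ 4 • g u with hk
    have hgi (n : ℕ) : Integrable fun u => u ^ n • g u := by
      have := (integrable_pow_mul_psiOneErr h0 n).ofReal (𝕜 := ℂ)
      refine this.congr (ae_of_all _ fun u => ?_)
      simp [hg]
    have hF : 𝓕 k = fun w : ℝ => (2 * Real.pi * I) ^ 4 *
        iteratedDeriv 4 smoothedLogDeriv (1 + (σ + 2 * Real.pi * I * w)) := by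
      rw [hk, ← Real.iteratedDeriv_fourier (N := ⊤) (fun n _ => hgi n) le_top]
      have : 𝓕 g = fun w : ℝ => smoothedLogDeriv (1 + (σ + 2 * Real.pi * I * w)) :=
        funext fun w => fourier_psiOneErr h0 w
      rw [this]
      funext w
      rw [iteratedDeriv_comp_affine (f := fun z => smoothedLogDeriv (1 + z)) (a := (σ : ℂ))
        (b := 2 * Real.pi * I) (by simpa using h0) (by simp)
        (fun s hs => analyticAt_smoothedLogDeriv hs), iteratedDeriv_comp_const_add]
    have hFn (w : ℝ) : ‖𝓕 k w‖ ≤ (2 * Real.pi) ^ 4 * C * (1 + ‖w‖) ^ (-(3 / 2) : ℝ) := by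
      have him : ((1 + (σ + 2 * Real.pi * I * w) : ℂ)).im = 2 * Real.pi * w := by simp
      have hre : ((1 + (σ + 2 * Real.pi * I * w) : ℂ)).re = 1 + σ := by simp
      have hb := hG (1 + (σ + 2 * Real.pi * I * w)) (by rw [hre]; linarith) (by rw [hre]; linarith)
      have hpi : 1 ≤ 2 * Real.pi := by linarith [Real.pi_gt_three]
      have hle : (1 + |2 * Real.pi * w|) ^ (-(3 / 2) : ℝ) ≤ (1 + ‖w‖) ^ (-(3 / 2) : ℝ) := by
        refine Real.rpow_le_rpow_of_nonpos (by positivity) ?_ (by norm_num)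
        rw [abs_mul, abs_of_pos (by positivity : 0 < 2 * Real.pi), Real.norm_eq_abs]
        nlinarith [abs_nonneg w]
      rw [him] at hb
      rw [hF]
      simp only [norm_mul, norm_pow, norm_I, mul_one, Complex.norm_real, Complex.norm_ofNat,
        Real.norm_of_nonneg Real.pi_pos.le]
      rw [mul_assoc _ C]
      exact mul_le_mul_of_nonneg_left (hb.trans (by gcongr)) (by positivity)
    have hkc : Continuous k := by
      have := continuous_psiOneErr
      simp only [hk, hg]
      fun_prop
    have hki : Integrable k := by
      refine ((hgi 4).const_mul ((-2 * Real.pi * I) ^ 4)).congr (ae_of_all _ fun u => ?_)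
      simp [hk]
      ring
    have hFc : AEStronglyMeasurable (𝓕 k) :=
      (VectorFourier.fourierIntegral_continuous Real.continuous_fourierChar
        (by fun_prop) hki).aestronglyMeasurable
    have hFi : Integrable (𝓕 k) := (hint.const_mul _).mono' hFc (ae_of_all _ hFn)
    have hinv := congrFun (hkc.fourierInv_fourier_eq hki hFi) u
    have hb : ‖k u‖ ≤ ∫ w : ℝ, (2 * Real.pi) ^ 4 * C * (1 + ‖w‖) ^ (-(3 / 2) : ℝ) := by
      rw [← hinv, Real.fourierInv_eq']
      refine norm_integral_le_of_norm_le (hint.const_mul _) (ae_of_all _ fun w => ?_)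
      rw [norm_smul, norm_exp_ofReal_mul_I, one_mul]
      exact hFn w
    have hku : ‖k u‖ = (2 * Real.pi) ^ 4 * (u ^ 4 * |psiOneErr u| * Real.exp (-σ * u)) := by
      simp only [hk, hg, norm_smul, norm_pow, norm_mul, norm_neg, norm_I, mul_one,
        Complex.norm_real, Complex.norm_ofNat, Real.norm_of_nonneg Real.pi_pos.le,
        Real.norm_of_nonneg (Real.exp_pos (-σ * u)).le, Real.norm_eq_abs]
      have : |u| ^ 4 = u ^ 4 := by rw [← abs_pow, abs_of_nonneg (by positivity)]
      rw [mul_pow, this]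
      ring
    rw [hku, integral_const_mul, mul_assoc _ C] at hb
    exact le_of_mul_le_mul_left hb (by positivity)
  set K := ∫ w : ℝ, (1 + ‖w‖) ^ (-(3 / 2) : ℝ)
  have hK : 0 ≤ K := integral_nonneg fun w => by positivity
  refine ⟨C * K + 1, by positivity, fun u => ?_⟩
  have hlim : Tendsto (fun σ : ℝ => u ^ 4 * |psiOneErr u| * Real.exp (-σ * u)) (𝓝[>] 0)
      (𝓝 (u ^ 4 * |psiOneErr u| * Real.exp (-0 * u))) :=
    (Continuous.tendsto (by fun_prop) 0).mono_left nhdsWithin_le_nhds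
  have := le_of_tendsto hlim (b := C * K) (by
    filter_upwards [Ioc_mem_nhdsGT (one_pos (α := ℝ))] with σ hσ using main hσ.1 hσ.2 u)
  simp at this
  linarith

/-- The prime number theorem with a `log⁻⁴` error term, in smoothed form. -/
lemma exists_abs_psiOne_sub_le :
    ∃ C : ℝ, 0 < C ∧ ∀ x : ℝ, 1 < x →
      |psiOne x - (x - 1) ^ 2 / 2| ≤ C * (x ^ 2 / Real.log x ^ 4) := by
  obtain ⟨C, hC, h⟩ := exists_pow_four_mul_psiOneErr_le
  refine ⟨C, hC, fun x hx => ?_⟩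
  have hx0 : 0 < x := by linarith
  have hl : 0 < Real.log x := Real.log_pos hx
  have := h (Real.log x)
  have e : Real.exp (-2 * Real.log x) = (x ^ 2)⁻¹ := by
    rw [neg_mul, Real.exp_neg, show 2 * Real.log x = Real.log (x ^ 2) by simp,
      Real.exp_log (by positivity)]
  rw [psiOneErr, e, Real.exp_log hx0, max_eq_left (by linarith), abs_mul,
    abs_of_pos (by positivity)] at this
  rw [← mul_div_assoc, le_div_iff₀ (by positivity)]
  generalize |psiOne x - (x - 1) ^ 2 / 2| = A at this ⊢
  field_simp at this
  linarith

end StrongPNT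

namespace StrongPNT

lemma exists_abs_psi_sub_le :
    ∃ C : ℝ, 0 < C ∧ ∀ x : ℝ, 16 ≤ x → |Chebyshev.psi x - x| ≤ C * (x / Real.log x ^ 2) := by
  obtain ⟨C, hC, h⟩ := exists_abs_psiOne_sub_le
  refine ⟨17 * C + 5, by positivity, fun x hx => ?_⟩
  have hx0 : 0 < x := by linarith
  set l := Real.log x with hl
  have hl2 : 2 ≤ l := by
    have h1 : Real.log 16 = 4 * Real.log 2 := by
      rw [show (16 : ℝ) = 2 ^ 4 by norm_num, Real.log_pow]; norm_num
    have h2 := Real.log_le_log (by norm_num) hx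
    linarith [Real.log_two_gt_d9]
  have hl0 : 0 < l := by linarith
  set d := x / l ^ 2 with hd
  have hd0 : 0 < d := by positivity
  have hd2 : d ≤ x / 2 := by
    rw [hd]
    gcongr
    nlinarith
  have hxd : x ^ 2 / l ^ 4 = d * d := by rw [hd]; field_simp
  have hone : 1 ≤ 4 * d := by
    have h1 : l ≤ 2 * x ^ (1 / 2 : ℝ) := by
      have := Real.log_le_rpow_div hx0.le (show (0 : ℝ) < 1 / 2 by norm_num)
      linarith
    have h2 : (x ^ (1 / 2 : ℝ)) ^ 2 = x := by
      rw [← Real.sqrt_eq_rpow, Real.sq_sqrt hx0.le]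
    have h3 : l ^ 2 ≤ 4 * x := by
      calc l ^ 2 ≤ (2 * x ^ (1 / 2 : ℝ)) ^ 2 := by gcongr
        _ = 4 * x := by rw [mul_pow, h2]; norm_num
    rw [hd, ← mul_div_assoc, le_div_iff₀ (by positivity)]
    linarith
  have b0 := h x (by linarith)
  have b1 : |psiOne (x + d) - (x + d - 1) ^ 2 / 2| ≤ C * (4 * (d * d)) := by
    refine (h (x + d) (by linarith)).trans ?_
    have hlog : l ≤ Real.log (x + d) := Real.log_le_log hx0 (by linarith)
    have hxd2 : x + d ≤ 2 * x := by linarith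
    gcongr
    calc (x + d) ^ 2 / Real.log (x + d) ^ 4 ≤ (2 * x) ^ 2 / l ^ 4 := by gcongr
      _ = 4 * (x ^ 2 / l ^ 4) := by ring
      _ = _ := by rw [hxd]
  have b2 : |psiOne (x - d) - (x - d - 1) ^ 2 / 2| ≤ C * (16 * (d * d)) := by
    refine (h (x - d) (by linarith)).trans ?_
    have hlog : l / 2 ≤ Real.log (x - d) := by
      have h1 : Real.log (x / 2) ≤ Real.log (x - d) := Real.log_le_log (by linarith) (by linarith)
      rw [Real.log_div hx0.ne' (by norm_num)] at h1
      linarith [Real.log_two_lt_d9]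
    have hxd2 : x - d ≤ x := by linarith
    have hxd3 : 0 ≤ x - d := by linarith
    gcongr
    calc (x - d) ^ 2 / Real.log (x - d) ^ 4 ≤ x ^ 2 / (l / 2) ^ 4 := by gcongr
      _ = 16 * (x ^ 2 / l ^ 4) := by field_simp; norm_num
      _ = _ := by rw [hxd]
  rw [hxd] at b0
  rw [abs_le] at b0 b1 b2
  have u1 := le_psiOne_sub hx0.le hd0.le
  have u2 := psiOne_sub_le (x := x - d) (by linarith) hd0.le
  rw [sub_add_cancel] at u2
  rw [abs_le]
  constructor
  · refine le_of_mul_le_mul_left ?_ hd0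
    nlinarith
  · refine le_of_mul_le_mul_left ?_ hd0
    nlinarith

lemma exists_abs_theta_sub_le :
    ∃ C : ℝ, 0 < C ∧ ∀ x : ℝ, 16 ≤ x → |Chebyshev.theta x - x| ≤ C * (x / Real.log x ^ 2) := by
  obtain ⟨C, hC, h⟩ := exists_abs_psi_sub_le
  refine ⟨C + 432, by positivity, fun x hx => ?_⟩
  have hx0 : 0 < x := by linarith
  have hl0 : 0 < Real.log x := Real.log_pos (by linarith)
  have h1 := Chebyshev.abs_psi_sub_theta_le_sqrt_mul_log (x := x) (by linarith)
  have h2 : 2 * √x * Real.log x ≤ 432 * (x / Real.log x ^ 2) := by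
    rw [← mul_div_assoc, le_div_iff₀ (by positivity)]
    have h3 : Real.log x ≤ 6 * x ^ (1 / 6 : ℝ) := by
      have := Real.log_le_rpow_div hx0.le (show (0 : ℝ) < 1 / 6 by norm_num)
      linarith
    have h4 : (x ^ (1 / 6 : ℝ)) ^ 3 = √x := by
      rw [← Real.rpow_natCast, ← Real.rpow_mul hx0.le, Real.sqrt_eq_rpow]
      norm_num
    calc 2 * √x * Real.log x * Real.log x ^ 2 = 2 * √x * Real.log x ^ 3 := by ring
      _ ≤ 2 * √x * (6 * x ^ (1 / 6 : ℝ)) ^ 3 := by gcongr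
      _ = 432 * (√x * √x) := by rw [mul_pow, h4]; ring
      _ = 432 * x := by rw [Real.mul_self_sqrt hx0.le]
  have h5 := h x hx
  rw [abs_le] at *
  constructor <;> linarith

open MeasureTheory

lemma exists_abs_sum_log_mul_rpow_sub_le {β : ℝ} (hβ : 0 < β) :
    ∃ C : ℝ, 0 < C ∧ ∀ y Y : ℝ, 16 ≤ y → y ≤ Y →
      |∑ p ∈ (Ioc ⌊y⌋₊ ⌊Y⌋₊).filter Nat.Prime, (p : ℝ) ^ (-1 - β) * Real.log p -
        (y ^ (-β) - Y ^ (-β)) / β| ≤ C * (y ^ (-β) / Real.log y ^ 2) := by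
  obtain ⟨C, hC, h⟩ := exists_abs_theta_sub_le
  refine ⟨2 * C + (1 + β) / β * C, by positivity, fun y Y hy hyY => ?_⟩
  have hy0 : 0 < y := by linarith
  have hY0 : 0 < Y := by linarith
  have hl0 : 0 < Real.log y := Real.log_pos (by linarith)
  set D := C / Real.log y ^ 2 with hD
  have hD0 : 0 < D := by positivity
  have hE (t : ℝ) (ht : y ≤ t) : |Chebyshev.theta t - t| ≤ D * t := by
    have hl : Real.log y ≤ Real.log t := Real.log_le_log hy0 ht
    have ht0 : 0 < t := by linarith
    calc _ ≤ C * (t / Real.log t ^ 2) := h t (by linarith)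
      _ ≤ C * (t / Real.log y ^ 2) := by gcongr
      _ = D * t := by rw [hD]; ring
  have hder (t : ℝ) (ht : 0 < t) :
      HasDerivAt (fun t : ℝ => t ^ (-1 - β)) (-(1 + β) * t ^ (-2 - β)) t := by
    have := Real.hasDerivAt_rpow_const (p := -1 - β) (Or.inl ht.ne')
    convert this using 1
    ring_nf
  have hpow (t : ℝ) (ht : 0 < t) : t ^ (-2 - β) * t = t ^ (-1 - β) := by
    rw [← Real.rpow_add_one ht.ne']; ring_nf
  have hpow' (t : ℝ) (ht : 0 < t) : t ^ (-1 - β) * t = t ^ (-β) := by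
    rw [← Real.rpow_add_one ht.ne']; ring_nf
  have hci (r : ℝ) : IntegrableOn (fun t : ℝ => t ^ r) (Set.Icc y Y) := by
    refine ContinuousOn.integrableOn_Icc fun t ht => ?_
    exact (Real.continuousAt_rpow_const t r
      (Or.inl (by linarith [ht.1] : 0 < t).ne')).continuousWithinAt
  have hdi : IntegrableOn (deriv fun t : ℝ => t ^ (-1 - β)) (Set.Icc y Y) := by
    refine IntegrableOn.congr_fun ((hci (-2 - β)).const_mul (-(1 + β))) (fun t ht => ?_)
      measurableSet_Icc
    exact (hder t (by linarith [ht.1])).deriv.symm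
  have abel := sum_mul_eq_sub_sub_integral_mul (fun k => if k.Prime then Real.log k else 0)
    hy0.le hyY (fun t ht => (hder t (by linarith [ht.1])).differentiableAt) hdi
  have hint := integrableOn_mul_sum_Icc (m := 0) (fun k => if k.Prime then Real.log k else 0)
    hy0.le hdi
  have hθ (t : ℝ) : ∑ k ∈ Icc 0 ⌊t⌋₊, (if k.Prime then Real.log k else 0) = Chebyshev.theta t := by
    rw [Chebyshev.theta_eq_sum_Icc, Finset.sum_filter]
  simp only [hθ, mul_ite, mul_zero] at abel hint
  rw [← Finset.sum_filter] at abel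
  have hint' := hint.mono_set (Set.Ioc_subset_Icc_self (a := y) (b := Y))
  have hint2 : IntegrableOn (fun t : ℝ => (1 + β) * t ^ (-1 - β)) (Set.Ioc y Y) :=
    ((hci _).mono_set Set.Ioc_subset_Icc_self).const_mul _
  have hval : ∫ t in Set.Ioc y Y, (1 + β) * t ^ (-1 - β) =
      (1 + β) * ((y ^ (-β) - Y ^ (-β)) / β) := by
    rw [integral_const_mul, ← intervalIntegral.integral_of_le hyY, integral_rpow]
    · rw [show -1 - β + 1 = -β by ring, div_neg, ← neg_div, neg_sub]
    · right
      refine ⟨by linarith, ?_⟩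
      rw [Set.uIcc_of_le hyY]
      intro h0
      linarith [h0.1]
  have herr : |(∫ t in Set.Ioc y Y, (deriv (fun t : ℝ => t ^ (-1 - β)) t * Chebyshev.theta t)) +
      ∫ t in Set.Ioc y Y, (1 + β) * t ^ (-1 - β)| ≤
      ∫ t in Set.Ioc y Y, D * ((1 + β) * t ^ (-1 - β)) := by
    rw [← integral_add hint' hint2, ← Real.norm_eq_abs]
    refine norm_integral_le_of_norm_le (hint2.const_mul D) ?_
    refine (ae_restrict_iff' measurableSet_Ioc).mpr (ae_of_all _ fun t ht => ?_)
    have ht0 : 0 < t := by linarith [ht.1]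
    rw [(hder t ht0).deriv, ← hpow t ht0, Real.norm_eq_abs,
      show -(1 + β) * t ^ (-2 - β) * Chebyshev.theta t + (1 + β) * (t ^ (-2 - β) * t) =
        -((1 + β) * t ^ (-2 - β)) * (Chebyshev.theta t - t) by ring, abs_mul, abs_neg,
      abs_of_pos (by positivity)]
    calc _ ≤ (1 + β) * t ^ (-2 - β) * (D * t) := by gcongr; exact hE t ht.1.le
      _ = _ := by ring
  rw [integral_const_mul D, hval] at herr
  have hYy : Y ^ (-β) ≤ y ^ (-β) :=
    Real.rpow_le_rpow_of_nonpos hy0 hyY (by linarith)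
  have hYp : 0 < Y ^ (-β) := by positivity
  have e1 : |y ^ (-1 - β) * (Chebyshev.theta y - y)| ≤ D * y ^ (-β) := by
    rw [abs_mul, abs_of_pos (by positivity), ← hpow' y hy0]
    calc _ ≤ y ^ (-1 - β) * (D * y) := by gcongr; exact hE y le_rfl
      _ = _ := by ring
  have e2 : |Y ^ (-1 - β) * (Chebyshev.theta Y - Y)| ≤ D * y ^ (-β) := by
    rw [abs_mul, abs_of_pos (by positivity)]
    calc _ ≤ Y ^ (-1 - β) * (D * Y) := by gcongr; exact hE Y hyY
      _ = D * (Y ^ (-1 - β) * Y) := by ring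
      _ = D * Y ^ (-β) := by rw [hpow' Y hY0]
      _ ≤ _ := by gcongr
  have e3 : D * ((1 + β) * ((y ^ (-β) - Y ^ (-β)) / β)) ≤ D * ((1 + β) * (y ^ (-β) / β)) := by
    gcongr
    linarith
  have hfin : (2 * C + (1 + β) / β * C) * (y ^ (-β) / Real.log y ^ 2) =
      2 * (D * y ^ (-β)) + D * ((1 + β) * (y ^ (-β) / β)) := by
    rw [hD]; ring
  rw [hfin, abel]
  have hmain : (y ^ (-β) - Y ^ (-β)) / β =
      Y ^ (-1 - β) * Y - y ^ (-1 - β) * y + (1 + β) * ((y ^ (-β) - Y ^ (-β)) / β) := by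
    rw [hpow' y hy0, hpow' Y hY0]
    field_simp
    ring
  rw [abs_le] at *
  constructor <;> linarith

lemma abs_prime_term_sub_le {α y p : ℝ} (hα : 0 < α) (hy : 1 < y) (hp : y < p)
    (hv : 2 * Real.log (p / y) ^ 2 ≤ Real.log y ^ 2) :
    |1 / (p ^ (2 * α + 1) * Real.log (y ^ 2 / p)) -
      p ^ (-1 - 2 * α) * Real.log p / Real.log y ^ 2| ≤
      8 / α ^ 2 * y ^ (-α) / Real.log y ^ 4 * (p ^ (-1 - α) * Real.log p) := by
  have hy0 : 0 < y := by linarith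
  have hp0 : 0 < p := by linarith
  have hl : 0 < Real.log y := Real.log_pos hy
  have hv0 : 0 < Real.log (p / y) := Real.log_pos (by rwa [one_lt_div hy0])
  have hvb : Real.log (p / y) ^ 2 ≤ 4 / α ^ 2 * (p ^ α * y ^ (-α)) := by
    have h1 := Real.log_le_rpow_div (x := p / y) (by positivity) (by positivity : 0 < α / 2)
    have h2 : ((p / y) ^ (α / 2)) ^ 2 = p ^ α * y ^ (-α) := by
      rw [← Real.rpow_natCast, ← Real.rpow_mul (by positivity), Real.div_rpow hp0.le hy0.le,
        Real.rpow_neg hy0.le]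
      norm_num
      rfl
    calc Real.log (p / y) ^ 2 ≤ ((p / y) ^ (α / 2) / (α / 2)) ^ 2 := by gcongr
      _ = 4 / α ^ 2 * ((p / y) ^ (α / 2)) ^ 2 := by field_simp; norm_num
      _ = _ := by rw [h2]
  have elp : Real.log p = Real.log y + Real.log (p / y) := by
    rw [Real.log_div hp0.ne' hy0.ne']; ring
  have elq : Real.log (y ^ 2 / p) = Real.log y - Real.log (p / y) := by
    rw [Real.log_div (by positivity) hp0.ne', Real.log_div hp0.ne' hy0.ne', Real.log_pow]
    push_cast
    ring
  set l := Real.log y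
  set v := Real.log (p / y)
  have hvl : v < l := by nlinarith
  have hsub : 0 < l - v := by linarith
  have hadd : 0 < l + v := by linarith
  have ep : p ^ (-1 - 2 * α) = (p ^ (2 * α + 1))⁻¹ := by
    rw [← Real.rpow_neg hp0.le]; ring_nf
  have ep2 : p ^ (-1 - α) = p ^ (-1 - 2 * α) * p ^ α := by
    rw [← Real.rpow_add hp0]; ring_nf
  have hA : 0 < p ^ (-1 - 2 * α) := by positivity
  rw [elq, elp, one_div, mul_inv, ← ep, ep2]
  set A := p ^ (-1 - 2 * α)
  have e : A * (l - v)⁻¹ - A * (l + v) / l ^ 2 = A * (v ^ 2 / (l ^ 2 * (l - v))) := by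
    field_simp
    ring
  rw [e, abs_of_pos (by positivity)]
  have hden : l ^ 4 ≤ 2 * ((l ^ 2 * (l - v)) * (l + v)) := by nlinarith [sq_nonneg l]
  calc A * (v ^ 2 / (l ^ 2 * (l - v))) = A * (v ^ 2 * (l + v)) / ((l ^ 2 * (l - v)) * (l + v)) := by
        field_simp
    _ ≤ A * (v ^ 2 * (l + v)) / (l ^ 4 / 2) := by gcongr; linarith
    _ = 2 * A * (l + v) / l ^ 4 * v ^ 2 := by field_simp
    _ ≤ 2 * A * (l + v) / l ^ 4 * (4 / α ^ 2 * (p ^ α * y ^ (-α))) := by gcongr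
    _ = _ := by ring

lemma exists_abs_prime_sum_sub_le {α : ℝ} (hα : 0 < α) :
    ∃ K : ℝ, 0 < K ∧ ∀ y M : ℝ, 16 ≤ y → 1 ≤ M → 2 * Real.log M ^ 2 ≤ Real.log y ^ 2 →
      Real.log y ^ 2 ≤ M ^ (2 * α) →
      |∑ p ∈ (Ioc ⌊y⌋₊ ⌊y * M⌋₊).filter Nat.Prime,
          1 / ((p : ℝ) ^ (2 * α + 1) * Real.log (y ^ 2 / p)) -
        y ^ (-(2 * α)) / (2 * α * Real.log y ^ 2)| ≤ K * (y ^ (-(2 * α)) / Real.log y ^ 4) := by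
  obtain ⟨C₁, hC₁, h₁⟩ := exists_abs_sum_log_mul_rpow_sub_le hα
  obtain ⟨C₂, hC₂, h₂⟩ := exists_abs_sum_log_mul_rpow_sub_le (by positivity : 0 < 2 * α)
  refine ⟨8 / α ^ 2 * (1 / α + C₁) + (1 / (2 * α) + C₂), by positivity,
    fun y M hy hM hMl hMα => ?_⟩
  have hy0 : 0 < y := by linarith
  have hM0 : 0 < M := by linarith
  have hl1 : 1 ≤ Real.log y := by
    rw [Real.le_log_iff_exp_le hy0]
    linarith [Real.exp_one_lt_d9]
  have hyM : y ≤ y * M := by nlinarith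
  have g₁ := h₁ y (y * M) hy hyM
  have g₂ := h₂ y (y * M) hy hyM
  set S := (Ioc ⌊y⌋₊ ⌊y * M⌋₊).filter Nat.Prime with hS
  set l := Real.log y
  have hl0 : 0 < l := by linarith
  have hterm : |∑ p ∈ S, 1 / ((p : ℝ) ^ (2 * α + 1) * Real.log (y ^ 2 / p)) -
      (∑ p ∈ S, (p : ℝ) ^ (-1 - 2 * α) * Real.log p) / l ^ 2| ≤
      8 / α ^ 2 * y ^ (-α) / l ^ 4 * ∑ p ∈ S, (p : ℝ) ^ (-1 - α) * Real.log p := by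
    rw [Finset.sum_div, ← Finset.sum_sub_distrib, Finset.mul_sum]
    refine (Finset.abs_sum_le_sum_abs _ _).trans (Finset.sum_le_sum fun p hp => ?_)
    rw [hS, Finset.mem_filter, Finset.mem_Ioc] at hp
    have hp1 : y < p := (Nat.floor_lt hy0.le).mp hp.1.1
    have hp2 : (p : ℝ) ≤ y * M := (Nat.le_floor_iff (by positivity)).mp hp.1.2
    refine abs_prime_term_sub_le hα (by linarith) hp1 (le_trans ?_ hMl)
    have hp0 : (0 : ℝ) < p := hy0.trans hp1
    have hlog : Real.log (p / y) ≤ Real.log M :=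
      Real.log_le_log (by positivity) (by rw [div_le_iff₀ hy0]; linarith)
    have hpos : 0 ≤ Real.log (p / y) := Real.log_nonneg (by rw [one_le_div hy0]; exact hp1.le)
    gcongr
  have hya : 0 < y ^ (-α) := by positivity
  have hyy : y ^ (-α) * y ^ (-α) = y ^ (-(2 * α)) := by
    rw [← Real.rpow_add hy0]; ring_nf
  have b1 : ∑ p ∈ S, (p : ℝ) ^ (-1 - α) * Real.log p ≤ (1 / α + C₁) * y ^ (-α) := by
    have k1 : 0 < (y * M) ^ (-α) / α := by positivity
    have k2 : C₁ * (y ^ (-α) / l ^ 2) ≤ C₁ * y ^ (-α) := by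
      gcongr
      exact div_le_self hya.le (one_le_pow₀ hl1)
    have := (abs_le.mp g₁).2
    rw [sub_div] at this
    have : (1 / α + C₁) * y ^ (-α) = y ^ (-α) / α + C₁ * y ^ (-α) := by ring
    linarith
  have b2 : 8 / α ^ 2 * y ^ (-α) / l ^ 4 * ∑ p ∈ S, (p : ℝ) ^ (-1 - α) * Real.log p ≤
      8 / α ^ 2 * (1 / α + C₁) * (y ^ (-(2 * α)) / l ^ 4) := by
    calc _ ≤ 8 / α ^ 2 * y ^ (-α) / l ^ 4 * ((1 / α + C₁) * y ^ (-α)) := by gcongr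
      _ = 8 / α ^ 2 * (1 / α + C₁) * (y ^ (-α) * y ^ (-α) / l ^ 4) := by ring
      _ = _ := by rw [hyy]
  have b3 : (y * M) ^ (-(2 * α)) ≤ y ^ (-(2 * α)) / l ^ 2 := by
    rw [Real.mul_rpow hy0.le hM0.le, Real.rpow_neg hM0.le, div_eq_mul_inv]
    gcongr
  have hpos : 0 < (y * M) ^ (-(2 * α)) := by positivity
  have b4 : |(∑ p ∈ S, (p : ℝ) ^ (-1 - 2 * α) * Real.log p) - y ^ (-(2 * α)) / (2 * α)| ≤
      (1 / (2 * α) + C₂) * (y ^ (-(2 * α)) / l ^ 2) := by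
    have k1 : 0 < (y * M) ^ (-(2 * α)) / (2 * α) := by positivity
    have k2 : (y * M) ^ (-(2 * α)) / (2 * α) ≤ y ^ (-(2 * α)) / l ^ 2 / (2 * α) := by gcongr
    have k3 : (1 / (2 * α) + C₂) * (y ^ (-(2 * α)) / l ^ 2) =
      y ^ (-(2 * α)) / l ^ 2 / (2 * α) + C₂ * (y ^ (-(2 * α)) / l ^ 2) := by ring
    have k4 : 0 < C₂ * (y ^ (-(2 * α)) / l ^ 2) := by positivity
    rw [sub_div] at g₂
    rw [k3]
    rw [abs_le] at g₂ ⊢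
    constructor <;> linarith
  have b5 : |(∑ p ∈ S, (p : ℝ) ^ (-1 - 2 * α) * Real.log p) / l ^ 2 -
      y ^ (-(2 * α)) / (2 * α * l ^ 2)| ≤
      (1 / (2 * α) + C₂) * (y ^ (-(2 * α)) / l ^ 4) := by
    rw [← div_div, ← sub_div, abs_div, abs_of_pos (by positivity : 0 < l ^ 2)]
    calc _ ≤ (1 / (2 * α) + C₂) * (y ^ (-(2 * α)) / l ^ 2) / l ^ 2 := by gcongr
      _ = _ := by field_simp
  calc _ ≤ _ := abs_sub_le _ ((∑ p ∈ S, (p : ℝ) ^ (-1 - 2 * α) * Real.log p) / l ^ 2) _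
    _ ≤ _ := add_le_add (hterm.trans b2) b5
    _ = _ := by ring

end StrongPNT

/-- For `α > 0`,
`Σ_{√x < p ≤ √x (log x)^{4/α}} 1/(p^{2α+1} log(x/p))
  = (2/α)·1/(x^α log²x) + O(1/(x^α log⁴x))`, the sum ranging over primes. -/
theorem prime_sum_inverse_log_asymptotic (α : ℝ) (hα : 0 < α) :
    (fun x : ℝ =>
        (∑ p ∈ (Finset.Icc 2 ⌊Real.sqrt x * Real.log x ^ ((4:ℝ) / α)⌋₊).filter
            (fun p : ℕ => p.Prime ∧ Real.sqrt x < (p : ℝ)),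
          1 / ((p : ℝ) ^ (2 * α + 1) * Real.log (x / (p : ℝ))))
        - (2 / α) * (1 / (x ^ α * Real.log x ^ 2)))
      =O[atTop] (fun x : ℝ => 1 / (x ^ α * Real.log x ^ 4)) := by
  obtain ⟨K, hK, h⟩ := StrongPNT.exists_abs_prime_sum_sub_le hα
  have hloglog : ∀ᶠ x : ℝ in atTop,
      Real.log (Real.log x) ≤ α / 16 * Real.log x := by
    have := (Real.isLittleO_log_id_atTop.comp_tendsto Real.tendsto_log_atTop).bound
      (by positivity : 0 < α / 16)
    filter_upwards [this, eventually_gt_atTop 1] with x hx h1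
    have := (le_abs_self _).trans hx
    simpa [abs_of_pos (Real.log_pos h1)] using this
  refine Asymptotics.IsBigO.of_bound (16 * K) ?_
  filter_upwards [hloglog, eventually_ge_atTop 256,
    Real.tendsto_log_atTop.eventually_ge_atTop 1] with x hll hx hL1
  have hx0 : 0 < x := by linarith
  have hL0 : 0 < Real.log x := by linarith
  have hy : 16 ≤ √x := Real.le_sqrt_of_sq_le (by linarith)
  have hly : Real.log √x = Real.log x / 2 := Real.log_sqrt hx0.le
  have hsq : √x ^ 2 = x := Real.sq_sqrt hx0.le
  have hpow : √x ^ (-(2 * α)) = (x ^ α)⁻¹ := by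
    rw [Real.rpow_neg (Real.sqrt_nonneg x), Real.sqrt_eq_rpow, ← Real.rpow_mul hx0.le]
    ring_nf
  have key := h √x (Real.log x ^ (4 / α)) hy (Real.one_le_rpow hL1 (by positivity)) ?_ ?_
  · have hset : (Finset.Icc 2 ⌊Real.sqrt x * Real.log x ^ ((4:ℝ) / α)⌋₊).filter
        (fun p : ℕ => p.Prime ∧ Real.sqrt x < (p : ℝ)) =
        (Ioc ⌊√x⌋₊ ⌊√x * Real.log x ^ (4 / α)⌋₊).filter Nat.Prime := by
      ext p
      simp only [Finset.mem_filter, Finset.mem_Icc, Finset.mem_Ioc,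
        Nat.floor_lt (Real.sqrt_nonneg x)]
      constructor
      · rintro ⟨⟨-, h2⟩, h3, h4⟩
        exact ⟨⟨h4, h2⟩, h3⟩
      · rintro ⟨⟨h1, h2⟩, h3⟩
        exact ⟨⟨h3.two_le, h2⟩, h3, h1⟩
    rw [hset, Real.norm_eq_abs, Real.norm_of_nonneg (by positivity)]
    rw [hsq, hly, hpow] at key
    convert key using 1
    · congr 2
      field_simp
    · field_simp
      norm_num
  · rw [hly, Real.log_rpow hL0]
    have h1 : 4 / α * Real.log (Real.log x) ≤ Real.log x / 4 := by
      calc _ ≤ 4 / α * (α / 16 * Real.log x) := by gcongr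
        _ = _ := by field_simp; norm_num
    have h2 : 0 ≤ 4 / α * Real.log (Real.log x) :=
      mul_nonneg (by positivity) (Real.log_nonneg hL1)
    nlinarith
  · rw [hly, ← Real.rpow_mul hL0.le, show 4 / α * (2 * α) = ((8 : ℕ) : ℝ) by field_simp; norm_num,
      Real.rpow_natCast]
    calc (Real.log x / 2) ^ 2 ≤ Real.log x ^ 2 := by gcongr; linarith
      _ ≤ Real.log x ^ 8 := pow_le_pow_right₀ hL1 (by norm_num)
end

section
/- Let α > 0 be a real number. Then as x → ∞, Σ_{√x < p ≤ √x (log x)^{4/α}, p prime} 1/(p^{2α+1} (log(x/p))²) = (4/α)·1/(x^α (log x)^3) + O(1/(x^α (log x)^4)). -/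
open Filter Finset

/-- The difference between `(s - 1) n⁻ˢ` and `(s - 1) ∫ u in n..n+1, u⁻ˢ`, written without
integrals; these are the terms of a series representing `(s - 1) ζ(s) - 1`. -/
noncomputable def zetaTerm (n : ℕ) (s : ℂ) : ℂ :=
  (s - 1) * (n : ℂ) ^ (-s) + ((n + 1 : ℕ) : ℂ) ^ (1 - s) - (n : ℂ) ^ (1 - s)

lemma norm_natCast_cpow_neg_sub_le {n : ℕ} (hn : 0 < n) {u : ℝ} (hu : (n : ℝ) ≤ u) {s : ℂ}
    (hs : 0 < s.re) (hu' : u ≤ n + 1) :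
    ‖(n : ℂ) ^ (-s) - (u : ℂ) ^ (-s)‖ ≤ min 2 (‖s‖ / n) * (n : ℝ) ^ (-s.re) := by
  have hn' : (0 : ℝ) < n := by exact_mod_cast hn
  have key : ∀ v : ℝ, (n : ℝ) ≤ v → ‖(v : ℂ) ^ (-s)‖ ≤ (n : ℝ) ^ (-s.re) := by
    intro v hv
    rw [Complex.norm_cpow_eq_rpow_re_of_pos (hn'.trans_le hv), Complex.neg_re]
    exact Real.rpow_le_rpow_of_nonpos hn' hv (by linarith)
  have h0 : 0 < (n : ℝ) ^ (-s.re) := Real.rpow_pos_of_pos hn' _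
  rw [min_mul_of_nonneg _ _ h0.le, le_min_iff]
  constructor
  · refine (norm_sub_le _ _).trans ?_
    have := key n le_rfl
    have := key u hu
    push_cast at *
    linarith
  · have hd : ∀ v ∈ Set.Icc (n : ℝ) (n + 1), HasDerivWithinAt (fun v : ℝ => (v : ℂ) ^ (-s))
        (-s * (v : ℂ) ^ (-s - 1)) (Set.Icc (n : ℝ) (n + 1)) v := by
      intro v hv
      have hv0 : 0 < v := hn'.trans_le hv.1
      exact (hasDerivAt_ofReal_cpow_const' (x := v) (r := -s - 1) hv0.ne' (by
        intro h
        have := congrArg Complex.re h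
        simp at this
        linarith) |>.const_mul (-s) |>.congr_deriv rfl |> fun h => by
          have h2 : (-s - 1 + 1) = -s := by ring
          have hs0 : s ≠ 0 := by rintro rfl; simp at hs
          rw [h2] at h
          refine (h.congr_of_eventuallyEq ?_).hasDerivWithinAt
          refine Eventually.of_forall fun y => ?_
          field_simp)
    have hb : ∀ v ∈ Set.Icc (n : ℝ) (n + 1),
        ‖-s * (v : ℂ) ^ (-s - 1)‖ ≤ ‖s‖ / n * (n : ℝ) ^ (-s.re) := by
      intro v hv
      have hv0 : 0 < v := hn'.trans_le hv.1
      rw [norm_mul, norm_neg, Complex.norm_cpow_eq_rpow_re_of_pos hv0,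
          div_mul_eq_mul_div, mul_div_assoc]
      refine mul_le_mul_of_nonneg_left ?_ (norm_nonneg _)
      simp only [Complex.sub_re, Complex.neg_re, Complex.one_re]
      rw [← Real.rpow_sub_one hn'.ne']
      exact Real.rpow_le_rpow_of_nonpos hn' hv.1 (by linarith)
    have := (convex_Icc (n : ℝ) (n + 1)).norm_image_sub_le_of_norm_hasDerivWithin_le hd hb
      (x := u) (y := n) ⟨hu, hu'⟩ ⟨le_rfl, by linarith⟩
    refine (by simpa using this : _ ≤ _).trans ?_
    have h1 : |(n : ℝ) - u| ≤ 1 := by rw [abs_le]; constructor <;> linarith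
    have h2 : 0 ≤ ‖s‖ / n * (n : ℝ) ^ (-s.re) := by positivity
    nlinarith

lemma norm_zetaTerm_le {n : ℕ} (hn : 0 < n) {s : ℂ} (hs : 0 < s.re) :
    ‖zetaTerm n s‖ ≤ ‖s - 1‖ * (min 2 (‖s‖ / n) * (n : ℝ) ^ (-s.re)) := by
  have hn' : (0 : ℝ) < n := by exact_mod_cast hn
  have hd : ∀ v ∈ Set.Icc (n : ℝ) (n + 1),
      HasDerivWithinAt (fun v : ℝ => (s - 1) * (n : ℂ) ^ (-s) * v + (v : ℂ) ^ (1 - s))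
        ((s - 1) * ((n : ℂ) ^ (-s) - (v : ℂ) ^ (-s))) (Set.Icc (n : ℝ) (n + 1)) v := by
    intro v hv
    have hv0 : 0 < v := hn'.trans_le hv.1
    have h1 : HasDerivAt (fun v : ℝ => (v : ℂ) ^ (1 - s)) ((1 - s) * (v : ℂ) ^ (-s)) v := by
      by_cases hs1 : s = 1
      · subst hs1
        simpa using hasDerivAt_const v (1 : ℂ)
      · have hs2 : 1 - s ≠ 0 := fun h => hs1 (by linear_combination -h)
        have := (hasDerivAt_ofReal_cpow_const' (x := v) (r := -s) hv0.ne' (by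
          intro h; exact hs1 (by linear_combination -h))).const_mul (1 - s)
        refine this.congr_of_eventuallyEq (Eventually.of_forall fun y => ?_)
        have h2 : -s + 1 = 1 - s := by ring
        simp only [h2]
        field_simp
    have h2 : HasDerivAt (fun v : ℝ => (s - 1) * (n : ℂ) ^ (-s) * (v : ℂ))
        ((s - 1) * (n : ℂ) ^ (-s)) v := by
      simpa using (Complex.ofRealCLM.hasDerivAt (x := v)).const_mul ((s - 1) * (n : ℂ) ^ (-s))
    exact ((h2.add h1).congr_deriv (by ring)).hasDerivWithinAt
  have hb : ∀ v ∈ Set.Icc (n : ℝ) (n + 1), ‖(s - 1) * ((n : ℂ) ^ (-s) - (v : ℂ) ^ (-s))‖ ≤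
      ‖s - 1‖ * (min 2 (‖s‖ / n) * (n : ℝ) ^ (-s.re)) := by
    intro v hv
    rw [norm_mul]
    exact mul_le_mul_of_nonneg_left (norm_natCast_cpow_neg_sub_le hn hv.1 hs hv.2) (norm_nonneg _)
  have := (convex_Icc (n : ℝ) (n + 1)).norm_image_sub_le_of_norm_hasDerivWithin_le hd hb
      (x := (n : ℝ)) (y := (n : ℝ) + 1) ⟨le_rfl, by linarith⟩ ⟨by linarith, le_rfl⟩
  simp only [add_sub_cancel_left, norm_one, mul_one] at this
  refine le_of_eq_of_le (congrArg norm ?_) this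
  unfold zetaTerm
  push_cast
  ring

lemma norm_zetaTerm_le_rpow {n : ℕ} (hn : 0 < n) {s : ℂ} (hs : 39 / 40 ≤ s.re) :
    ‖zetaTerm n s‖ ≤ 2 * ‖s - 1‖ * ‖s‖ ^ (1 / 20 : ℝ) * (n : ℝ) ^ (-(41 / 40) : ℝ) := by
  have hn' : (0 : ℝ) < n := by exact_mod_cast hn
  refine (norm_zetaTerm_le hn (by linarith)).trans ?_
  have h0 : min 2 (‖s‖ / n) ≤ 2 * (‖s‖ / n) ^ (1 / 20 : ℝ) := by
    have hq : 0 ≤ ‖s‖ / n := by positivity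
    rcases le_total (‖s‖ / n) 1 with h | h
    · have := Real.rpow_le_rpow_of_exponent_ge' hq h
          (by norm_num : (0 : ℝ) ≤ 1 / 20) (by norm_num : (1 / 20 : ℝ) ≤ 1)
      rw [Real.rpow_one] at this
      refine (min_le_right _ _).trans ?_
      have := Real.rpow_nonneg hq (1 / 20)
      linarith
    · have := Real.one_le_rpow h (by norm_num : (0 : ℝ) ≤ 1 / 20)
      refine (min_le_left _ _).trans ?_
      linarith
  have h1 : (n : ℝ) ^ (-s.re) ≤ (n : ℝ) ^ (-(39 / 40) : ℝ) :=
    Real.rpow_le_rpow_of_exponent_le (by exact_mod_cast hn) (by linarith)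
  calc _ ≤ ‖s - 1‖ * ((2 * (‖s‖ / n) ^ (1 / 20 : ℝ)) * (n : ℝ) ^ (-(39 / 40) : ℝ)) := by
        gcongr
    _ = _ := by
        have : (n : ℝ) ^ (-(41 / 40) : ℝ) =
            (n : ℝ) ^ (-(39 / 40) : ℝ) / (n : ℝ) ^ (1 / 20 : ℝ) := by
          rw [← Real.rpow_sub hn']; norm_num
        rw [Real.div_rpow (norm_nonneg _) hn'.le, this]
        ring

lemma riemannZeta₁_eq_of_one_lt_re {s : ℂ} (hs : 1 < s.re) :
    riemannZeta₁ s = 1 + ∑' n : ℕ, zetaTerm (n + 1) s := by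
  have hs1 : s ≠ 1 := by rintro rfl; simp at hs
  have hz : riemannZeta₁ s = (s - 1) * riemannZeta s := by
    rw [riemannZeta_eq_inv_sub_mul hs1, mul_inv_cancel_left₀ (sub_ne_zero.2 hs1)]
  have h1 : HasSum (fun n : ℕ => (s - 1) * ((n + 1 : ℕ) : ℂ) ^ (-s)) ((s - 1) * riemannZeta s) := by
    refine HasSum.mul_left _ ?_
    rw [zeta_eq_tsum_one_div_nat_add_one_cpow hs]
    have : Summable (fun n : ℕ => 1 / ((n : ℂ) + 1) ^ s) := by
      have := (summable_nat_add_iff 1).2 (Complex.summable_one_div_nat_cpow.2 hs)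
      simpa using this
    simpa [Complex.cpow_neg] using this.hasSum
  have h2 : HasSum
      (fun n : ℕ => ((n + 1 + 1 : ℕ) : ℂ) ^ (1 - s) - ((n + 1 : ℕ) : ℂ) ^ (1 - s)) (-1) := by
    have hsum : Summable
        (fun n : ℕ => ((n + 1 + 1 : ℕ) : ℂ) ^ (1 - s) - ((n + 1 : ℕ) : ℂ) ^ (1 - s)) := by
      have h3 : Summable fun n : ℕ => zetaTerm (n + 1) s := by
        refine Summable.of_norm_bounded (g := fun n : ℕ => 2 * ‖s - 1‖ * ‖s‖ ^ (1 / 20 : ℝ) * ((n + 1 : ℕ) : ℝ) ^ (-(41 / 40) : ℝ)) ?_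
          (fun n => norm_zetaTerm_le_rpow n.succ_pos (by linarith))
        refine Summable.mul_left _ ?_
        exact (summable_nat_add_iff 1).2 (Real.summable_nat_rpow.2 (by norm_num))
      refine (h3.sub h1.summable).congr fun n => ?_
      simp only [zetaTerm]
      ring
    have hlim : Tendsto (fun N : ℕ => ∑ n ∈ range N, (((n + 1 + 1 : ℕ) : ℂ) ^ (1 - s) - ((n + 1 : ℕ) : ℂ) ^ (1 - s)))
        atTop (nhds (0 - 1)) := by
      have : ∀ N : ℕ,
          ∑ n ∈ range N, (((n + 1 + 1 : ℕ) : ℂ) ^ (1 - s) - ((n + 1 : ℕ) : ℂ) ^ (1 - s)) =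
          ((N + 1 : ℕ) : ℂ) ^ (1 - s) - 1 := by
        intro N
        rw [Finset.sum_range_sub (fun n : ℕ => ((n + 1 : ℕ) : ℂ) ^ (1 - s))]
        simp
      simp_rw [this]
      refine Tendsto.sub ?_ tendsto_const_nhds
      rw [tendsto_zero_iff_norm_tendsto_zero]
      have h4 : ∀ N : ℕ, ‖((N + 1 : ℕ) : ℂ) ^ (1 - s)‖ = ((N + 1 : ℕ) : ℝ) ^ (-(s.re - 1)) := by
        intro N
        rw [Complex.norm_natCast_cpow_of_pos N.succ_pos]
        simp
      simp_rw [h4]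
      exact (tendsto_rpow_neg_atTop (by linarith : 0 < s.re - 1)).comp
        (tendsto_natCast_atTop_atTop.comp (tendsto_add_atTop_nat 1))
    have := tendsto_nhds_unique hsum.hasSum.tendsto_sum_nat hlim
    rw [zero_sub] at this
    rw [← this]
    exact hsum.hasSum
  have h3 := (h1.add h2).tsum_eq
  rw [hz, show (∑' n : ℕ, zetaTerm (n + 1) s) =
      (s - 1) * riemannZeta s + -1 from h3 ▸ tsum_congr fun n => by
    simp only [zetaTerm]; ring]
  ring

lemma riemannZeta₁_eq_tsum {s : ℂ} (hs : 39 / 40 < s.re) :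
    riemannZeta₁ s = 1 + ∑' n : ℕ, zetaTerm (n + 1) s := by
  set U : Set ℂ := {z : ℂ | 39 / 40 < z.re} ∩ Metric.ball 0 (‖s‖ + 3) with hU
  have hUo : IsOpen U := (isOpen_lt continuous_const Complex.continuous_re).inter Metric.isOpen_ball
  have hUc : IsPreconnected U :=
    ((convex_halfSpace_re_gt _).inter (convex_ball _ _)).isPreconnected
  have hd : DifferentiableOn ℂ (fun z => ∑' n : ℕ, zetaTerm (n + 1) z) U := by
    refine Complex.differentiableOn_tsum_of_summable_norm
      (u := fun n : ℕ => 2 * (‖s‖ + 4) * (‖s‖ + 3) ^ (1 / 20 : ℝ) * ((n + 1 : ℕ) : ℝ) ^ (-(41 / 40) : ℝ)) ?_ ?_ hUo ?_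
    · exact Summable.mul_left _
        ((summable_nat_add_iff 1).2 (Real.summable_nat_rpow.2 (by norm_num)))
    · intro n z _
      have h1 : ((n + 1 : ℕ) : ℂ) ≠ 0 := by exact_mod_cast n.succ_ne_zero
      have h2 : ((n + 1 + 1 : ℕ) : ℂ) ≠ 0 := by exact_mod_cast (n + 1).succ_ne_zero
      unfold zetaTerm
      refine DifferentiableAt.differentiableWithinAt ?_
      refine DifferentiableAt.sub
          (DifferentiableAt.add (DifferentiableAt.mul (by fun_prop) ?_) ?_) ?_
      · exact DifferentiableAt.const_cpow (by fun_prop) (Or.inl h1)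
      · exact DifferentiableAt.const_cpow (by fun_prop) (Or.inl h2)
      · exact DifferentiableAt.const_cpow (by fun_prop) (Or.inl h1)
    · intro n z hz
      have hz2 : ‖z‖ < ‖s‖ + 3 := by simpa using hz.2
      refine (norm_zetaTerm_le_rpow n.succ_pos hz.1.le).trans ?_
      have : ‖z - 1‖ ≤ ‖s‖ + 4 := (norm_sub_le _ _).trans (by rw [norm_one]; linarith)
      gcongr
  have h2 : (2 : ℂ) ∈ U := by
    refine ⟨by simp; norm_num, ?_⟩
    simp
    linarith [norm_nonneg s]
  have hev : riemannZeta₁ =ᶠ[nhds 2] fun z => 1 + ∑' n : ℕ, zetaTerm (n + 1) z := by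
    filter_upwards [(isOpen_lt continuous_const Complex.continuous_re).mem_nhds
      (show (2 : ℂ) ∈ {z : ℂ | 1 < z.re} by simp)] with z hz
    exact riemannZeta₁_eq_of_one_lt_re hz
  exact AnalyticOnNhd.eqOn_of_preconnected_of_eventuallyEq
    (differentiable_riemannZeta₁.differentiableOn.analyticOnNhd hUo)
    (((differentiableOn_const 1).add hd).analyticOnNhd hUo) hUc h2 hev
    ⟨hs, by simp⟩

/-- A slowly growing function of the height on the vertical strip, in whose powers the growth of
functions there is measured. -/
noncomputable def heightWeight (s : ℂ) : ℝ := (3 + |s.im|) ^ (1 / 20 : ℝ)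

lemma one_le_heightWeight (s : ℂ) : 1 ≤ heightWeight s :=
  Real.one_le_rpow (by linarith [abs_nonneg s.im]) (by norm_num)

lemma heightWeight_pow_twenty (s : ℂ) : heightWeight s ^ 20 = 3 + |s.im| := by
  have : 0 ≤ 3 + |s.im| := by positivity
  rw [heightWeight, ← Real.rpow_natCast, ← Real.rpow_mul this]
  norm_num

lemma exists_norm_riemannZeta₁_le :
    ∃ C : ℝ, 0 < C ∧ ∀ s : ℂ, 39 / 40 < s.re → s.re ≤ 4 →
      ‖riemannZeta₁ s‖ ≤ C * heightWeight s ^ 21 := by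
  have hS : Summable fun n : ℕ => ((n + 1 : ℕ) : ℝ) ^ (-(41 / 40) : ℝ) :=
    (summable_nat_add_iff 1).2 (Real.summable_nat_rpow.2 (by norm_num))
  set S := ∑' n : ℕ, ((n + 1 : ℕ) : ℝ) ^ (-(41 / 40) : ℝ)
  have hS0 : 0 ≤ S := tsum_nonneg fun n => by positivity
  refine ⟨1 + 4 * S, by positivity, fun s hs hs4 => ?_⟩
  have hw := one_le_heightWeight s
  have hw20 := heightWeight_pow_twenty s
  rw [riemannZeta₁_eq_tsum hs]
  refine (norm_add_le _ _).trans ?_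
  rw [norm_one]
  have h1 : ‖∑' n : ℕ, zetaTerm (n + 1) s‖ ≤ 2 * ‖s - 1‖ * ‖s‖ ^ (1 / 20 : ℝ) * S := by
    refine tsum_of_norm_bounded (hS.hasSum.mul_left _) fun n => ?_
    exact norm_zetaTerm_le_rpow n.succ_pos hs.le
  have h2 : ‖s - 1‖ ≤ heightWeight s ^ 20 := by
    rw [hw20]
    refine (Complex.norm_le_abs_re_add_abs_im _).trans ?_
    simp only [Complex.sub_re, Complex.one_re, Complex.sub_im, Complex.one_im, sub_zero]
    gcongr
    rw [abs_le]; constructor <;> linarith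
  have h3 : ‖s‖ ≤ 2 * (3 + |s.im|) := by
    refine (Complex.norm_le_abs_re_add_abs_im _).trans ?_
    rw [abs_of_pos (by linarith : 0 < s.re)]
    linarith [abs_nonneg s.im]
  have h4 : ‖s‖ ^ (1 / 20 : ℝ) ≤ 2 * heightWeight s := by
    refine (Real.rpow_le_rpow (norm_nonneg _) h3 (by norm_num)).trans ?_
    rw [Real.mul_rpow (by norm_num) (by positivity)]
    have : (2 : ℝ) ^ (1 / 20 : ℝ) ≤ 2 := by
      conv_rhs => rw [← Real.rpow_one 2]
      exact Real.rpow_le_rpow_of_exponent_le (by norm_num) (by norm_num)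
    exact mul_le_mul_of_nonneg_right this (by positivity)
  have h5 : 2 * ‖s - 1‖ * ‖s‖ ^ (1 / 20 : ℝ) * S ≤
      2 * heightWeight s ^ 20 * (2 * heightWeight s) * S := by
    gcongr
  have h6 : 1 ≤ heightWeight s ^ 21 := one_le_pow₀ hw
  nlinarith

lemma heightWeight_le_two_mul {s z : ℂ} (h : |z.im| ≤ 2 * |s.im| + 1) :
    heightWeight z ≤ 2 * heightWeight s := by
  have h0 : 3 + |z.im| ≤ 2 * (3 + |s.im|) := by linarith [abs_nonneg s.im]
  refine (Real.rpow_le_rpow (by positivity) h0 (by norm_num)).trans ?_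
  rw [Real.mul_rpow (by norm_num) (by positivity)]
  have : (2 : ℝ) ^ (1 / 20 : ℝ) ≤ 2 := by
    conv_rhs => rw [← Real.rpow_one 2]
    exact Real.rpow_le_rpow_of_exponent_le (by norm_num) (by norm_num)
  exact mul_le_mul_of_nonneg_right this (by positivity)

lemma abs_im_le_of_norm_sub_le {s z : ℂ} {r : ℝ} (h : ‖z - s‖ ≤ r) : |z.im| ≤ |s.im| + r := by
  have h1 := (Complex.abs_im_le_norm (z - s)).trans h
  rw [Complex.sub_im] at h1
  have := abs_sub_abs_le_abs_sub z.im s.im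
  linarith

lemma abs_re_sub_le_of_norm_sub_le {s z : ℂ} {r : ℝ} (h : ‖z - s‖ ≤ r) : |z.re - s.re| ≤ r := by
  have h1 := (Complex.abs_re_le_norm (z - s)).trans h
  rwa [Complex.sub_re] at h1

lemma exists_norm_deriv_riemannZeta₁_le :
    ∃ C : ℝ, 0 < C ∧ ∀ s : ℂ, 1 < s.re → s.re ≤ 2 → ∀ z : ℂ, ‖z - s‖ ≤ 1 / 80 →
      ‖deriv riemannZeta₁ z‖ ≤ C * heightWeight s ^ 21 := by
  obtain ⟨C, hC, hb⟩ := exists_norm_riemannZeta₁_le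
  refine ⟨C * 2 ^ 21 * 80, by positivity, fun s h1 h2 z hz => ?_⟩
  have hd := Complex.norm_deriv_le_of_forall_mem_sphere_norm_le (c := z) (R := 1 / 80)
    (C := C * (2 * heightWeight s) ^ 21) (by norm_num)
    (differentiable_riemannZeta₁.diffContOnCl) (fun y hy => by
      have hy' : ‖y - s‖ ≤ 1 / 80 + 1 / 80 := by
        have : y - s = (y - z) + (z - s) := by ring
        rw [this]
        refine (norm_add_le _ _).trans (add_le_add ?_ hz)
        rw [← mem_sphere_iff_norm.1 hy]
      have hre := abs_le.1 (abs_re_sub_le_of_norm_sub_le hy')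
      have him := abs_im_le_of_norm_sub_le hy'
      refine (hb y (by linarith) (by linarith)).trans ?_
      have h0 : 0 ≤ heightWeight y := zero_le_one.trans (one_le_heightWeight y)
      gcongr
      exact heightWeight_le_two_mul (by linarith [abs_nonneg s.im]))
  refine hd.trans (le_of_eq ?_)
  ring

lemma exists_norm_riemannZeta₁_sub_le :
    ∃ C : ℝ, 0 < C ∧ ∀ s : ℂ, 1 < s.re → s.re ≤ 2 → ∀ z : ℂ, ‖z - s‖ ≤ 1 / 80 →
      ‖riemannZeta₁ z - riemannZeta₁ s‖ ≤ C * heightWeight s ^ 21 * ‖z - s‖ := by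
  obtain ⟨C, hC, hb⟩ := exists_norm_deriv_riemannZeta₁_le
  refine ⟨C, hC, fun s h1 h2 z hz => ?_⟩
  exact (convex_closedBall s (1 / 80)).norm_image_sub_le_of_norm_deriv_le
    (fun y _ => differentiable_riemannZeta₁.differentiableAt)
    (fun y hy => hb s h1 h2 y (mem_closedBall_iff_norm.1 hy)) (by simp)
    (mem_closedBall_iff_norm.2 hz)

lemma norm_riemannZeta_product_ge_one {x : ℝ} (hx : 0 < x) (y : ℝ) :
    1 ≤ ‖riemannZeta (1 + x)‖ ^ 3 * ‖riemannZeta (1 + x + Complex.I * y)‖ ^ 4 *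
      ‖riemannZeta (1 + x + 2 * Complex.I * y)‖ := by
  have := DirichletCharacter.norm_LFunction_product_ge_one (N := 1) 1 hx y
  simpa [DirichletCharacter.LFunctionTrivChar, DirichletCharacter.LFunction_modOne_eq] using this

lemma exists_le_norm_riemannZeta₁_pow_four :
    ∃ a : ℝ, 0 < a ∧ ∀ s : ℂ, 1 < s.re → s.re ≤ 4 → 1 ≤ |s.im| →
      a ^ 4 * (s.re - 1) ^ 3 * heightWeight s ^ 79 ≤ ‖riemannZeta₁ s‖ ^ 4 := by
  obtain ⟨C, hC, hb⟩ := exists_norm_riemannZeta₁_le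
  set D := C * 4 ^ 21 with hD
  have hD0 : 0 < D := by positivity
  set B := D ^ 3 * 4 ^ 4 * (4 * D) with hB
  have hB0 : 0 < B := by positivity
  refine ⟨(B⁻¹) ^ (1 / 4 : ℝ), by positivity, fun s h1 h4 him => ?_⟩
  have ha : ((B⁻¹) ^ (1 / 4 : ℝ)) ^ 4 = B⁻¹ := by
    rw [← Real.rpow_natCast, ← Real.rpow_mul (by positivity)]
    norm_num
  rw [ha]
  set x := s.re - 1 with hx
  have hx0 : 0 < x := by linarith
  have hw := one_le_heightWeight s
  have hw20 := heightWeight_pow_twenty s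
  set w := heightWeight s
  have ht : w ^ 20 / 4 ≤ |s.im| := by rw [hw20]; linarith
  have hs : (1 + x + Complex.I * s.im : ℂ) = s := by
    apply Complex.ext <;> simp [hx]
  have h341 := norm_riemannZeta_product_ge_one hx0 s.im
  rw [hs] at h341
  have e1 : ‖riemannZeta (1 + x)‖ ≤ D / x := by
    have hne : (1 + x : ℂ) ≠ 1 := by simpa using hx0.ne'
    rw [riemannZeta_eq_inv_sub_mul hne, add_sub_cancel_left, norm_mul, norm_inv, Complex.norm_real,
      Real.norm_of_nonneg hx0.le, div_eq_inv_mul]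
    gcongr
    refine (hb _ (by simp; linarith) (by simp; linarith)).trans ?_
    have : heightWeight (1 + x : ℂ) ≤ 4 := by
      unfold heightWeight
      simp only [Complex.add_im, Complex.one_im, Complex.ofReal_im, add_zero, abs_zero]
      refine (Real.rpow_le_rpow_of_exponent_le (by norm_num)
          (by norm_num : (1 / 20 : ℝ) ≤ 1)).trans ?_
      norm_num
    have h0 : 0 ≤ heightWeight (1 + x : ℂ) := zero_le_one.trans (one_le_heightWeight _)
    rw [hD]
    gcongr
  have e2 : ‖riemannZeta s‖ ≤ 4 * ‖riemannZeta₁ s‖ / w ^ 20 := by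
    have hne : s ≠ 1 := by rintro rfl; simp at h1
    rw [riemannZeta_eq_inv_sub_mul hne, norm_mul, norm_inv, mul_comm, ← div_eq_mul_inv]
    have : w ^ 20 / 4 ≤ ‖s - 1‖ := ht.trans (by simpa using Complex.abs_im_le_norm (s - 1))
    calc ‖riemannZeta₁ s‖ / ‖s - 1‖ ≤ ‖riemannZeta₁ s‖ / (w ^ 20 / 4) := by gcongr
      _ = _ := by field_simp
  have e3 : ‖riemannZeta (1 + x + 2 * Complex.I * s.im)‖ ≤ 4 * D * w := by
    set z : ℂ := 1 + x + 2 * Complex.I * s.im with hz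
    have hzre : z.re = 1 + x := by simp [hz]
    have hzim : z.im = 2 * s.im := by simp [hz]
    have hne : z ≠ 1 := by
      intro h
      rw [h] at hzre
      simp at hzre
      linarith
    rw [riemannZeta_eq_inv_sub_mul hne, norm_mul, norm_inv, mul_comm, ← div_eq_mul_inv]
    have h5 : w ^ 20 / 4 ≤ ‖z - 1‖ := by
      refine ht.trans ((le_trans ?_ (Complex.abs_im_le_norm (z - 1))))
      rw [Complex.sub_im, hzim, Complex.one_im, sub_zero, abs_mul]
      norm_num
      linarith [abs_nonneg s.im]
    have h6 : heightWeight z ≤ 2 * w := heightWeight_le_two_mul (by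
      rw [hzim, abs_mul]; norm_num)
    have h7 : ‖riemannZeta₁ z‖ ≤ C * (2 * w) ^ 21 := by
      refine (hb z (by linarith) (by linarith)).trans ?_
      have h0 : 0 ≤ heightWeight z := zero_le_one.trans (one_le_heightWeight z)
      gcongr
    calc ‖riemannZeta₁ z‖ / ‖z - 1‖ ≤ C * (2 * w) ^ 21 / (w ^ 20 / 4) := by gcongr
      _ = 4 * (C * 2 ^ 21) * w := by field_simp
      _ ≤ 4 * D * w := by
        rw [hD]
        gcongr
        norm_num
  have h8 : 1 ≤ (D / x) ^ 3 * (4 * ‖riemannZeta₁ s‖ / w ^ 20) ^ 4 * (4 * D * w) :=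
    h341.trans (by gcongr)
  have h9 : (D / x) ^ 3 * (4 * ‖riemannZeta₁ s‖ / w ^ 20) ^ 4 * (4 * D * w) =
      B * ‖riemannZeta₁ s‖ ^ 4 / (x ^ 3 * w ^ 79) := by
    rw [hB]; field_simp
  rw [h9, one_le_div (by positivity)] at h8
  rw [mul_assoc, inv_mul_le_iff₀ hB0]
  exact h8

lemma riemannZeta₁_ne_zero {s : ℂ} (hs : 1 ≤ s.re) : riemannZeta₁ s ≠ 0 := by
  by_cases h : s = 1
  · simp [h]
  · have := riemannZeta_ne_zero_of_one_le_re hs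
    rw [riemannZeta_eq_inv_sub_mul h] at this
    exact right_ne_zero_of_mul this

lemma exists_le_norm_riemannZeta₁ :
    ∃ c : ℝ, 0 < c ∧ ∀ s : ℂ, 1 < s.re → s.re ≤ 2 →
      c * heightWeight s ^ 16 ≤ ‖riemannZeta₁ s‖ := by
  obtain ⟨a, ha, hlow⟩ := exists_le_norm_riemannZeta₁_pow_four
  obtain ⟨C, hC, hlip⟩ := exists_norm_riemannZeta₁_sub_le
  set k := min (1 / 80) (a / (2 * C)) with hk
  have hk0 : 0 < k := by positivity
  have hk1 : k ≤ 1 / 80 := min_le_left _ _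
  have hk2 : C * k ≤ a / 2 := by
    have : k ≤ a / (2 * C) := min_le_right _ _
    rw [le_div_iff₀ (by positivity)] at this
    linarith
  have high : ∀ s : ℂ, 1 < s.re → s.re ≤ 2 → 1 ≤ |s.im| →
      a * k ^ 3 / 2 * heightWeight s ^ 16 ≤ ‖riemannZeta₁ s‖ := by
    intro s h1 h2 him
    have hw := one_le_heightWeight s
    set w := heightWeight s with hwdef
    have hw0 : 0 < w := by linarith
    set η := k ^ 4 / w ^ 5 with hη
    have hη0 : 0 < η := by positivity
    have hη1 : η ≤ 1 / 80 := by
      rw [hη, div_le_iff₀ (by positivity)]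
      have h1 : 1 ≤ w ^ 5 := one_le_pow₀ hw
      have h2 : k ^ 4 ≤ k := by
        have := pow_le_pow_of_le_one hk0.le (by linarith) (show 1 ≤ 4 by norm_num)
        simpa using this
      nlinarith
    set σ := max s.re (1 + η) with hσ
    have hσ1 : 1 + η ≤ σ := le_max_right _ _
    have hσ2 : s.re ≤ σ := le_max_left _ _
    have hσ3 : σ ≤ s.re + η := max_le (by linarith) (by linarith)
    set z : ℂ := ⟨σ, s.im⟩ with hz
    have hwz : heightWeight z = w := by simp [heightWeight, hwdef, hz]
    have hzs : ‖z - s‖ ≤ η := by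
      have : z - s = ((σ - s.re : ℝ) : ℂ) := by
        apply Complex.ext <;> simp [hz]
      rw [this, Complex.norm_real, Real.norm_of_nonneg (by linarith)]
      linarith
    have h3 := hlow z (by simp only [hz]; linarith) (by simp only [hz]; linarith) him
    rw [hwz] at h3
    have h4 : a * k ^ 3 * w ^ 16 ≤ ‖riemannZeta₁ z‖ := by
      refine le_of_pow_le_pow_left₀ (n := 4) (by norm_num) (norm_nonneg _) (le_trans ?_ h3)
      have : η ^ 3 ≤ (z.re - 1) ^ 3 := by
        gcongr
        simp only [hz]; linarith
      calc (a * k ^ 3 * w ^ 16) ^ 4 = a ^ 4 * η ^ 3 * w ^ 79 := by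
            rw [hη]; field_simp
        _ ≤ _ := by gcongr
    have h5 := hlip s h1 h2 z (hzs.trans hη1)
    have h6 : ‖riemannZeta₁ z‖ ≤ ‖riemannZeta₁ s‖ + ‖riemannZeta₁ z - riemannZeta₁ s‖ := by
      have : riemannZeta₁ z = riemannZeta₁ s + (riemannZeta₁ z - riemannZeta₁ s) := by ring
      conv_lhs => rw [this]
      exact norm_add_le _ _
    have h7 : C * w ^ 21 * ‖z - s‖ ≤ C * k ^ 4 * w ^ 16 := by
      calc C * w ^ 21 * ‖z - s‖ ≤ C * w ^ 21 * η := by gcongr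
        _ = _ := by rw [hη]; field_simp
    have h8 : C * k ^ 4 * w ^ 16 ≤ a / 2 * k ^ 3 * w ^ 16 := by
      calc C * k ^ 4 * w ^ 16 = C * k * (k ^ 3 * w ^ 16) := by ring
        _ ≤ a / 2 * (k ^ 3 * w ^ 16) := by gcongr
        _ = _ := by ring
    linarith
  have hK : IsCompact (Set.Icc (1 : ℝ) 2 ×ℂ Set.Icc (-1 : ℝ) 1) :=
      isCompact_Icc.reProdIm isCompact_Icc
  obtain ⟨z, hz, hmin⟩ := hK.exists_isMinOn ⟨1, by simp [Complex.mem_reProdIm]⟩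
    (f := fun s => ‖riemannZeta₁ s‖) differentiable_riemannZeta₁.continuous.norm.continuousOn
  set m := ‖riemannZeta₁ z‖
  have hm : 0 < m := norm_pos_iff.2 (riemannZeta₁_ne_zero hz.1.1)
  refine ⟨min (a * k ^ 3 / 2) (m / 4), by positivity, fun s h1 h2 => ?_⟩
  have hw := one_le_heightWeight s
  rcases le_total 1 |s.im| with h | h
  · refine le_trans ?_ (high s h1 h2 h)
    gcongr
    exact min_le_left _ _
  · have h3 : m ≤ ‖riemannZeta₁ s‖ := hmin ⟨⟨h1.le, h2⟩, abs_le.1 h⟩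
    refine le_trans ?_ h3
    have h4 : heightWeight s ^ 16 ≤ 4 := by
      refine (pow_le_pow_right₀ hw (show 16 ≤ 20 by norm_num)).trans ?_
      rw [heightWeight_pow_twenty]
      linarith
    have h5 : min (a * k ^ 3 / 2) (m / 4) ≤ m / 4 := min_le_right _ _
    calc _ ≤ m / 4 * 4 := by gcongr
      _ = m := by ring

/-- The function `-(ζ'/ζ(s) + 1/(s-1)) / (s (s+1))`, without its removable singularity. -/
noncomputable def smoothedLogDeriv (s : ℂ) : ℂ :=
  -(deriv riemannZeta₁ s / riemannZeta₁ s) / (s * (s + 1))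

lemma differentiableAt_smoothedLogDeriv {s : ℂ} (hs : 1 / 2 < s.re) (h : riemannZeta₁ s ≠ 0) :
    DifferentiableAt ℂ smoothedLogDeriv s := by
  have h1 : s ≠ 0 := by rintro rfl; simp at hs; linarith
  have h2 : s + 1 ≠ 0 := by
    intro h
    have := congrArg Complex.re h
    simp at this
    linarith
  have h3 : DifferentiableAt ℂ (deriv riemannZeta₁) s :=
    (differentiable_riemannZeta₁.differentiableOn.deriv isOpen_univ).differentiableAt
        Filter.univ_mem
  have h4 := differentiable_riemannZeta₁.differentiableAt (x := s)
  unfold smoothedLogDeriv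
  exact ((h3.div h4 h).neg).div (by fun_prop) (mul_ne_zero h1 h2)

lemma exists_norm_iteratedDeriv_smoothedLogDeriv_le :
    ∃ C : ℝ, 0 < C ∧ ∀ s : ℂ, 1 < s.re → s.re ≤ 2 →
      ‖iteratedDeriv 2 smoothedLogDeriv s‖ ≤ C / heightWeight s ^ 25 := by
  obtain ⟨c, hc, hlow⟩ := exists_le_norm_riemannZeta₁
  obtain ⟨C, hC, hlip⟩ := exists_norm_riemannZeta₁_sub_le
  obtain ⟨D, hD, hder⟩ := exists_norm_deriv_riemannZeta₁_le
  set κ := min (1 / 80) (c / (2 * C)) with hκ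
  have hκ0 : 0 < κ := by positivity
  have hκ1 : κ ≤ 1 / 80 := min_le_left _ _
  have hκ2 : C * κ ≤ c / 2 := by
    have : κ ≤ c / (2 * C) := min_le_right _ _
    rw [le_div_iff₀ (by positivity)] at this
    linarith
  refine ⟨2 * (D / (c / 2) * 81) / κ ^ 2, by positivity, fun s h1 h2 => ?_⟩
  have hw := one_le_heightWeight s
  have hw20 := heightWeight_pow_twenty s
  have hlow := hlow s h1 h2
  have hlip := hlip s h1 h2
  have hder := hder s h1 h2
  set w := heightWeight s with hwdef
  have hw0 : 0 < w := by linarith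
  set r := κ / w ^ 5 with hr
  have hr0 : 0 < r := by positivity
  have hr1 : r ≤ 1 / 80 := by
    refine le_trans (div_le_self hκ0.le (one_le_pow₀ hw)) hκ1
  have hlow' : ∀ z : ℂ, ‖z - s‖ ≤ r → c / 2 * w ^ 16 ≤ ‖riemannZeta₁ z‖ := by
    intro z hz
    have h3 := hlip z (hz.trans hr1)
    have h4 : ‖riemannZeta₁ s‖ ≤ ‖riemannZeta₁ z‖ + ‖riemannZeta₁ z - riemannZeta₁ s‖ := by
      have : riemannZeta₁ s = riemannZeta₁ z - (riemannZeta₁ z - riemannZeta₁ s) := by ring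
      conv_lhs => rw [this]
      exact norm_sub_le _ _
    have h5 : C * w ^ 21 * ‖z - s‖ ≤ C * κ * w ^ 16 := by
      calc C * w ^ 21 * ‖z - s‖ ≤ C * w ^ 21 * r := by gcongr
        _ = _ := by rw [hr]; field_simp
    have h6 : C * κ * w ^ 16 ≤ c / 2 * w ^ 16 := by gcongr
    linarith
  have hre : ∀ z : ℂ, ‖z - s‖ ≤ r → 1 / 2 < z.re := fun z hz => by
    have := abs_le.1 (abs_re_sub_le_of_norm_sub_le hz)
    linarith
  have hnorm : ∀ z : ℂ, 1 / 2 < z.re → |s.im| ≤ |z.im| + 1 → w ^ 20 / 9 ≤ ‖z‖ := by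
    intro z hz hz'
    have h3 := Complex.abs_im_le_norm z
    have h4 := Complex.re_le_norm z
    rw [hw20]
    linarith
  have hbound : ∀ z ∈ Metric.sphere s r, ‖smoothedLogDeriv z‖ ≤ D / (c / 2) * 81 / w ^ 35 := by
    intro z hz
    have hz' : ‖z - s‖ ≤ r := (mem_sphere_iff_norm.1 hz).le
    have h3 := hder z (hz'.trans hr1)
    have h4 := hlow' z hz'
    have h5 := hre z hz'
    have h6 : |s.im| ≤ |z.im| + 1 := by
      rw [norm_sub_rev] at hz'
      have := abs_im_le_of_norm_sub_le hz'
      linarith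
    have h7 := hnorm z h5 h6
    have h8 := hnorm (z + 1) (by simp; linarith) (by simpa using h6)
    rw [smoothedLogDeriv, norm_div, norm_neg, norm_div, norm_mul]
    calc _ ≤ D * w ^ 21 / (c / 2 * w ^ 16) / (w ^ 20 / 9 * (w ^ 20 / 9)) := by gcongr
      _ = _ := by field_simp; norm_num
  have hdiff : DiffContOnCl ℂ smoothedLogDeriv (Metric.ball s r) := by
    refine DifferentiableOn.diffContOnCl fun z hz => ?_
    rw [closure_ball _ hr0.ne'] at hz
    have hz' := mem_closedBall_iff_norm.1 hz
    refine (differentiableAt_smoothedLogDeriv (hre z hz') ?_).differentiableWithinAt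
    rw [← norm_pos_iff]
    exact lt_of_lt_of_le (by positivity) (hlow' z hz')
  have := Complex.norm_iteratedDeriv_le_of_forall_mem_sphere_norm_le 2 hr0 hdiff hbound
  refine this.trans (le_of_eq ?_)
  rw [hr, Nat.factorial_two]
  push_cast
  field_simp

open ArithmeticFunction in
/-- The integral `∫ t in 0..x, ψ t` of the second Chebyshev function. -/
noncomputable def psiIntegral (x : ℝ) : ℝ := ∑' n : ℕ, vonMangoldt n * max (x - n) 0

lemma psiIntegral_eq_sum {x : ℝ} {N : ℕ} (h : x ≤ N) :
    psiIntegral x = ∑ n ∈ range N, ArithmeticFunction.vonMangoldt n * max (x - n) 0 := by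
  refine tsum_eq_sum fun n hn => ?_
  have : (N : ℝ) ≤ n := by exact_mod_cast (by simpa using hn : N ≤ n)
  rw [max_eq_right (by linarith), mul_zero]

lemma continuous_psiIntegral : Continuous psiIntegral := by
  rw [continuous_iff_continuousAt]
  intro x
  obtain ⟨N, hN⟩ := exists_nat_gt x
  have h : (fun y => ∑ n ∈ range N, ArithmeticFunction.vonMangoldt n * max (y - n) 0) =ᶠ[nhds x]
      psiIntegral := by
    filter_upwards [Iio_mem_nhds hN] with y hy
    exact (psiIntegral_eq_sum hy.le).symm
  refine ContinuousAt.congr ?_ h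
  fun_prop

lemma psiIntegral_nonneg (x : ℝ) : 0 ≤ psiIntegral x :=
  tsum_nonneg fun _ => mul_nonneg ArithmeticFunction.vonMangoldt_nonneg (le_max_right _ _)

lemma psiIntegral_eq_zero {x : ℝ} (hx : x ≤ 1) : psiIntegral x = 0 := by
  rw [psiIntegral_eq_sum (N := 1) (by simpa using hx)]
  simp

/-- The increments of `psiIntegral` are squeezed between values of `ψ`. -/
lemma psi_mul_le_psiIntegral_sub {x y : ℝ} (hx : 0 ≤ x) (hxy : x ≤ y) :
    Chebyshev.psi x * (y - x) ≤ psiIntegral y - psiIntegral x := by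
  obtain ⟨N, hN⟩ := exists_nat_gt y
  rw [psiIntegral_eq_sum hN.le, psiIntegral_eq_sum (hxy.trans hN.le), ← sum_sub_distrib,
    Chebyshev.psi, sum_mul]
  have hle : ∀ n ∈ Ioc 0 ⌊x⌋₊, (n : ℝ) ≤ x := fun n hn =>
    (Nat.le_floor_iff hx).1 (Finset.mem_Ioc.1 hn).2
  refine (sum_le_sum fun n hn => ?_).trans (sum_le_sum_of_subset_of_nonneg (fun n hn => ?_)
    fun n _ _ => ?_)
  · have := hle n hn
    rw [max_eq_left (by linarith), max_eq_left (by linarith)]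
    exact le_of_eq (by ring)
  · have := hle n hn
    exact Finset.mem_range.2 (by exact_mod_cast (by linarith : (n : ℝ) < N))
  · rw [← mul_sub]
    exact mul_nonneg ArithmeticFunction.vonMangoldt_nonneg
      (sub_nonneg.2 (max_le_max_right 0 (by linarith)))

lemma psiIntegral_sub_le_psi_mul {x y : ℝ} (hx : 0 ≤ x) (hxy : x ≤ y) :
    psiIntegral y - psiIntegral x ≤ Chebyshev.psi y * (y - x) := by
  obtain ⟨N, hN⟩ := exists_nat_gt y
  rw [psiIntegral_eq_sum hN.le, psiIntegral_eq_sum (hxy.trans hN.le), ← sum_sub_distrib,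
    Chebyshev.psi, sum_mul]
  have hy := hx.trans hxy
  rw [← sum_subset (s₁ := Ioc 0 ⌊y⌋₊)]
  · refine sum_le_sum fun n _ => ?_
    rw [← mul_sub]
    refine mul_le_mul_of_nonneg_left ?_ ArithmeticFunction.vonMangoldt_nonneg
    rw [sub_le_iff_le_add]
    refine max_le ?_ ?_
    · linarith [le_max_left (x - n) 0]
    · linarith [le_max_right (x - n) 0]
  · intro n hn
    have := (Nat.le_floor_iff hy).1 (Finset.mem_Ioc.1 hn).2
    exact Finset.mem_range.2 (by exact_mod_cast (by linarith : (n : ℝ) < N))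
  · intro n _ hn
    rcases Nat.eq_zero_or_pos n with rfl | hn0
    · simp
    have : y < n := by
      rw [← Nat.floor_lt hy]
      by_contra h
      exact hn (Finset.mem_Ioc.2 ⟨hn0, not_lt.1 h⟩)
    rw [max_eq_right (by linarith), max_eq_right (by linarith), sub_self]

open Complex MeasureTheory in
lemma integrable_and_integral_max_exp_sub {c : ℝ} (hc : 0 < c) {s : ℂ} (hs : 0 < s.re) :
    Integrable (fun u : ℝ => (max (Real.exp u - c) 0 : ℝ) * cexp (-(s + 1) * u)) ∧
      ∫ u : ℝ, (max (Real.exp u - c) 0 : ℝ) * cexp (-(s + 1) * u) =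
          (c : ℂ) ^ (-s) / (s * (s + 1)) := by
  have h1 : (-s).re < 0 := by simpa using hs
  have h2 : (-(s + 1)).re < 0 := by simp; linarith
  have hs0 : s ≠ 0 := by rintro rfl; simp at hs
  have hs1 : s + 1 ≠ 0 := by
    intro h
    have := congrArg re h
    simp at this
    linarith
  have hf : (fun u : ℝ => (max (Real.exp u - c) 0 : ℝ) * cexp (-(s + 1) * u)) =
      (Set.Ioi (Real.log c)).indicator (fun u : ℝ => cexp (-s * u) - c * cexp (-(s + 1) * u)) := by
    ext u
    by_cases hu : u ∈ Set.Ioi (Real.log c)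
    · have h3 : c < Real.exp u := (Real.log_lt_iff_lt_exp hc).1 hu
      rw [Set.indicator_of_mem hu, max_eq_left (by linarith)]
      push_cast
      rw [sub_mul, ← Complex.exp_add]
      ring_nf
    · have h3 : Real.exp u ≤ c := (Real.le_log_iff_exp_le hc).1 (not_lt.1 hu)
      rw [Set.indicator_of_notMem hu, max_eq_right (by linarith)]
      simp
  have i1 := integrableOn_exp_mul_complex_Ioi h1 (Real.log c)
  have i2 := (integrableOn_exp_mul_complex_Ioi h2 (Real.log c)).const_mul (c : ℂ)
  rw [hf]
  refine ⟨IntegrableOn.integrable_indicator (i1.sub i2) measurableSet_Ioi, ?_⟩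
  rw [integral_indicator measurableSet_Ioi, integral_sub i1 i2, integral_const_mul,
    integral_exp_mul_complex_Ioi h1, integral_exp_mul_complex_Ioi h2]
  have hc' : (c : ℂ) ≠ 0 := by exact_mod_cast hc.ne'
  have e1 : cexp (-s * (Real.log c : ℝ)) = (c : ℂ) ^ (-s) := by
    rw [cpow_def_of_ne_zero hc', ofReal_log hc.le]; ring_nf
  have e2 : (c : ℂ) * cexp (-(s + 1) * (Real.log c : ℝ)) = (c : ℂ) ^ (-s) := by
    have : cexp (-(s + 1) * (Real.log c : ℝ)) = (c : ℂ) ^ (-(s + 1)) := by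
      rw [cpow_def_of_ne_zero hc', ofReal_log hc.le]; ring_nf
    rw [this, show -s = 1 + -(s + 1) by ring, cpow_add _ _ hc', cpow_one]
  rw [mul_div_assoc', mul_neg, e1, e2]
  field_simp
  ring

open Complex MeasureTheory in
lemma integral_psiIntegral_exp {s : ℂ} (hs : 1 < s.re) :
    ∫ u : ℝ, psiIntegral (Real.exp u) * cexp (-(s + 1) * u) =
      LSeries (fun n => (ArithmeticFunction.vonMangoldt n : ℂ)) s / (s * (s + 1)) := by
  set F : ℕ → ℝ → ℂ := fun n u =>
    (ArithmeticFunction.vonMangoldt n : ℂ) * ((max (Real.exp u - n) 0 : ℝ) * cexp (-(s + 1) * u))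
  have hF : ∀ n, Integrable (F n) ∧
      ∫ u, F n u =
          LSeries.term (fun n => (ArithmeticFunction.vonMangoldt n : ℂ)) s n / (s * (s + 1)) := by
    intro n
    rcases Nat.eq_zero_or_pos n with rfl | hn
    · simp [F]
    · have := integrable_and_integral_max_exp_sub (c := n) (by exact_mod_cast hn) (s := s)
          (by linarith)
      refine ⟨this.1.const_mul _, ?_⟩
      rw [integral_const_mul, this.2, LSeries.term_of_ne_zero hn.ne', cpow_neg]
      push_cast
      field_simp
  have hnorm : ∀ n, ∫ u, ‖F n u‖ = ‖LSeries.term (fun n => (ArithmeticFunction.vonMangoldt n : ℂ)) s n‖ / (s.re * (s.re + 1)) := by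
    intro n
    rcases Nat.eq_zero_or_pos n with rfl | hn
    · simp [F]
    · have h1 := (integrable_and_integral_max_exp_sub (c := n) (by exact_mod_cast hn)
          (s := (s.re : ℂ)) (by simp; linarith)).2
      have hn' : (0 : ℝ) < n := by exact_mod_cast hn
      have h2 : ∀ u : ℝ, ‖F n u‖ = ArithmeticFunction.vonMangoldt n * (max (Real.exp u - n) 0 * Real.exp (-(s.re + 1) * u)) := by
        intro u
        simp only [F, norm_mul, norm_real,
            Real.norm_of_nonneg ArithmeticFunction.vonMangoldt_nonneg,
          Real.norm_of_nonneg (le_max_right (Real.exp u - n) 0), norm_exp]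
        simp
      simp_rw [h2]
      have h3 : ∫ u : ℝ, max (Real.exp u - n) 0 * Real.exp (-(s.re + 1) * u) =
          (n : ℝ) ^ (-s.re) / (s.re * (s.re + 1)) := by
        apply ofReal_injective
        rw [← integral_complex_ofReal]
        push_cast
        rw [ofReal_cpow hn'.le]
        push_cast at h1 ⊢
        rw [← h1]
      rw [integral_const_mul, h3, LSeries.norm_term_eq, if_neg hn.ne', norm_real,
        Real.norm_of_nonneg ArithmeticFunction.vonMangoldt_nonneg, Real.rpow_neg hn'.le]
      field_simp
  have hL := ArithmeticFunction.LSeriesSummable_vonMangoldt hs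
  have := hasSum_integral_of_summable_integral_norm (fun n => (hF n).1) (by
    simp_rw [hnorm]
    exact hL.norm.div_const _)
  simp_rw [(hF _).2] at this
  rw [LSeries, ← tsum_div_const, this.tsum_eq]
  refine integral_congr_ae (Eventually.of_forall fun u => ?_)
  simp only [F, psiIntegral, ofReal_tsum, ← tsum_mul_right]
  refine tsum_congr fun n => ?_
  push_cast
  ring

open Complex MeasureTheory in
lemma integrable_and_integral_sq_max_exp_sub_one {s : ℂ} (hs : 1 < s.re) :
    Integrable (fun u : ℝ => ((max (Real.exp u - 1) 0 : ℝ) ^ 2 / 2 : ℂ) * cexp (-(s + 1) * u)) ∧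
      ∫ u : ℝ, ((max (Real.exp u - 1) 0 : ℝ) ^ 2 / 2 : ℂ) * cexp (-(s + 1) * u) =
        1 / ((s - 1) * s * (s + 1)) := by
  have h0 : (-(s - 1)).re < 0 := by simpa using hs
  have h1 : (-s).re < 0 := by simp; linarith
  have h2 : (-(s + 1)).re < 0 := by simp; linarith
  have hs0 : s ≠ 0 := by rintro rfl; simp at hs; linarith
  have hs1 : s + 1 ≠ 0 := by
    intro h
    have := congrArg re h
    simp at this
    linarith
  have hs2 : s - 1 ≠ 0 := by
    intro h
    have := congrArg re h
    simp at this
    linarith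
  have hf : (fun u : ℝ => ((max (Real.exp u - 1) 0 : ℝ) ^ 2 / 2 : ℂ) * cexp (-(s + 1) * u)) =
      (Set.Ioi 0).indicator (fun u : ℝ =>
        (1 / 2) * cexp (-(s - 1) * u) - cexp (-s * u) + (1 / 2) * cexp (-(s + 1) * u)) := by
    ext u
    by_cases hu : u ∈ Set.Ioi (0 : ℝ)
    · have h3 : 1 < Real.exp u := Real.one_lt_exp_iff.2 hu
      rw [Set.indicator_of_mem hu, max_eq_left (by linarith)]
      push_cast
      rw [show -(s - 1) * (u : ℂ) = u + u + -(s + 1) * u by ring,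
        show -s * (u : ℂ) = u + -(s + 1) * u by ring]
      simp only [Complex.exp_add]
      ring
    · have h3 : Real.exp u ≤ 1 := Real.exp_le_one_iff.2 (not_lt.1 hu)
      rw [Set.indicator_of_notMem hu, max_eq_right (by linarith)]
      simp
  have i0 := (integrableOn_exp_mul_complex_Ioi h0 0).const_mul (1 / 2 : ℂ)
  have i1 := integrableOn_exp_mul_complex_Ioi h1 0
  have i2 := (integrableOn_exp_mul_complex_Ioi h2 0).const_mul (1 / 2 : ℂ)
  rw [hf]
  refine ⟨IntegrableOn.integrable_indicator ((i0.sub i1).add i2) measurableSet_Ioi, ?_⟩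
  have i01 : IntegrableOn (fun u : ℝ => (1 / 2) * cexp (-(s - 1) * u) - cexp (-s * u))
      (Set.Ioi 0) :=
    i0.sub i1
  rw [integral_indicator measurableSet_Ioi, integral_add i01 i2, integral_sub i0 i1,
    integral_const_mul, integral_const_mul, integral_exp_mul_complex_Ioi h0,
    integral_exp_mul_complex_Ioi h1, integral_exp_mul_complex_Ioi h2]
  simp only [ofReal_zero, mul_zero, Complex.exp_zero]
  field_simp
  ring

/-- The normalized error term of the approximation of `psiIntegral` at `exp u`. -/
noncomputable def psiIntegralError (u : ℝ) : ℝ :=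
  (psiIntegral (Real.exp u) - max (Real.exp u - 1) 0 ^ 2 / 2) * Real.exp (-2 * u)

lemma continuous_psiIntegralError : Continuous psiIntegralError := by
  have := continuous_psiIntegral.comp Real.continuous_exp
  unfold psiIntegralError
  simp only [Function.comp_def] at this
  fun_prop

lemma psiIntegralError_eq_zero {u : ℝ} (hu : u ≤ 0) : psiIntegralError u = 0 := by
  have h : Real.exp u ≤ 1 := Real.exp_le_one_iff.2 hu
  rw [psiIntegralError, psiIntegral_eq_zero h, max_eq_right (by linarith)]
  simp

lemma exists_abs_psiIntegralError_le : ∃ C : ℝ, 0 < C ∧ ∀ u, |psiIntegralError u| ≤ C := by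
  refine ⟨(Real.log 4 + 4) + 1, by positivity, fun u => ?_⟩
  have hx := Real.exp_pos u
  have hE : Real.exp (-2 * u) = (Real.exp u ^ 2)⁻¹ := by
    rw [← Real.exp_nat_mul, ← Real.exp_neg]; congr 1; push_cast; ring
  have h1 : psiIntegral (Real.exp u) ≤ (Real.log 4 + 4) * Real.exp u ^ 2 := by
    have h2 := psiIntegral_sub_le_psi_mul le_rfl hx.le
    have h3 := Chebyshev.psi_le_const_mul_self hx.le
    rw [psiIntegral_eq_zero (by norm_num : (0 : ℝ) ≤ 1)] at h2
    nlinarith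
  have h0 := psiIntegral_nonneg (Real.exp u)
  have h4 : 0 ≤ max (Real.exp u - 1) 0 := le_max_right _ _
  have h5 : max (Real.exp u - 1) 0 ≤ Real.exp u := max_le (by linarith) hx.le
  have h6 : max (Real.exp u - 1) 0 ^ 2 ≤ Real.exp u ^ 2 := by gcongr
  have hl : 0 ≤ Real.log 4 := Real.log_nonneg (by norm_num)
  rw [psiIntegralError, hE, abs_mul, abs_inv, abs_of_nonneg (sq_nonneg (Real.exp u)),
    ← div_eq_mul_inv, div_le_iff₀ (by positivity), abs_le]
  constructor <;> nlinarith [sq_nonneg (max (Real.exp u - 1) 0)]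

open MeasureTheory in
lemma integrable_pow_mul_psiIntegralError_mul_exp {δ : ℝ} (hδ : 0 < δ) (k : ℕ) :
    Integrable fun u : ℝ => u ^ k * (psiIntegralError u * Real.exp (-δ * u)) := by
  obtain ⟨C, hC, hb⟩ := exists_abs_psiIntegralError_le
  have h1 : IntegrableOn (fun u : ℝ => u ^ k * Real.exp (-δ * u)) (Set.Ioi 0) := by
    have := integrableOn_rpow_mul_exp_neg_mul_rpow (p := 1) (s := k) (b := δ) (by
      have : (0 : ℝ) ≤ k := by positivity
      linarith) one_pos hδ
    simpa using this
  have h2 := IntegrableOn.integrable_indicator (h1.const_mul C) measurableSet_Ioi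
  refine h2.mono' ?_ (Eventually.of_forall fun u => ?_)
  · have := continuous_psiIntegralError
    exact Continuous.aestronglyMeasurable (by fun_prop)
  · by_cases hu : u ∈ Set.Ioi (0 : ℝ)
    · rw [Set.indicator_of_mem hu]
      have hu' : 0 < u := hu
      rw [norm_mul, norm_mul, norm_pow, Real.norm_of_nonneg hu'.le,
          Real.norm_of_nonneg (Real.exp_pos _).le]
      calc u ^ k * (‖psiIntegralError u‖ * Real.exp (-δ * u))
          ≤ u ^ k * (C * Real.exp (-δ * u)) := by
            gcongr; exact hb u
        _ = _ := by ring
    · rw [Set.indicator_of_notMem hu, psiIntegralError_eq_zero (not_lt.1 hu)]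
      simp

open Complex in
lemma smoothedLogDeriv_eq {s : ℂ} (hs : 1 < s.re) :
    smoothedLogDeriv s = (-deriv riemannZeta s / riemannZeta s) / (s * (s + 1)) -
      1 / ((s - 1) * s * (s + 1)) := by
  have hs0 : s ≠ 0 := by rintro rfl; simp at hs; linarith
  have hs1 : s + 1 ≠ 0 := by
    intro h
    have := congrArg re h
    simp at this
    linarith
  have hs2 : s ≠ 1 := by rintro rfl; simp at hs
  have hs3 : s - 1 ≠ 0 := sub_ne_zero.2 hs2
  have hZ := riemannZeta₁_ne_zero hs.le
  have hev : riemannZeta =ᶠ[nhds s] fun z => (z - 1)⁻¹ * riemannZeta₁ z := by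
    filter_upwards [isOpen_ne.mem_nhds hs2] with z hz
    exact riemannZeta_eq_inv_sub_mul hz
  have hd : HasDerivAt (fun z : ℂ => (z - 1)⁻¹ * riemannZeta₁ z)
      (-1 / (s - 1) ^ 2 * riemannZeta₁ s + (s - 1)⁻¹ * deriv riemannZeta₁ s) s :=
    (((hasDerivAt_id s).sub_const 1).inv hs3).mul
      (differentiable_riemannZeta₁.differentiableAt.hasDerivAt)
  rw [hev.deriv_eq, hd.deriv, riemannZeta_eq_inv_sub_mul hs2, smoothedLogDeriv]
  field_simp
  ring

open Complex MeasureTheory in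
lemma integral_psiIntegralError_mul_exp {s : ℂ} (hs : 1 < s.re) :
    ∫ u : ℝ, psiIntegralError u * cexp (-(s - 1) * u) = smoothedLogDeriv s := by
  have e : ∀ u : ℝ, psiIntegralError u * cexp (-(s - 1) * u) =
      psiIntegral (Real.exp u) * cexp (-(s + 1) * u) -
        ((max (Real.exp u - 1) 0 : ℝ) ^ 2 / 2 : ℂ) * cexp (-(s + 1) * u) := by
    intro u
    rw [psiIntegralError, show -(s + 1) * (u : ℂ) = -2 * u + -(s - 1) * u by ring, Complex.exp_add]
    push_cast
    ring
  have i2 := integrable_and_integral_sq_max_exp_sub_one hs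
  have i1 : Integrable fun u : ℝ => psiIntegral (Real.exp u) * cexp (-(s + 1) * u) := by
    have h1 : Integrable fun u : ℝ => psiIntegralError u * cexp (-(s - 1) * u) := by
      have := integrable_pow_mul_psiIntegralError_mul_exp (δ := s.re - 1) (by linarith) 0
      refine this.norm.mono' ?_ (Eventually.of_forall fun u => ?_)
      · have := continuous_psiIntegralError
        exact Continuous.aestronglyMeasurable (by fun_prop)
      · simp [norm_exp]
    refine (h1.add i2.1).congr (Eventually.of_forall fun u => ?_)
    simp only [Pi.add_apply, e]
    ring
  simp_rw [e]
  rw [integral_sub i1 i2.1, i2.2, integral_psiIntegral_exp hs,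
    ArithmeticFunction.LSeries_vonMangoldt_eq_deriv_riemannZeta_div hs, smoothedLogDeriv_eq hs]

open Complex Real in
lemma iteratedDeriv_two_smoothedLogDeriv_vertical {σ : ℝ} (hσ : 1 < σ) (ξ : ℝ) :
    iteratedDeriv 2 (fun t : ℝ => smoothedLogDeriv (σ + 2 * π * I * t)) ξ =
      (2 * π * I) ^ 2 * iteratedDeriv 2 smoothedLogDeriv (σ + 2 * π * I * ξ) := by
  have hU : IsOpen {s : ℂ | 1 < s.re} := isOpen_lt continuous_const Complex.continuous_re
  have hd : DifferentiableOn ℂ smoothedLogDeriv {s : ℂ | 1 < s.re} := fun s hs => by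
    have hs' : 1 < s.re := hs
    exact (differentiableAt_smoothedLogDeriv (by linarith)
      (riemannZeta₁_ne_zero hs'.le)).differentiableWithinAt
  have hmem : ∀ t : ℝ, (σ + 2 * π * I * t : ℂ) ∈ {s : ℂ | 1 < s.re} := by
    intro t
    simpa using hσ
  have hl : ∀ t : ℝ, HasDerivAt (fun t : ℝ => (σ + 2 * π * I * t : ℂ)) (2 * π * I) t := by
    intro t
    simpa using ((hasDerivAt_id t).ofReal_comp.const_mul (2 * π * I : ℂ)).const_add (σ : ℂ)
  have hcomp : ∀ {G : ℂ → ℂ}, DifferentiableOn ℂ G {s : ℂ | 1 < s.re} → ∀ t : ℝ,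
      HasDerivAt (fun t : ℝ => G (σ + 2 * π * I * t))
          (deriv G (σ + 2 * π * I * t) * (2 * π * I)) t :=
    fun hG t => ((hG.differentiableAt (hU.mem_nhds (hmem t))).hasDerivAt).comp t (hl t)
  have e : deriv (fun t : ℝ => smoothedLogDeriv (σ + 2 * π * I * t)) =
      fun t : ℝ => deriv smoothedLogDeriv (σ + 2 * π * I * t) * (2 * π * I) :=
    funext fun t => (hcomp hd t).deriv
  simp only [iteratedDeriv_succ, iteratedDeriv_zero]
  rw [e, ((hcomp (hd.deriv hU) ξ).mul_const _).deriv]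
  ring

open Complex MeasureTheory Real FourierTransform in
lemma exists_sq_mul_abs_psiIntegralError_le :
    ∃ K : ℝ, 0 < K ∧ ∀ u, u ^ 2 * |psiIntegralError u| ≤ K := by
  obtain ⟨C, hC, hb⟩ := exists_norm_iteratedDeriv_smoothedLogDeriv_le
  have hgInt : Integrable fun ξ : ℝ => (2 * π) ^ 2 * (C * (1 + ‖ξ‖) ^ (-(5 / 4) : ℝ)) :=
    ((integrable_one_add_norm (by norm_num)).const_mul C).const_mul _
  set K := ∫ ξ : ℝ, (2 * π) ^ 2 * (C * (1 + ‖ξ‖) ^ (-(5 / 4) : ℝ)) with hK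
  have key : ∀ u σ : ℝ, 1 < σ → σ ≤ 2 →
      (2 * π) ^ 2 * (u ^ 2 * (|psiIntegralError u| * Real.exp (-(σ - 1) * u))) ≤ K := by
    intro u σ hσ hσ2
    set f : ℝ → ℂ := fun u => ((psiIntegralError u * Real.exp (-(σ - 1) * u) : ℝ) : ℂ) with hf
    have hfc : Continuous f := by
      have := continuous_psiIntegralError
      fun_prop
    have hi : ∀ k : ℕ, Integrable fun u : ℝ => u ^ k • f u := fun k => by
      have := (integrable_pow_mul_psiIntegralError_mul_exp (sub_pos.2 hσ) k).ofReal (𝕜 := ℂ)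
      refine this.congr (Eventually.of_forall fun u => ?_)
      simp [hf]
    have hF : 𝓕 f = fun ξ : ℝ => smoothedLogDeriv (σ + 2 * π * I * ξ) := by
      funext ξ
      rw [← integral_psiIntegralError_mul_exp (by simpa using hσ),
          fourier_real_eq_integral_exp_smul]
      refine integral_congr_ae (Eventually.of_forall fun v => ?_)
      simp only [hf, smul_eq_mul]
      push_cast
      rw [mul_left_comm, ← Complex.exp_add]
      ring_nf
    set g : ℝ → ℂ := fun x => (-2 * π * I * x) ^ 2 • f x with hg
    have hgc : Continuous g := by fun_prop
    have hgi : Integrable g := by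
      refine ((hi 2).const_mul ((-2 * π * I) ^ 2)).congr (Eventually.of_forall fun u => ?_)
      simp only [hg, smul_eq_mul, real_smul]
      push_cast
      ring
    have hFg : 𝓕 g = fun ξ : ℝ =>
        (2 * π * I) ^ 2 * iteratedDeriv 2 smoothedLogDeriv (σ + 2 * π * I * ξ) := by
      rw [hg, ← iteratedDeriv_fourier (N := 2) (fun n _ => hi n) le_rfl, hF]
      funext ξ
      exact iteratedDeriv_two_smoothedLogDeriv_vertical hσ ξ
    have hbound : ∀ ξ, ‖𝓕 g ξ‖ ≤ (2 * π) ^ 2 * (C * (1 + ‖ξ‖) ^ (-(5 / 4) : ℝ)) := by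
      intro ξ
      have h1 := hb (σ + 2 * π * I * ξ) (by simpa using hσ) (by simpa using hσ2)
      have h2 : (1 + ‖ξ‖) ^ (5 / 4 : ℝ) ≤ heightWeight (σ + 2 * π * I * ξ) ^ 25 := by
        rw [heightWeight, ← Real.rpow_natCast, ← Real.rpow_mul (by positivity)]
        norm_num
        rw [abs_of_pos Real.pi_pos]
        gcongr
        · norm_num
        · have := Real.pi_gt_three
          nlinarith [abs_nonneg ξ]
      have hp : 0 < (1 + ‖ξ‖) ^ (5 / 4 : ℝ) := by positivity
      rw [hFg, norm_mul, Real.rpow_neg (by positivity), ← div_eq_mul_inv]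
      have h3 : ‖(2 * π * I : ℂ) ^ 2‖ = (2 * π) ^ 2 := by
        simp [abs_of_pos Real.pi_pos]
      rw [h3]
      gcongr
      exact h1.trans (by gcongr)
    have hFgc : Continuous (𝓕 g) :=
      VectorFourier.fourierIntegral_continuous Real.continuous_fourierChar
        (by exact continuous_inner) hgi
    have hFgi : Integrable (𝓕 g) :=
      hgInt.mono' hFgc.aestronglyMeasurable (Eventually.of_forall hbound)
    have hinv := congrFun (hgc.fourierInv_fourier_eq hgi hFgi) u
    have h4 : ‖g u‖ = (2 * π) ^ 2 * (u ^ 2 * (|psiIntegralError u| * Real.exp (-(σ - 1) * u))) := by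
      simp only [hg, hf, norm_smul, norm_pow, norm_mul, norm_real, norm_I, norm_neg, mul_pow]
      simp [abs_of_pos Real.pi_pos]
      ring
    rw [← h4, ← hinv, fourierInv_eq_fourier_neg]
    calc ‖𝓕 (𝓕 g) (-u)‖ ≤ ∫ ξ, ‖𝓕 g ξ‖ :=
        VectorFourier.norm_fourierIntegral_le_integral_norm _ _ _ _ _
      _ ≤ K := integral_mono hFgi.norm hgInt hbound
  refine ⟨|K| + 1, by positivity, fun u => ?_⟩
  have hlim : Tendsto
      (fun σ : ℝ => (2 * π) ^ 2 * (u ^ 2 * (|psiIntegralError u| * Real.exp (-(σ - 1) * u))))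
      (nhdsWithin 1 (Set.Ioi 1))
          (nhds ((2 * π) ^ 2 * (u ^ 2 * (|psiIntegralError u| * Real.exp (-(1 - 1) * u))))) :=
    ((by fun_prop : Continuous fun σ : ℝ =>
      (2 * π) ^ 2 * (u ^ 2 * (|psiIntegralError u| * Real.exp (-(σ - 1) * u)))).tendsto 1).mono_left
      nhdsWithin_le_nhds
  have hle := le_of_tendsto hlim (by
    filter_upwards [Ioc_mem_nhdsGT (by norm_num : (1 : ℝ) < 2)] with σ hσ
    exact key u σ hσ.1 hσ.2)
  simp only [sub_self, neg_zero, zero_mul, Real.exp_zero, mul_one] at hle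
  have h5 : (1 : ℝ) ≤ (2 * π) ^ 2 := by
    have := Real.pi_gt_three
    nlinarith
  have h6 : 0 ≤ u ^ 2 * |psiIntegralError u| := by positivity
  nlinarith [le_abs_self K]

lemma exists_abs_psiIntegral_sub_mul_log_sq_le :
    ∃ K : ℝ, 0 < K ∧ ∀ x : ℝ, 1 ≤ x →
      |psiIntegral x - (x - 1) ^ 2 / 2| * Real.log x ^ 2 ≤ K * x ^ 2 := by
  obtain ⟨K, hK, h⟩ := exists_sq_mul_abs_psiIntegralError_le
  refine ⟨K, hK, fun x hx => ?_⟩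
  have hx0 : 0 < x := by linarith
  have h1 := h (Real.log x)
  have hE : Real.exp (-2 * Real.log x) = (x ^ 2)⁻¹ := by
    rw [show -2 * Real.log x = -(2 * Real.log x) by ring, Real.exp_neg, two_mul, Real.exp_add,
      Real.exp_log hx0, sq]
  rw [psiIntegralError, Real.exp_log hx0, max_eq_left (by linarith), hE, abs_mul,
    abs_of_pos (by positivity : (0 : ℝ) < (x ^ 2)⁻¹), ← div_eq_mul_inv, mul_div_assoc',
    div_le_iff₀ (by positivity)] at h1
  linarith

/-- The prime number theorem for `ψ` with error term `O(x / log x)`. -/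
lemma exists_abs_psi_sub_self_le :
    ∃ C : ℝ, 0 < C ∧ ∀ x : ℝ, 2 ≤ x → |Chebyshev.psi x - x| ≤ C * (x / Real.log x) := by
  obtain ⟨K, hK, h⟩ := exists_abs_psiIntegral_sub_mul_log_sq_le
  have hl4 : 0 ≤ Real.log 4 := Real.log_nonneg (by norm_num)
  refine ⟨(5 * K + 2) + 2 * (Real.log 4 + 5), by positivity, fun x hx => ?_⟩
  have hx0 : 0 < x := by linarith
  have hL0 : 0 < Real.log x := Real.log_pos (by linarith)
  have hdiv : 0 ≤ x / Real.log x := by positivity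
  rcases lt_or_ge (Real.log x) 2 with hL | hL
  · have h1 := Chebyshev.psi_le_const_mul_self hx0.le
    have h2 := Chebyshev.psi_nonneg x
    have h3 : x ≤ 2 * (x / Real.log x) := by
      rw [mul_div_assoc', le_div_iff₀ hL0]
      nlinarith
    have h4 : |Chebyshev.psi x - x| ≤ (Real.log 4 + 5) * x := by
      rw [abs_le]
      constructor <;> nlinarith
    nlinarith
  · have hx4 : 4 ≤ x := by
      have h1 : Real.exp 2 ≤ x := (Real.le_log_iff_exp_le hx0).1 hL
      have h2 : (4 : ℝ) ≤ Real.exp 2 := by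
        have := Real.exp_one_gt_d9
        rw [show (2 : ℝ) = 1 + 1 by norm_num, Real.exp_add]
        nlinarith
      linarith
    set L := Real.log x with hLdef
    set d := x / L with hd
    have hdL : d * L = x := by rw [hd]; field_simp
    have hd0 : 0 < d := by positivity
    have hd2 : d ≤ x / 2 := by rw [hd]; gcongr
    have hd1 : 1 ≤ d := by
      rw [hd, le_div_iff₀ hL0]
      linarith [Real.log_le_sub_one_of_pos hx0]
    have bd : ∀ y : ℝ, x / 2 ≤ y → |psiIntegral y - (y - 1) ^ 2 / 2| * L ^ 2 ≤ 4 * K * y ^ 2 := by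
      intro y hy
      have h1 := h y (by linarith)
      have h2 : L ≤ 2 * Real.log y := by
        rw [hLdef, show (2 : ℝ) * Real.log y = Real.log (y ^ 2) by rw [Real.log_pow]; norm_num]
        refine Real.log_le_log hx0 ?_
        nlinarith
      have h3 : L ^ 2 ≤ (2 * Real.log y) ^ 2 := by gcongr
      have := mul_le_mul_of_nonneg_left h3 (abs_nonneg (psiIntegral y - (y - 1) ^ 2 / 2))
      linarith
    have bd' : ∀ y : ℝ, x ≤ y → |psiIntegral y - (y - 1) ^ 2 / 2| * L ^ 2 ≤ K * y ^ 2 := by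
      intro y hy
      have h1 := h y (by linarith)
      have h2 : L ≤ Real.log y := Real.log_le_log hx0 hy
      have h3 : L ^ 2 ≤ (Real.log y) ^ 2 := by gcongr
      have := mul_le_mul_of_nonneg_left h3 (abs_nonneg (psiIntegral y - (y - 1) ^ 2 / 2))
      linarith
    have toD : ∀ {a c : ℝ}, |a| * L ^ 2 ≤ c * x ^ 2 → |a| ≤ c * d ^ 2 := by
      intro a c h1
      rw [← hdL] at h1
      have : 0 < L ^ 2 := by positivity
      nlinarith
    have b0 := abs_le.1 (toD (bd' x le_rfl))
    have b1 : |psiIntegral (x + d) - (x + d - 1) ^ 2 / 2| ≤ 4 * K * d ^ 2 := by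
      refine toD ((bd' (x + d) (by linarith)).trans ?_)
      rw [mul_comm 4 K, mul_assoc]
      gcongr
      nlinarith
    have b2 : |psiIntegral (x - d) - (x - d - 1) ^ 2 / 2| ≤ 4 * K * d ^ 2 := by
      refine toD ((bd (x - d) (by linarith)).trans ?_)
      gcongr
      · linarith
      · linarith
    have b1' := abs_le.1 b1
    have b2' := abs_le.1 b2
    have up := psi_mul_le_psiIntegral_sub hx0.le (by linarith : x ≤ x + d)
    have lo := psiIntegral_sub_le_psi_mul (by linarith : 0 ≤ x - d) (by linarith : x - d ≤ x)
    rw [add_sub_cancel_left] at up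
    rw [sub_sub_cancel] at lo
    have u1 : (Chebyshev.psi x - x) * d ≤ ((5 * K + 2) * d) * d := by nlinarith
    have l1 : (-((5 * K + 2) * d)) * d ≤ (Chebyshev.psi x - x) * d := by nlinarith
    have u2 := le_of_mul_le_mul_right u1 hd0
    have l2 := le_of_mul_le_mul_right l1 hd0
    rw [abs_le]
    constructor <;> nlinarith

/-- The prime number theorem for `θ` with error term `O(x / log x)`. -/
lemma exists_abs_theta_sub_self_le :
    ∃ C : ℝ, 0 < C ∧ ∀ x : ℝ, 2 ≤ x → |Chebyshev.theta x - x| ≤ C * (x / Real.log x) := by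
  obtain ⟨C, hC, h⟩ := exists_abs_psi_sub_self_le
  obtain ⟨D, hD⟩ := Chebyshev.psi_sub_theta_le_mul_sqrt
  refine ⟨C + 2 * |D|, by positivity, fun x hx => ?_⟩
  have hx0 : 0 < x := by linarith
  have hL0 : 0 < Real.log x := Real.log_pos (by linarith)
  have hs : √x ≤ 2 * (x / Real.log x) := by
    have h1 := Real.log_le_self (Real.sqrt_nonneg x)
    rw [Real.log_sqrt hx0.le] at h1
    rw [mul_div_assoc', le_div_iff₀ hL0]
    nlinarith [Real.sq_sqrt hx0.le, Real.sqrt_nonneg x]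
  have h1 := abs_le.1 (h x hx)
  have h2 := hD x
  have h3 := Chebyshev.theta_le_psi x
  have h4 : D * √x ≤ |D| * (2 * (x / Real.log x)) := by
    gcongr
    exact le_abs_self D
  have h5 : 0 ≤ |D| * (2 * (x / Real.log x)) := by positivity
  rw [abs_le]
  constructor <;> nlinarith

open MeasureTheory in
/-- Partial summation: `∑ y < p ≤ Y, log p / p ^ (β + 1)` is `∫ t in y..Y, t ^ (-β - 1)` up to
`O(y ^ (-β) / log y)`, uniformly in `Y`. -/
lemma exists_abs_sum_log_mul_rpow_sub_le {β : ℝ} (hβ : 0 < β) :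
    ∃ C : ℝ, 0 < C ∧ ∀ y Y : ℝ, 2 ≤ y → y ≤ Y →
      |∑ p ∈ Ioc ⌊y⌋₊ ⌊Y⌋₊ with p.Prime, Real.log p * (p : ℝ) ^ (-β - 1) -
        (y ^ (-β) - Y ^ (-β)) / β| ≤ C * (y ^ (-β) / Real.log y) := by
  obtain ⟨C, hC, h⟩ := exists_abs_theta_sub_self_le
  refine ⟨C * (2 + (β + 1) / β), by positivity, fun y Y hy hyY => ?_⟩
  have hy0 : 0 < y := by linarith
  have hY0 : 0 < Y := by linarith
  have hL : 0 < Real.log y := Real.log_pos (by linarith)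
  set L := Real.log y with hLdef
  set f : ℝ → ℝ := fun t => t ^ (-β - 1) with hf
  set c : ℕ → ℝ := fun k => if k.Prime then Real.log k else 0 with hc
  have hpos : ∀ t ∈ Set.Icc y Y, 0 < t := fun t ht => hy0.trans_le ht.1
  have hder : ∀ t ∈ Set.Icc y Y, HasDerivAt f ((-β - 1) * t ^ (-β - 2)) t := fun t ht => by
    have := Real.hasDerivAt_rpow_const (x := t) (p := -β - 1) (Or.inl (hpos t ht).ne')
    rwa [show -β - 1 - 1 = -β - 2 by ring] at this
  have hcont : ∀ r : ℝ, ContinuousOn (fun t : ℝ => t ^ r) (Set.Icc y Y) := fun r t ht =>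
    (Real.continuousAt_rpow_const t r (Or.inl (hpos t ht).ne')).continuousWithinAt
  have hdi : IntegrableOn (deriv f) (Set.Icc y Y) :=
    (((hcont (-β - 2)).const_mul (-β - 1)).integrableOn_Icc).congr_fun
      (fun t ht => (hder t ht).deriv.symm) measurableSet_Icc
  have htheta : ∀ t : ℝ, ∑ k ∈ Icc 0 ⌊t⌋₊, c k = Chebyshev.theta t := fun t => by
    rw [Chebyshev.theta_eq_sum_Icc, sum_filter]
  have habel := sum_mul_eq_sub_sub_integral_mul c hy0.le hyY
    (fun t ht => (hder t ht).differentiableAt) hdi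
  have hti := integrableOn_mul_sum_Icc (m := 0) c hy0.le hdi
  simp_rw [htheta] at habel hti
  have hsum : ∑ k ∈ Ioc ⌊y⌋₊ ⌊Y⌋₊, f k * c k =
      ∑ p ∈ Ioc ⌊y⌋₊ ⌊Y⌋₊ with p.Prime, Real.log p * (p : ℝ) ^ (-β - 1) := by
    rw [sum_filter]
    refine sum_congr rfl fun k _ => ?_
    simp only [hf, hc]
    split_ifs <;> ring
  have hii : ∀ r : ℝ, IntervalIntegrable (fun t : ℝ => t ^ r) volume y Y := fun r =>
    ContinuousOn.intervalIntegrable (by rw [Set.uIcc_of_le hyY]; exact hcont r)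
  have hmul : ∀ t : ℝ, 0 < t → ∀ r : ℝ, t ^ (r - 1) * t = t ^ r := fun t ht r => by
    rw [← Real.rpow_add_one ht.ne']; ring_nf
  have hgInt : ∫ t in y..Y, t ^ (-β - 1) = (y ^ (-β) - Y ^ (-β)) / β := by
    rw [integral_rpow (Or.inr ⟨by linarith, by
      rw [Set.uIcc_of_le hyY]
      exact fun h0 => (hpos 0 h0).ne' rfl⟩), show -β - 1 + 1 = -β by ring]
    field_simp
    ring
  have hrem : |∫ t in y..Y, deriv f t * (Chebyshev.theta t - t)| ≤
      C * (β + 1) / L * ((y ^ (-β) - Y ^ (-β)) / β) := by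
    rw [← hgInt, ← intervalIntegral.integral_const_mul, ← Real.norm_eq_abs]
    refine intervalIntegral.norm_integral_le_of_norm_le hyY (Eventually.of_forall fun t ht => ?_)
      ((hii _).const_mul _)
    have ht' : t ∈ Set.Icc y Y := ⟨ht.1.le, ht.2⟩
    have ht0 := hpos t ht'
    rw [(hder t ht').deriv, Real.norm_eq_abs, abs_mul, abs_mul,
      abs_of_nonneg (Real.rpow_nonneg ht0.le _), abs_of_neg (by linarith : -β - 1 < 0)]
    have h1 : |Chebyshev.theta t - t| ≤ C * (t / L) := by
      refine (h t (hy.trans ht'.1)).trans ?_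
      have : L ≤ Real.log t := Real.log_le_log hy0 ht'.1
      gcongr
    calc -(-β - 1) * t ^ (-β - 2) * |Chebyshev.theta t - t|
        ≤ -(-β - 1) * t ^ (-β - 2) * (C * (t / L)) := by
          gcongr
          have := Real.rpow_pos_of_pos ht0 (-β - 2)
          nlinarith
      _ = C * (β + 1) / L * (t ^ (-β - 2) * t) := by ring
      _ = C * (β + 1) / L * t ^ (-β - 1) := by
          rw [← hmul t ht0 (-β - 1)]; ring_nf
  have hid : ∫ t in y..Y, deriv f t * t = (-β - 1) * ((y ^ (-β) - Y ^ (-β)) / β) := by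
    rw [← hgInt, ← intervalIntegral.integral_const_mul]
    refine intervalIntegral.integral_congr fun t ht => ?_
    rw [Set.uIcc_of_le hyY] at ht
    rw [(hder t ht).deriv, ← hmul t (hpos t ht) (-β - 1)]
    ring_nf
  have hsplit : ∫ t in y..Y, deriv f t * (Chebyshev.theta t - t) =
      (∫ t in Set.Ioc y Y, deriv f t * Chebyshev.theta t) - ∫ t in y..Y, deriv f t * t := by
    rw [← intervalIntegral.integral_of_le hyY, ← intervalIntegral.integral_sub]
    · simp_rw [mul_sub]
    · rw [intervalIntegrable_iff_integrableOn_Icc_of_le hyY]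
      exact hti
    · rw [intervalIntegrable_iff_integrableOn_Icc_of_le hyY]
      exact hdi.mul_continuousOn continuousOn_id isCompact_Icc
  have hend : ∀ t ∈ Set.Icc y Y, |f t * (Chebyshev.theta t - t)| ≤ C * (y ^ (-β) / L) := by
    intro t ht
    have ht0 := hpos t ht
    have h1 : |Chebyshev.theta t - t| ≤ C * (t / L) := by
      refine (h t (hy.trans ht.1)).trans ?_
      have : L ≤ Real.log t := Real.log_le_log hy0 ht.1
      gcongr
    have h2 : t ^ (-β) ≤ y ^ (-β) := Real.rpow_le_rpow_of_nonpos hy0 ht.1 (by linarith)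
    rw [abs_mul, abs_of_nonneg (Real.rpow_nonneg ht0.le _)]
    calc f t * |Chebyshev.theta t - t| ≤ f t * (C * (t / L)) := by
          gcongr
      _ = C * ((t ^ (-β - 1) * t) / L) := by simp only [hf]; ring
      _ ≤ C * (y ^ (-β) / L) := by
          rw [hmul t ht0]
          gcongr
  have hfy : f y * y = y ^ (-β) := hmul y hy0 (-β)
  have hfY : f Y * Y = Y ^ (-β) := hmul Y hY0 (-β)
  have b1 := abs_le.1 (hend y ⟨le_rfl, hyY⟩)
  have b2 := abs_le.1 (hend Y ⟨hyY, le_rfl⟩)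
  have hYpos : 0 < Y ^ (-β) := Real.rpow_pos_of_pos hY0 _
  have b3 : |∫ t in y..Y, deriv f t * (Chebyshev.theta t - t)| ≤
      C * ((β + 1) / β) * (y ^ (-β) / L) := by
    refine hrem.trans ?_
    calc C * (β + 1) / L * ((y ^ (-β) - Y ^ (-β)) / β) ≤ C * (β + 1) / L * (y ^ (-β) / β) := by
          gcongr; linarith
      _ = _ := by field_simp
  have b3' := abs_le.1 b3
  have heq : ∑ k ∈ Ioc ⌊y⌋₊ ⌊Y⌋₊, f k * c k - (y ^ (-β) - Y ^ (-β)) / β =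
      f Y * (Chebyshev.theta Y - Y) - f y * (Chebyshev.theta y - y) -
        ∫ t in y..Y, deriv f t * (Chebyshev.theta t - t) := by
    rw [hsplit, hid, habel, mul_sub, mul_sub, hfy, hfY]
    field_simp
    ring
  rw [← hsum, heq, abs_le]
  constructor <;> linarith

lemma abs_one_div_add_mul_sub_sq_sub_le {h v : ℝ} (hh : 0 < h) (hv : 0 ≤ v) (hvh : v ≤ h / 2) :
    |1 / ((h + v) * (h - v) ^ 2) - 1 / h ^ 3| ≤ 5 * v / h ^ 4 := by
  have hsub : h / 2 ≤ h - v := by linarith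
  have hD : h ^ 3 / 4 ≤ (h + v) * (h - v) ^ 2 := by
    calc h ^ 3 / 4 = h * (h / 2) ^ 2 := by ring
      _ ≤ (h + v) * (h - v) ^ 2 := by gcongr; linarith
  have hD0 : 0 < (h + v) * (h - v) ^ 2 := lt_of_lt_of_le (by positivity) hD
  have heq : 1 / ((h + v) * (h - v) ^ 2) - 1 / h ^ 3 =
      v * (h ^ 2 + v * (h - v)) / ((h + v) * (h - v) ^ 2 * h ^ 3) := by
    have h1 : h - v ≠ 0 := by linarith
    have h2 : h + v ≠ 0 := by linarith
    field_simp
    ring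
  have hnum : 0 ≤ v * (h ^ 2 + v * (h - v)) := by
    have : 0 ≤ h - v := by linarith
    positivity
  rw [heq, abs_of_nonneg (by positivity)]
  calc v * (h ^ 2 + v * (h - v)) / ((h + v) * (h - v) ^ 2 * h ^ 3)
      ≤ v * (5 / 4 * h ^ 2) / (h ^ 3 / 4 * h ^ 3) := by
        gcongr
        nlinarith [sq_nonneg (h / 2 - v)]
    _ = 5 * v / h ^ 4 := by field_simp

lemma filter_Icc_two_eq_filter_Ioc_floor {y : ℝ} (hy : 0 ≤ y) (N : ℕ) :
    (Icc 2 N).filter (fun p : ℕ => p.Prime ∧ y < (p : ℝ)) = {p ∈ Ioc ⌊y⌋₊ N | p.Prime} := by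
  ext p
  simp only [Finset.mem_filter, Finset.mem_Icc, Finset.mem_Ioc, Nat.floor_lt hy]
  constructor
  · rintro ⟨⟨-, h1⟩, h2, h3⟩
    exact ⟨⟨h3, h1⟩, h2⟩
  · rintro ⟨⟨h3, h1⟩, h2⟩
    exact ⟨⟨h2.two_le, h1⟩, h2, h3⟩

lemma eventually_mul_log_log_le (c : ℝ) :
    ∀ᶠ x : ℝ in atTop, c * Real.log (Real.log x) ≤ Real.log x / 4 := by
  have h1 := (Real.isLittleO_log_id_atTop.const_mul_left c).comp_tendsto Real.tendsto_log_atTop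
  filter_upwards [h1.bound (by norm_num : (0 : ℝ) < 1 / 4), eventually_ge_atTop 1] with x hx hx1
  simp only [Function.comp_apply, id_eq, Real.norm_eq_abs,
    abs_of_nonneg (Real.log_nonneg hx1)] at hx
  linarith [le_abs_self (c * Real.log (Real.log x))]

/-- For `α > 0`,
`Σ_{√x < p ≤ √x (log x)^{4/α}} 1/(p^{2α+1} (log(x/p))²)
  = (4/α)·1/(x^α log³x) + O(1/(x^α log⁴x))`, the sum ranging over primes. -/
theorem prime_sum_inverse_log_sq_asymptotic (α : ℝ) (hα : 0 < α) :
    (fun x : ℝ =>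
        (∑ p ∈ (Finset.Icc 2 ⌊Real.sqrt x * Real.log x ^ ((4:ℝ) / α)⌋₊).filter
            (fun p : ℕ => p.Prime ∧ Real.sqrt x < (p : ℝ)),
          1 / ((p : ℝ) ^ (2 * α + 1) * Real.log (x / (p : ℝ)) ^ 2))
        - (4 / α) * (1 / (x ^ α * Real.log x ^ 3)))
      =O[atTop] (fun x : ℝ => 1 / (x ^ α * Real.log x ^ 4)) := by
  obtain ⟨C₁, hC₁, h₁⟩ := exists_abs_sum_log_mul_rpow_sub_le (β := 2 * α) (by positivity)
  obtain ⟨C₂, hC₂, h₂⟩ := exists_abs_sum_log_mul_rpow_sub_le hα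
  refine Asymptotics.IsBigO.of_bound
    (80 * (1 / α * (1 / α + C₂)) + 8 * (1 / (2 * α) + 2 * C₁)) ?_
  filter_upwards [eventually_mul_log_log_le (4 / α), eventually_ge_atTop (4 : ℝ),
    Real.tendsto_log_atTop.eventually_ge_atTop 2] with x hlog hx hL2
  have hx0 : 0 < x := by linarith
  set L := Real.log x with hL
  set y := √x with hy
  have hL0 : 0 < L := by linarith
  have hy2 : 2 ≤ y := Real.le_sqrt_of_sq_le (by linarith)
  have hy0 : 0 < y := by linarith
  have hlogy : Real.log y = L / 2 := Real.log_sqrt hx0.le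
  have hLα : 1 ≤ L ^ (4 / α) := Real.one_le_rpow (by linarith) (by positivity)
  set Y := y * L ^ (4 / α) with hY
  have hyY : y ≤ Y := le_mul_of_one_le_right hy0.le hLα
  have hlogY : Real.log Y = L / 2 + 4 / α * Real.log L := by
    rw [hY, Real.log_mul hy0.ne' (by positivity), hlogy, Real.log_rpow hL0]
  have hyα : y ^ (-(2 * α)) = (x ^ α)⁻¹ := by
    rw [hy, Real.sqrt_eq_rpow, ← Real.rpow_mul hx0.le, ← Real.rpow_neg hx0.le]
    ring_nf
  have hyα' : y ^ (-α) * y ^ (-α) = (x ^ α)⁻¹ := by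
    rw [← hyα, ← Real.rpow_add hy0]
    ring_nf
  have hX : 0 < (x ^ α)⁻¹ := by positivity
  set X := (x ^ α)⁻¹ with hXdef
  have hYα : Y ^ (-(2 * α)) ≤ X / L := by
    have hL8 : (L ^ (4 / α)) ^ (-(2 * α)) ≤ L ^ (-1 : ℝ) := by
      rw [← Real.rpow_mul hL0.le, show 4 / α * -(2 * α) = -8 by field_simp; norm_num]
      exact Real.rpow_le_rpow_of_exponent_le (by linarith) (by norm_num)
    rw [hY, Real.mul_rpow hy0.le (by positivity), hyα, div_eq_mul_inv X, ← Real.rpow_neg_one L]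
    exact mul_le_mul_of_nonneg_left hL8 hX.le
  rw [filter_Icc_two_eq_filter_Ioc_floor hy0.le]
  set P := {p ∈ Ioc ⌊y⌋₊ ⌊Y⌋₊ | p.Prime} with hP
  have hmem : ∀ p ∈ P, y < (p : ℝ) ∧ (p : ℝ) ≤ Y := by
    intro p hp
    rw [hP, Finset.mem_filter, Finset.mem_Ioc, Nat.floor_lt hy0.le,
      Nat.le_floor_iff (hy0.le.trans hyY)] at hp
    exact hp.1
  have hA := h₁ y Y hy2 hyY
  have hB := (abs_le.1 (h₂ y Y hy2 hyY)).2
  rw [← hP] at hA hB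
  have hterm : ∀ p ∈ P, |1 / ((p : ℝ) ^ (2 * α + 1) * Real.log (x / p) ^ 2) -
      8 / L ^ 3 * (Real.log p * (p : ℝ) ^ (-(2 * α) - 1))| ≤
        80 / L ^ 4 * (1 / α * y ^ (-α) * (Real.log p * (p : ℝ) ^ (-α - 1))) := by
    intro p hp
    obtain ⟨hyp, hpY⟩ := hmem p hp
    have hp0 : (0 : ℝ) < p := hy0.trans hyp
    have hlogp0 : 0 < Real.log p := Real.log_pos (by linarith)
    set v := Real.log p - L / 2 with hv
    have hv0 : 0 ≤ v := by
      have := Real.log_le_log hy0 hyp.le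
      linarith
    have hv1 : v ≤ L / 2 / 2 := by
      have := Real.log_le_log hp0 hpY
      linarith
    have hlp : Real.log p = L / 2 + v := by rw [hv]; ring
    have hvα : v ≤ 1 / α * ((p : ℝ) ^ α * y ^ (-α)) := by
      have h3 : v = Real.log (p / y) := by rw [Real.log_div hp0.ne' hy0.ne', hlogy]
      have h4 := Real.log_le_rpow_div (div_pos hp0 hy0).le hα
      rw [Real.div_rpow hp0.le hy0.le, ← h3] at h4
      rw [Real.rpow_neg hy0.le]
      exact h4.trans_eq (by ring)
    have hxp : Real.log (x / p) = L / 2 - v := by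
      rw [Real.log_div hx0.ne' hp0.ne', hlp]; ring
    have hpow : (p : ℝ) ^ (-(2 * α) - 1) = ((p : ℝ) ^ (2 * α + 1))⁻¹ := by
      rw [← Real.rpow_neg hp0.le]; ring_nf
    have ha : 0 < Real.log p * (p : ℝ) ^ (-(2 * α) - 1) := by positivity
    have hmain := abs_one_div_add_mul_sub_sq_sub_le (half_pos hL0) hv0 hv1
    have heq : 1 / ((p : ℝ) ^ (2 * α + 1) * Real.log (x / p) ^ 2) -
        8 / L ^ 3 * (Real.log p * (p : ℝ) ^ (-(2 * α) - 1)) =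
        (Real.log p * (p : ℝ) ^ (-(2 * α) - 1)) *
          (1 / ((L / 2 + v) * (L / 2 - v) ^ 2) - 1 / (L / 2) ^ 3) := by
      have h5 : L / 2 - v ≠ 0 := by linarith
      rw [hpow, hxp, ← hlp]
      field_simp
      ring
    rw [heq, abs_mul, abs_of_pos ha]
    calc Real.log p * (p : ℝ) ^ (-(2 * α) - 1) *
          |1 / ((L / 2 + v) * (L / 2 - v) ^ 2) - 1 / (L / 2) ^ 3|
        ≤ Real.log p * (p : ℝ) ^ (-(2 * α) - 1) *
          (5 * (1 / α * ((p : ℝ) ^ α * y ^ (-α))) / (L / 2) ^ 4) := by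
          refine mul_le_mul_of_nonneg_left (hmain.trans ?_) ha.le
          gcongr
      _ = 80 / L ^ 4 * (1 / α * y ^ (-α) *
          (Real.log p * ((p : ℝ) ^ (-(2 * α) - 1) * (p : ℝ) ^ α))) := by
          field_simp
          ring
      _ = _ := by
          rw [← Real.rpow_add hp0]
          ring_nf
  have hsum : |∑ p ∈ P, 1 / ((p : ℝ) ^ (2 * α + 1) * Real.log (x / p) ^ 2) -
      8 / L ^ 3 * ∑ p ∈ P, Real.log p * (p : ℝ) ^ (-(2 * α) - 1)| ≤
        80 / L ^ 4 * (1 / α * (1 / α + C₂) * X) := by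
    rw [mul_sum, ← sum_sub_distrib]
    refine (abs_sum_le_sum_abs _ _).trans ((sum_le_sum hterm).trans ?_)
    rw [← mul_sum, ← mul_sum, ← hyα']
    have hyp : 0 < y ^ (-α) := by positivity
    have hb : ∑ p ∈ P, Real.log p * (p : ℝ) ^ (-α - 1) ≤ (1 / α + C₂) * y ^ (-α) := by
      have hYp : 0 < Y ^ (-α) := Real.rpow_pos_of_pos (hy0.trans_le hyY) _
      have h6 : (y ^ (-α) - Y ^ (-α)) / α ≤ y ^ (-α) / α := by gcongr; linarith
      have h7 : y ^ (-α) / Real.log y ≤ y ^ (-α) := div_le_self hyp.le (by linarith)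
      have h8 : C₂ * (y ^ (-α) / Real.log y) ≤ C₂ * y ^ (-α) := by gcongr
      rw [add_mul, one_div_mul_eq_div]
      linarith
    calc 80 / L ^ 4 * (1 / α * y ^ (-α) * ∑ p ∈ P, Real.log p * (p : ℝ) ^ (-α - 1))
        ≤ 80 / L ^ 4 * (1 / α * y ^ (-α) * ((1 / α + C₂) * y ^ (-α))) := by gcongr
      _ = _ := by ring
  have hA' : |∑ p ∈ P, Real.log p * (p : ℝ) ^ (-(2 * α) - 1) - X / (2 * α)| ≤
      (1 / (2 * α) + 2 * C₁) * (X / L) := by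
    rw [hyα, hlogy] at hA
    have hYp : 0 < Y ^ (-(2 * α)) := Real.rpow_pos_of_pos (hy0.trans_le hyY) _
    have h9 : |(X - Y ^ (-(2 * α))) / (2 * α) - X / (2 * α)| ≤ 1 / (2 * α) * (X / L) := by
      rw [← sub_div, sub_sub_cancel_left, abs_div, abs_neg, abs_of_pos hYp,
        abs_of_pos (by positivity : 0 < 2 * α), one_div_mul_eq_div]
      gcongr
    have h10 : C₁ * (X / (L / 2)) = 2 * C₁ * (X / L) := by field_simp
    have := abs_sub_le (∑ p ∈ P, Real.log p * (p : ℝ) ^ (-(2 * α) - 1))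
      ((X - Y ^ (-(2 * α))) / (2 * α)) (X / (2 * α))
    linarith
  rw [Real.norm_eq_abs, Real.norm_eq_abs, abs_of_pos (by positivity : 0 < 1 / (x ^ α * L ^ 4))]
  have hM : 4 / α * (1 / (x ^ α * L ^ 3)) = 8 / L ^ 3 * (X / (2 * α)) := by
    rw [hXdef]
    field_simp
    norm_num
  have hR : 1 / (x ^ α * L ^ 4) = X / L ^ 4 := by
    rw [hXdef]
    field_simp
  rw [hM, hR]
  have h11 : |8 / L ^ 3 * ∑ p ∈ P, Real.log p * (p : ℝ) ^ (-(2 * α) - 1) -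
      8 / L ^ 3 * (X / (2 * α))| ≤ 8 * (1 / (2 * α) + 2 * C₁) * (X / L ^ 4) := by
    rw [← mul_sub, abs_mul, abs_of_pos (by positivity : 0 < 8 / L ^ 3)]
    refine (mul_le_mul_of_nonneg_left hA' (by positivity)).trans_eq ?_
    field_simp
  have h12 : 80 / L ^ 4 * (1 / α * (1 / α + C₂) * X) =
      80 * (1 / α * (1 / α + C₂)) * (X / L ^ 4) := by ring
  have := abs_sub_le (∑ p ∈ P, 1 / ((p : ℝ) ^ (2 * α + 1) * Real.log (x / p) ^ 2))
    (8 / L ^ 3 * ∑ p ∈ P, Real.log p * (p : ℝ) ^ (-(2 * α) - 1)) (8 / L ^ 3 * (X / (2 * α)))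
  rw [add_mul]
  linarith
end
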